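/- Let G be a finite simple graph of maximum degree at most 3 that does not contain H2 (the graph obtained from K4 by subdividing one edge) as a subgraph. Then the circular chromatic index of G is at most 11/3; equivalently, the line graph L(G) admits an (11,3)-coloring. -/

import Mathlib

open SimpleGraph

/-- A `(p,q)`-coloring of a simple graph `H`: a function into `{0,...,p-1}` such that
adjacent vertices `x, y` satisfy `q ≤ |f x - f y| ≤ p - q`. -/
def IsPQColoring {V : Type*} (H : SimpleGraph V) (p q : ℕ) (f : V → ℕ) : Prop :=
  (∀ v, f v < p) ∧
    ∀ x y, H.Adj x y → (q : ℤ) ≤ |(f x : ℤ) - (f y : ℤ)| ∧ |(f x : ℤ) - (f y : ℤ)| ≤ (p : ℤ) - q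

/-- The graph `H₂` obtained from `K₄` by subdividing one edge:
vertices `a = 0, b = 1, c = 2, d = 3, s = 4`, edges `ac, ad, bc, bd, cd, as, sb`. -/
def H2 : SimpleGraph (Fin 5) :=
  SimpleGraph.fromRel (fun x y =>
    (x, y) ∈ ({(0, 2), (0, 3), (1, 2), (1, 3), (2, 3), (0, 4), (1, 4)} : Set (Fin 5 × Fin 5)))

/-- `G` contains `H` as a subgraph: there is an injective map of the vertices of `H` into
the vertices of `G` preserving adjacency. -/
def ContainsSubgraph {W V : Type*} (H : SimpleGraph W) (G : SimpleGraph V) : Prop :=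
  ∃ f : W → V, Function.Injective f ∧ ∀ x y, H.Adj x y → G.Adj (f x) (f y)

namespace CCI

/-- circular distance at least `3` in `ℤ/11`. -/
def Far (a b : ZMod 11) : Prop := 3 ≤ (a - b).val ∧ (a - b).val ≤ 8

instance (a b : ZMod 11) : Decidable (Far a b) := by unfold Far; infer_instance

theorem Far.symm {a b : ZMod 11} (h : Far a b) : Far b a := by
  revert a b; decide

theorem Far.refl_sub (r : ZMod 11) {a b : ZMod 11} (h : Far a b) : Far (r - a) (r - b) := by
  have : (r - a) - (r - b) = b - a := by ring
  have h2 := h.symm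
  unfold Far at *
  rw [this]; exact h2

theorem Far.add_right (r : ZMod 11) {a b : ZMod 11} (h : Far a b) : Far (a + r) (b + r) := by
  unfold Far at *
  rw [add_sub_add_right_eq_sub]; exact h

theorem exists_far2 : ∀ a b : ZMod 11, Far a b → ∃ c, Far c a ∧ Far c b := by decide

theorem exists_far1 : ∀ a : ZMod 11, ∃ c, Far c a := by decide

set_option linter.unusedSectionVars false

section Cyc

variable {E : Type*} [Fintype E] [DecidableEq E]

/-- The cycle of `σ` through `e` can be edge coloured, given the colours `m` of the hanging edges. -/
def Good (σ : Equiv.Perm E) (m : E → ZMod 11) (e : E) : Prop :=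
  ∃ x : E → ZMod 11, ∀ f, σ.SameCycle e f →
    Far (x (σ⁻¹ f)) (x f) ∧ Far (m f) (x f) ∧ Far (m f) (x (σ⁻¹ f))

theorem Good.of_inv {σ : Equiv.Perm E} {m : E → ZMod 11} {e : E} (h : Good σ⁻¹ m e) :
    Good σ m e := by
  obtain ⟨x, hx⟩ := h
  refine ⟨fun f => x (σ f), fun f hf => ?_⟩
  have h1 := hx f (Equiv.Perm.sameCycle_inv.2 hf)
  simp only [inv_inv] at h1
  have h2 : σ (σ⁻¹ f) = f := σ.apply_symm_apply f
  simp only [h2]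
  exact ⟨h1.1.symm, h1.2.2, h1.2.1⟩

theorem Good.mirror {σ : Equiv.Perm E} {m : E → ZMod 11} {e : E} (r : ZMod 11) (h : Good σ m e) :
    Good σ (fun f => r - m f) e := by
  obtain ⟨x, hx⟩ := h
  refine ⟨fun f => r - x f, fun f hf => ?_⟩
  obtain ⟨h1, h2, h3⟩ := hx f hf
  exact ⟨h1.refl_sub r, h2.refl_sub r, h3.refl_sub r⟩

theorem Good.congr {σ : Equiv.Perm E} {m m' : E → ZMod 11} {e : E} (h : Good σ m e)
    (hm : ∀ f, σ.SameCycle e f → m f = m' f) : Good σ m' e := by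
  obtain ⟨x, hx⟩ := h
  refine ⟨x, fun f hf => ?_⟩
  rw [← hm f hf]; exact hx f hf

theorem Good.same {σ : Equiv.Perm E} {m : E → ZMod 11} {e e' : E} (h : Good σ m e)
    (he : σ.SameCycle e e') : Good σ m e' := by
  obtain ⟨x, hx⟩ := h
  exact ⟨x, fun f hf => hx f (he.trans hf)⟩

theorem good_of_seq {σ : Equiv.Perm E} {m : E → ZMod 11} {e : E} (n : ℕ)
    (hn : Function.minimalPeriod σ e = n) (hn0 : 1 < n) (y : ℕ → ZMod 11)
    (h1 : ∀ i, i + 1 < n → Far (y i) (y (i + 1))) (h2 : Far (y (n - 1)) (y 0))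
    (h3 : ∀ i < n, Far (m ((σ ^ i) e)) (y i))
    (h4 : ∀ i, i + 1 < n → Far (m ((σ ^ (i + 1)) e)) (y i)) (h5 : Far (m e) (y (n - 1))) :
    Good σ m e := by
  have key : ∀ f, σ.SameCycle e f → ∃ i < n, (σ ^ i) e = f := by
    intro f hf
    obtain ⟨i, hi⟩ := hf.exists_nat_pow_eq
    refine ⟨i % n, Nat.mod_lt _ (by omega), ?_⟩
    rw [← hi, Equiv.Perm.coe_pow, Equiv.Perm.coe_pow, ← hn, Function.iterate_mod_minimalPeriod_eq]
  have inj : ∀ i < n, ∀ j < n, (σ ^ i) e = (σ ^ j) e → i = j := by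
    intro i hi j hj h
    rw [Equiv.Perm.coe_pow, Equiv.Perm.coe_pow] at h
    rw [← hn] at hi hj
    exact (Function.iterate_eq_iterate_iff_of_lt_minimalPeriod hi hj).1 h
  have hper : (σ ^ n) e = e := by
    rw [Equiv.Perm.coe_pow, ← hn]; exact Function.isPeriodicPt_minimalPeriod _ _
  classical
  let x : E → ZMod 11 := fun f => if h : ∃ i, i < n ∧ (σ ^ i) e = f then y h.choose else 0
  have hx : ∀ i < n, x ((σ ^ i) e) = y i := by
    intro i hi
    have h : ∃ j, j < n ∧ (σ ^ j) e = (σ ^ i) e := ⟨i, hi, rfl⟩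
    have : x ((σ ^ i) e) = y h.choose := by simp only [x]; rw [dif_pos h]
    rw [this, inj _ h.choose_spec.1 _ hi h.choose_spec.2]
  refine ⟨x, fun f hf => ?_⟩
  obtain ⟨i, hi, rfl⟩ := key f hf
  rcases i with _ | i
  · have : σ⁻¹ ((σ ^ 0) e) = (σ ^ (n - 1)) e := by
      rw [Equiv.Perm.inv_eq_iff_eq, ← Equiv.Perm.mul_apply, ← pow_succ', Nat.sub_add_cancel (by omega), hper]
      simp
    rw [this, hx _ hi, hx _ (by omega)]
    refine ⟨h2, h3 0 hi, ?_⟩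
    simpa using h5
  · have : σ⁻¹ ((σ ^ (i + 1)) e) = (σ ^ i) e := by
      rw [Equiv.Perm.inv_eq_iff_eq, ← Equiv.Perm.mul_apply, ← pow_succ']
    rw [this, hx _ hi, hx _ (by omega)]
    exact ⟨h1 i hi, h3 _ hi, h4 _ hi⟩

/-- window condition -/
def Win (α a0 a1 a2 a3 a4 : ZMod 11) : Prop :=
  Far a0 α ∧ Far a4 α ∧ ∃ w0, Far α w0 ∧ Far a0 w0 ∧ Far a1 w0 ∧
  ∃ w1, Far w0 w1 ∧ Far a1 w1 ∧ Far a2 w1 ∧ ∃ w2, Far w1 w2 ∧ Far a2 w2 ∧ Far a3 w2 ∧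
  ∃ w3, Far w2 w3 ∧ Far a3 w3 ∧ Far a4 w3 ∧ Far w3 α

instance (α a0 a1 a2 a3 a4 : ZMod 11) : Decidable (Win α a0 a1 a2 a3 a4) := by
  unfold Win; infer_instance

theorem good_win' {σ : Equiv.Perm E} {m : E → ZMod 11} {e : E}
    (ho : Odd (Function.minimalPeriod σ e)) (h5 : 5 ≤ Function.minimalPeriod σ e)
    (α β : ZMod 11) (hab : Far α β)
    (hw : Win α (m e) (m (σ e)) (m (σ (σ e))) (m (σ (σ (σ e)))) (m (σ (σ (σ (σ e))))))
    (hr : ∀ f, σ.SameCycle e f → f ≠ e → f ≠ σ e → f ≠ σ (σ e) → f ≠ σ (σ (σ e)) →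
      f ≠ σ (σ (σ (σ e))) → Far (m f) α ∧ Far (m f) β) : Good σ m e := by
  obtain ⟨n, hn⟩ : ∃ n, Function.minimalPeriod σ e = n := ⟨_, rfl⟩
  rw [hn] at ho h5
  have inj : ∀ i < n, ∀ j < n, (σ ^ i) e = (σ ^ j) e → i = j := by
    intro i hi j hj h
    rw [Equiv.Perm.coe_pow, Equiv.Perm.coe_pow] at h
    rw [← hn] at hi hj
    exact (Function.iterate_eq_iterate_iff_of_lt_minimalPeriod hi hj).1 h
  obtain ⟨ha0, ha4, w0, f1, f2, f3, w1, f4, f5, f6, w2, f7, f8, f9, w3, f10, f11, f12, f13⟩ := hw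
  have e1 : σ e = (σ ^ 1) e := by simp
  have e2 : σ (σ e) = (σ ^ 2) e := rfl
  have e3 : σ (σ (σ e)) = (σ ^ 3) e := rfl
  have e4 : σ (σ (σ (σ e))) = (σ ^ 4) e := rfl
  rw [e4] at ha4 f12
  rw [e1] at f3 f5
  rw [e2] at f6 f8
  rw [e3] at f9 f11
  have hr' : ∀ i, i < n → 5 ≤ i → Far (m ((σ ^ i) e)) α ∧ Far (m ((σ ^ i) e)) β := by
    intro i hi h5i
    refine hr _ ⟨i, by simp⟩ ?_ ?_ ?_ ?_ ?_
    · intro h; have := inj i hi 0 (by omega) (by simpa using h); omega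
    · rw [e1]; intro h; have := inj i hi 1 (by omega) h; omega
    · rw [e2]; intro h; have := inj i hi 2 (by omega) h; omega
    · rw [e3]; intro h; have := inj i hi 3 (by omega) h; omega
    · rw [e4]; intro h; have := inj i hi 4 (by omega) h; omega
  let y : ℕ → ZMod 11 := fun i => if i = 0 then w0 else if i = 1 then w1 else if i = 2 then w2
    else if i = 3 then w3 else if i % 2 = 0 then α else β
  have yE : ∀ i, 4 ≤ i → i % 2 = 0 → y i = α := by
    intro i hi h
    simp only [y]
    rw [if_neg (by omega), if_neg (by omega), if_neg (by omega), if_neg (by omega), if_pos h]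
  have yO : ∀ i, 4 ≤ i → i % 2 = 1 → y i = β := by
    intro i hi h
    simp only [y]
    rw [if_neg (by omega), if_neg (by omega), if_neg (by omega), if_neg (by omega), if_neg (by omega)]
  have y0 : y 0 = w0 := rfl
  have y1 : y 1 = w1 := rfl
  have y2 : y 2 = w2 := rfl
  have y3 : y 3 = w3 := rfl
  have y4 : y 4 = α := rfl
  have ylast : y (n - 1) = α := yE _ (by omega) (by obtain ⟨k, hk⟩ := ho; omega)
  refine good_of_seq n hn (by omega) y ?_ ?_ ?_ ?_ ?_
  · intro i hi
    rcases i with _ | _ | _ | _ | i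
    · rw [y0, y1]; exact f4
    · rw [y1, y2]; exact f7
    · rw [y2, y3]; exact f10
    · rw [y3, y4]; exact f13
    · rcases Nat.mod_two_eq_zero_or_one i with h | h
      · rw [yE _ (by omega) (by omega), yO _ (by omega) (by omega)]; exact hab
      · rw [yO _ (by omega) (by omega), yE _ (by omega) (by omega)]; exact hab.symm
  · rw [ylast, y0]; exact f1
  · intro i hi
    rcases i with _ | _ | _ | _ | _ | i
    · simpa [y0] using f2
    · rw [y1]; exact f5
    · rw [y2]; exact f8
    · rw [y3]; exact f11
    · rw [y4]; exact ha4
    · have := hr' (i + 5) hi (by omega)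
      rcases Nat.mod_two_eq_zero_or_one i with h | h
      · rw [yO _ (by omega) (by omega)]; exact this.2
      · rw [yE _ (by omega) (by omega)]; exact this.1
  · intro i hi
    rcases i with _ | _ | _ | _ | i
    · rw [y0]; exact f3
    · rw [y1]; exact f6
    · rw [y2]; exact f9
    · rw [y3]; exact f12
    · have := hr' (i + 5) hi (by omega)
      rcases Nat.mod_two_eq_zero_or_one i with h | h
      · rw [yE _ (by omega) (by omega)]; exact this.1
      · rw [yO _ (by omega) (by omega)]; exact this.2
  · rw [ylast]; simpa using ha0

theorem minimalPeriod_inv (σ : Equiv.Perm E) (e : E) :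
    Function.minimalPeriod (σ⁻¹ : Equiv.Perm E) e = Function.minimalPeriod σ e := by
  refine Function.minimalPeriod_eq_minimalPeriod_iff.2 fun n => ?_
  unfold Function.IsPeriodicPt Function.IsFixedPt
  rw [← Equiv.Perm.coe_pow, ← Equiv.Perm.coe_pow, inv_pow, Equiv.Perm.inv_eq_iff_eq]
  exact eq_comm

theorem minimalPeriod_same (σ : Equiv.Perm E) {e f : E} (h : σ.SameCycle e f) :
    Function.minimalPeriod σ e = Function.minimalPeriod σ f := by
  obtain ⟨i, hi⟩ := h
  refine Function.minimalPeriod_eq_minimalPeriod_iff.2 fun n => ?_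
  unfold Function.IsPeriodicPt Function.IsFixedPt
  rw [← Equiv.Perm.coe_pow, ← hi, ← Equiv.Perm.mul_apply]
  have : σ ^ n * σ ^ i = σ ^ i * σ ^ n := by
    rw [← zpow_natCast, ← zpow_add, ← zpow_add, add_comm]
  rw [this, Equiv.Perm.mul_apply]
  exact (Equiv.injective _).eq_iff.symm

/-- window lemma in either direction -/
theorem good_win {σ τ : Equiv.Perm E} (hτ : τ = σ ∨ τ = σ⁻¹) {m : E → ZMod 11} {e : E}
    (ho : Odd (Function.minimalPeriod σ e)) (h5 : 5 ≤ Function.minimalPeriod σ e)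
    (α β : ZMod 11) (hab : Far α β)
    (hw : Win α (m e) (m (τ e)) (m (τ (τ e))) (m (τ (τ (τ e)))) (m (τ (τ (τ (τ e))))))
    (hr : ∀ f, σ.SameCycle e f → f ≠ e → f ≠ τ e → f ≠ τ (τ e) → f ≠ τ (τ (τ e)) →
      f ≠ τ (τ (τ (τ e))) → Far (m f) α ∧ Far (m f) β) : Good σ m e := by
  rcases hτ with rfl | rfl
  · exact good_win' ho h5 α β hab hw hr
  · refine Good.of_inv (good_win' (σ := σ⁻¹) ?_ ?_ α β hab hw ?_)
    · rwa [minimalPeriod_inv]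
    · rwa [minimalPeriod_inv]
    · intro f hf; exact hr f (Equiv.Perm.sameCycle_inv.1 hf)

theorem win_P3 : ∀ a2 a3 a4 : ZMod 11, (a2 = 1 ∨ a2 = 2) → (a3 = 1 ∨ a3 = 2) →
    (a4 = 1 ∨ a4 = 2 ∨ a4 = 3) → Win 9 3 3 a2 a3 a4 ∨ Win 6 3 3 a2 a3 a4 := by
  decide +kernel

theorem win_P0 : ∀ a2 a3 a4 : ZMod 11, (a2 = 1 ∨ a2 = 2) → (a3 = 1 ∨ a3 = 2) →
    (a4 = 0 ∨ a4 = 1 ∨ a4 = 2) → Win 5 0 0 a2 a3 a4 ∨ Win 8 0 0 a2 a3 a4 := by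
  decide +kernel

theorem win_P2 : ∀ a1 a2 a3 a4 : ZMod 11, (a1 = 2 ∨ a1 = 4) → (a2 = 0 ∨ a2 = 1) →
    (a3 = 0 ∨ a3 = 1) →
    (a4 = 0 ∨ a4 = 1 ∨ a4 = 2) → Win 5 2 a1 a2 a3 a4 ∨ Win 8 2 a1 a2 a3 a4 := by
  decide +kernel

theorem win_B : ∀ a2 a3 a4 : ZMod 11, (a2 = 0 ∨ a2 = 1 ∨ a2 = 2) → (a3 = 0 ∨ a3 = 1 ∨ a3 = 2) →
    (a4 = 0 ∨ a4 = 1 ∨ a4 = 2) → Win 5 4 9 a2 a3 a4 ∨ Win 8 4 9 a2 a3 a4 := by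
  decide +kernel

theorem win_D : ∀ a0 a4 : ZMod 11, (a0 = 0 ∨ a0 = 1) →
    (a4 = 0 ∨ a4 = 1 ∨ a4 = 2) → Win 5 a0 1 3 2 a4 ∨ Win 8 a0 1 3 2 a4 := by
  decide +kernel

theorem win_D9 : ∀ a0 a4 : ZMod 11, (a0 = 1 ∨ a0 = 2) →
    (a4 = 0 ∨ a4 = 1 ∨ a4 = 2) → Win 5 a0 1 9 0 a4 ∨ Win 8 a0 1 9 0 a4 := by
  decide +kernel

theorem win_E : ∀ a4 : ZMod 11, 
    (a4 = 0 ∨ a4 = 1) → Win 7 3 2 3 1 a4 := by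
  decide +kernel

end Cyc
end CCI

namespace CCI
set_option linter.unusedSectionVars false
section Sol

variable {E : Type*} [Fintype E] [DecidableEq E]

/-- membership in the list attached to a label: `true` is `{1,2}`, `false` is `{0,1}`. -/
def inL (b : Bool) (z : ZMod 11) : Prop := z = 1 ∨ z = if b then 2 else 0

theorem inL_true {z : ZMod 11} (h : inL true z) : z = 1 ∨ z = 2 := by simpa [inL] using h
theorem inL_false {z : ZMod 11} (h : inL false z) : z = 0 ∨ z = 1 := by
  have : z = 1 ∨ z = 0 := by simpa [inL] using h
  tauto

theorem inL_not (b : Bool) {z : ZMod 11} (h : inL b z) : inL (!b) (2 - z) := by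
  cases b <;> simp only [inL] at * <;> rcases h with rfl | rfl <;> decide

/-- hypotheses on a `σ`-closed set of ends. -/
structure Sys (σ : Equiv.Perm E) (μ : E → E) (U : Finset E) : Prop where
  inv : ∀ e, μ (μ e) = e
  closed : ∀ e f, σ.SameCycle e f → e ∈ U → f ∈ U
  odd : ∀ e ∈ U, Odd (Function.minimalPeriod σ e)
  five : ∀ e ∈ U, 5 ≤ Function.minimalPeriod σ e
  noadj : ∀ e ∈ U, μ e ≠ σ e
  seven : ∀ e ∈ U, μ e ≠ e → σ.SameCycle e (μ e) → 7 ≤ Function.minimalPeriod σ e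

/-- solvability of the labelled system on `U`. -/
def Solv (σ : Equiv.Perm E) (μ : E → E) (U : Finset E) (ℓ : E → Bool) : Prop :=
  ∃ m : E → ZMod 11, (∀ e ∈ U, μ e ∈ U → m (μ e) = m e) ∧
    (∀ e ∈ U, (μ e ∉ U ∨ μ e = e) → inL (ℓ e) (m e)) ∧ ∀ e ∈ U, Good σ m e

theorem Solv.mirror {σ : Equiv.Perm E} {μ : E → E} {U : Finset E} {ℓ : E → Bool}
    (h : Solv σ μ U (fun e => !ℓ e)) : Solv σ μ U ℓ := by
  obtain ⟨m, h1, h2, h3⟩ := h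
  refine ⟨fun e => 2 - m e, fun e he hm => ?_, fun e he hx => ?_, fun e he => (h3 e he).mirror 2⟩
  · simp only [h1 e he hm]
  · have := inL_not _ (h2 e he hx)
    simpa using this

theorem step {σ : Equiv.Perm E} {μ : E → E} {U : Finset E} (S : Sys σ μ U) {ℓ : E → Bool}
    (IH : ∀ U', U' ⊂ U → Sys σ μ U' → ∀ ℓ', Solv σ μ U' ℓ')
    (K : Finset E) (hKU : K ⊆ U) (hne : K.Nonempty)
    (hKc : ∀ e f, σ.SameCycle e f → e ∈ K → f ∈ K) (m0 : E → ZMod 11) (ℓ' : E → Bool)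
    (h1 : ∀ e ∈ K, μ e ∈ K → m0 (μ e) = m0 e)
    (h2 : ∀ e ∈ K, (μ e ∉ U ∨ μ e = e) → inL (ℓ e) (m0 e))
    (h3 : ∀ m : E → ZMod 11, (∀ e ∈ K, (μ e ∈ U ∧ μ e ∉ K → inL (ℓ' e) (m e)) ∧
      (¬ (μ e ∈ U ∧ μ e ∉ K) → m e = m0 e)) → ∀ e ∈ K, Good σ m e) : Solv σ μ U ℓ := by
  have hss : U \ K ⊂ U := by
    refine Finset.ssubset_iff_subset_ne.2 ⟨Finset.sdiff_subset, fun h => ?_⟩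
    obtain ⟨k, hk⟩ := hne
    have : k ∈ U \ K := by rw [h]; exact hKU hk
    exact (Finset.mem_sdiff.1 this).2 hk
  have hcl : ∀ e f, σ.SameCycle e f → e ∈ U \ K → f ∈ U \ K := by
    intro e f hef he
    rw [Finset.mem_sdiff] at he ⊢
    exact ⟨S.closed e f hef he.1, fun hf => he.2 (hKc f e hef.symm hf)⟩
  have hS : Sys σ μ (U \ K) := by
    have hm : ∀ e, e ∈ U \ K → e ∈ U := fun e he => (Finset.mem_sdiff.1 he).1
    exact ⟨S.inv, hcl, fun e he => S.odd e (hm e he), fun e he => S.five e (hm e he),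
      fun e he => S.noadj e (hm e he), fun e he => S.seven e (hm e he)⟩
  obtain ⟨m', g1, g2, g3⟩ := IH _ hss hS (fun e => if μ e ∈ K then ℓ' (μ e) else ℓ e)
  let m : E → ZMod 11 := fun e =>
    if e ∈ K then (if μ e ∈ U ∧ μ e ∉ K then m' (μ e) else m0 e) else m' e
  have mK : ∀ e ∈ K, m e = if μ e ∈ U ∧ μ e ∉ K then m' (μ e) else m0 e := by
    intro e he; simp only [m]; rw [if_pos he]
  have mN : ∀ e, e ∉ K → m e = m' e := by
    intro e he; simp only [m]; rw [if_neg he]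
  refine ⟨m, ?_, ?_, ?_⟩
  · intro e he hme
    by_cases hK : e ∈ K
    · by_cases hK2 : μ e ∈ K
      · rw [mK _ hK, mK _ hK2, S.inv, if_neg (by tauto), if_neg (by tauto)]
        exact h1 e hK hK2
      · rw [mK _ hK, mN _ hK2, if_pos (by tauto)]
    · by_cases hK2 : μ e ∈ K
      · rw [mN _ hK, mK _ hK2, S.inv, if_pos (by tauto)]
      · rw [mN _ hK, mN _ hK2]
        exact g1 e (Finset.mem_sdiff.2 ⟨he, hK⟩) (Finset.mem_sdiff.2 ⟨hme, hK2⟩)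
  · intro e he hx
    by_cases hK : e ∈ K
    · rw [mK _ hK, if_neg ?_]
      · exact h2 e hK hx
      · rintro ⟨a, b⟩
        rcases hx with hx | hx
        · exact hx a
        · rw [hx] at b; exact b hK
    · rw [mN _ hK]
      have h := g2 e (Finset.mem_sdiff.2 ⟨he, hK⟩) ?_
      · beta_reduce at h
        rw [if_neg] at h
        · exact h
        · intro hk
          rcases hx with hx | hx
          · exact hx (hKU hk)
          · rw [hx] at hk; exact hK hk
      · rcases hx with hx | hx
        · left; intro h; exact hx (Finset.mem_sdiff.1 h).1
        · right; exact hx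
  · intro e he
    by_cases hK : e ∈ K
    · refine h3 m ?_ e hK
      intro f hf
      refine ⟨fun hx => ?_, fun hx => ?_⟩
      · rw [mK _ hf, if_pos hx]
        have h := g2 (μ f) (Finset.mem_sdiff.2 hx) ?_
        · simp only [S.inv] at h
          rwa [if_pos hf] at h
        · left; rw [S.inv]; intro h; exact (Finset.mem_sdiff.1 h).2 hf
      · rw [mK _ hf, if_neg hx]
    · have hd := Finset.mem_sdiff.2 ⟨he, hK⟩
      refine (g3 e hd).congr fun f hf => ?_
      rw [mN _ (Finset.mem_sdiff.1 (hcl e f hf hd)).2]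

/-- `τ` is one of the two directions. -/
def Dir (σ τ : Equiv.Perm E) : Prop := τ = σ ∨ τ = σ⁻¹

theorem Dir.inv {σ τ : Equiv.Perm E} (h : Dir σ τ) : Dir σ τ⁻¹ := by
  rcases h with rfl | rfl
  · right; rfl
  · left; simp

theorem Dir.sc {σ τ : Equiv.Perm E} (h : Dir σ τ) (e : E) : σ.SameCycle e (τ e) := by
  rcases h with rfl | rfl
  · exact ⟨1, by simp⟩
  · exact ⟨-1, by simp⟩

theorem Dir.sc_right {σ τ : Equiv.Perm E} (h : Dir σ τ) {e f : E} (hf : σ.SameCycle e f) :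
    σ.SameCycle e (τ f) := hf.trans (h.sc f)

theorem Dir.period {σ τ : Equiv.Perm E} (h : Dir σ τ) (e : E) :
    Function.minimalPeriod τ e = Function.minimalPeriod σ e := by
  rcases h with rfl | rfl
  · rfl
  · exact minimalPeriod_inv _ _

theorem Dir.pow_ne {σ τ : Equiv.Perm E} (h : Dir σ τ) (e : E) (k : ℕ) (hk : 0 < k)
    (hk2 : k < Function.minimalPeriod σ e) : (τ ^ k) e ≠ e := by
  intro he
  rw [← h.period] at hk2
  rw [Equiv.Perm.coe_pow] at he
  exact Function.not_isPeriodicPt_of_pos_of_lt_minimalPeriod (by omega) hk2 he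

theorem nsc {σ : Equiv.Perm E} {e f g : E} (h : ¬ σ.SameCycle e f) (hg : σ.SameCycle e g) :
    ¬ σ.SameCycle g f := fun h' => h (hg.trans h')

theorem Dir.ne1 {σ τ : Equiv.Perm E} (h : Dir σ τ) (e : E)
    (h5 : 5 ≤ Function.minimalPeriod σ e) : τ e ≠ e :=
  h.pow_ne e 1 (by omega) (by omega)
theorem Dir.ne2 {σ τ : Equiv.Perm E} (h : Dir σ τ) (e : E)
    (h5 : 5 ≤ Function.minimalPeriod σ e) : τ (τ e) ≠ e :=
  h.pow_ne e 2 (by omega) (by omega)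
theorem Dir.ne3 {σ τ : Equiv.Perm E} (h : Dir σ τ) (e : E)
    (h5 : 5 ≤ Function.minimalPeriod σ e) : τ (τ (τ e)) ≠ e :=
  h.pow_ne e 3 (by omega) (by omega)
theorem Dir.ne4 {σ τ : Equiv.Perm E} (h : Dir σ τ) (e : E)
    (h5 : 5 ≤ Function.minimalPeriod σ e) : τ (τ (τ (τ e))) ≠ e :=
  h.pow_ne e 4 (by omega) (by omega)

theorem val_rest {b : Bool} {z : ZMod 11} (h : inL b z) : z = 0 ∨ z = 1 ∨ z = 2 := by
  cases b
  · rcases inL_false h with h | h <;> tauto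
  · rcases inL_true h with h | h <;> tauto

theorem far012 : ∀ z : ZMod 11, (z = 0 ∨ z = 1 ∨ z = 2) → Far z 5 ∧ Far z 8 := by decide
theorem far123 : ∀ z : ZMod 11, (z = 1 ∨ z = 2 ∨ z = 3) → Far z 6 ∧ Far z 9 := by decide
theorem far01 : ∀ z : ZMod 11, (z = 0 ∨ z = 1) → Far z 7 ∧ Far z 4 := by decide

/-- window, frame `5/8`. -/
theorem good58 {σ τ : Equiv.Perm E} (hτ : Dir σ τ) {m : E → ZMod 11} {e : E}
    (ho : Odd (Function.minimalPeriod σ e)) (h5 : 5 ≤ Function.minimalPeriod σ e)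
    (hw : Win 5 (m e) (m (τ e)) (m (τ (τ e))) (m (τ (τ (τ e)))) (m (τ (τ (τ (τ e))))) ∨
      Win 8 (m e) (m (τ e)) (m (τ (τ e))) (m (τ (τ (τ e)))) (m (τ (τ (τ (τ e))))))
    (hr : ∀ f, σ.SameCycle e f → f ≠ e → f ≠ τ e → f ≠ τ (τ e) → f ≠ τ (τ (τ e)) →
      f ≠ τ (τ (τ (τ e))) → m f = 0 ∨ m f = 1 ∨ m f = 2) : Good σ m e := by
  rcases hw with hw | hw
  · exact good_win hτ ho h5 5 8 (by decide) hw fun f a b c d e g => far012 _ (hr f a b c d e g)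
  · exact good_win hτ ho h5 8 5 (by decide) hw fun f a b c d e g => (far012 _ (hr f a b c d e g)).symm

theorem good69 {σ τ : Equiv.Perm E} (hτ : Dir σ τ) {m : E → ZMod 11} {e : E}
    (ho : Odd (Function.minimalPeriod σ e)) (h5 : 5 ≤ Function.minimalPeriod σ e)
    (hw : Win 9 (m e) (m (τ e)) (m (τ (τ e))) (m (τ (τ (τ e)))) (m (τ (τ (τ (τ e))))) ∨
      Win 6 (m e) (m (τ e)) (m (τ (τ e))) (m (τ (τ (τ e)))) (m (τ (τ (τ (τ e))))))
    (hr : ∀ f, σ.SameCycle e f → f ≠ e → f ≠ τ e → f ≠ τ (τ e) → f ≠ τ (τ (τ e)) →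
      f ≠ τ (τ (τ (τ e))) → m f = 1 ∨ m f = 2 ∨ m f = 3) : Good σ m e := by
  rcases hw with hw | hw
  · exact good_win hτ ho h5 9 6 (by decide) hw fun f a b c d e g => (far123 _ (hr f a b c d e g)).symm
  · exact good_win hτ ho h5 6 9 (by decide) hw fun f a b c d e g => far123 _ (hr f a b c d e g)

/-- shapes for the value-3 lemma -/
def ShP (σ : Equiv.Perm E) (S3 : Finset E) (e : E) : Prop :=
  ∃ e0 τ, Dir σ τ ∧ σ.SameCycle e e0 ∧ e0 ∈ S3 ∧ τ e0 ∈ S3 ∧ τ (τ e0) ∉ S3 ∧ τ (τ (τ e0)) ∉ S3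

def ShD (σ : Equiv.Perm E) (NL : E → Prop) (S3 S2 : Finset E) (e : E) : Prop :=
  ∃ g τ, Dir σ τ ∧ σ.SameCycle e g ∧ g ∉ S3 ∧ g ∉ S2 ∧ τ g ∉ S3 ∧ τ g ∉ S2 ∧ NL (τ g) ∧
    τ (τ g) ∈ S3 ∧ τ (τ (τ g)) ∈ S2 ∧ τ (τ (τ g)) ∉ S3 ∧
    ∀ f, σ.SameCycle g f → f ∈ S3 → f = τ (τ g)

def ShE (σ : Equiv.Perm E) (NL : E → Prop) (S3 S2 : Finset E) (e : E) : Prop :=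
  ∃ e0 τ, Dir σ τ ∧ σ.SameCycle e e0 ∧ e0 ∈ S3 ∧ τ e0 ∈ S2 ∧ τ e0 ∉ S3 ∧ τ (τ e0) ∈ S3 ∧
    τ (τ (τ e0)) ∉ S3 ∧ τ (τ (τ e0)) ∉ S2 ∧ NL (τ (τ (τ e0))) ∧
    (∀ f, σ.SameCycle e0 f → f ∈ S3 → f = e0 ∨ f = τ (τ e0)) ∧
    ∀ f, σ.SameCycle e0 f → f ∈ S2 → f = τ e0

theorem core3 {σ : Equiv.Perm E} {μ : E → E} {U : Finset E} (S : Sys σ μ U) {ℓ : E → Bool}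
    (IH : ∀ U', U' ⊂ U → Sys σ μ U' → ∀ ℓ', Solv σ μ U' ℓ')
    (K : Finset E) (hKU : K ⊆ U) (hne : K.Nonempty)
    (hKc : ∀ e f, σ.SameCycle e f → e ∈ K → f ∈ K) (S3 S2 : Finset E)
    (i3 : ∀ e ∈ S3, μ e ∈ K ∧ μ e ∈ S3 ∧ μ e ≠ e)
    (i2 : ∀ e ∈ S2, e ∈ K → μ e ∈ K → μ e ∈ S2)
    (i2n : ∀ e ∈ S2, e ∈ K → (μ e ∈ K ∨ μ e ∉ U))
    (i2x : ∀ e ∈ S2, e ∈ K → (μ e ∉ U ∨ μ e = e) → ℓ e = true)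
    (sh : ∀ e ∈ K, ShP σ S3 e ∨ ShD σ (fun f => μ f ∈ K ∨ μ f ∉ U) S3 S2 e ∨
      ShE σ (fun f => μ f ∈ K ∨ μ f ∉ U) S3 S2 e) : Solv σ μ U ℓ := by
  classical
  let m0 : E → ZMod 11 := fun e => if e ∈ S3 then 3 else if e ∈ S2 then 2 else 1
  have m03 : ∀ e ∈ S3, m0 e = 3 := fun e he => by simp only [m0]; rw [if_pos he]
  have m02 : ∀ e ∈ S2, e ∉ S3 → m0 e = 2 := fun e he hn => by
    simp only [m0]; rw [if_neg hn, if_pos he]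
  have m01 : ∀ e, e ∉ S3 → e ∉ S2 → m0 e = 1 := fun e he hn => by
    simp only [m0]; rw [if_neg he, if_neg hn]
  have i3' : ∀ e, μ e ∈ S3 → e ∈ S3 := fun e he => by
    have := (i3 _ he).2.1; rwa [S.inv] at this
  refine step S IH K hKU hne hKc m0 (fun e => decide (ShP σ S3 e)) ?_ ?_ ?_
  · intro e he hm
    by_cases h3 : e ∈ S3
    · rw [m03 e h3, m03 _ (i3 e h3).2.1]
    · have h3' : μ e ∉ S3 := fun h => h3 (i3' _ h)
      by_cases h2 : e ∈ S2
      · rw [m02 e h2 h3, m02 _ (i2 e h2 he hm) h3']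
      · rw [m01 e h3 h2, m01 _ h3' ?_]
        intro h
        have := i2 _ h hm (by rwa [S.inv])
        rw [S.inv] at this; exact h2 this
  · intro e he hx
    have h3 : e ∉ S3 := by
      intro h
      obtain ⟨a, b, c⟩ := i3 e h
      rcases hx with hx | hx
      · exact hx (hKU a)
      · exact c hx
    by_cases h2 : e ∈ S2
    · rw [m02 e h2 h3, i2x e h2 he hx]; right; rfl
    · rw [m01 e h3 h2]; left; rfl
  · intro m hm e he
    have v3 : ∀ f ∈ K, f ∈ S3 → m f = 3 := by
      intro f hf h
      rw [(hm f hf).2 (fun h' => h'.2 (i3 f h).1), m03 f h]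
    have v2 : ∀ f ∈ K, f ∈ S2 → f ∉ S3 → m f = 2 := by
      intro f hf h h3
      rw [(hm f hf).2 ?_, m02 f h h3]
      have := i2n f h hf
      tauto
    have v1 : ∀ f ∈ K, f ∉ S3 → f ∉ S2 → (μ f ∈ K ∨ μ f ∉ U) → m f = 1 := by
      intro f hf h h3 h'
      rw [(hm f hf).2 ?_, m01 f h h3]
      tauto
    have v1' : ∀ f ∈ K, f ∉ S3 → f ∉ S2 → inL (decide (ShP σ S3 f)) (m f) := by
      intro f hf h h3
      by_cases h' : (μ f ∈ K ∨ μ f ∉ U)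
      · rw [v1 f hf h h3 h']; left; rfl
      · exact (hm f hf).1 (by tauto)
    have shP_same : ∀ f g, σ.SameCycle f g → ShP σ S3 f → ShP σ S3 g := by
      rintro f g hfg ⟨e0, τ, a, b, c⟩
      exact ⟨e0, τ, a, hfg.symm.trans b, c⟩
    by_cases hP : ShP σ S3 e
    · have v : ∀ f, σ.SameCycle e f → f ∉ S3 → m f = 1 ∨ m f = 2 := by
        intro f hf h3
        have hfK := hKc e f hf he
        by_cases h2 : f ∈ S2
        · right; exact v2 f hfK h2 h3
        · have := v1' f hfK h3 h2
          have hp := shP_same e f hf hP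
          rw [decide_eq_true hp] at this
          exact inL_true this
      have v' : ∀ f, σ.SameCycle e f → m f = 1 ∨ m f = 2 ∨ m f = 3 := by
        intro f hf
        by_cases h3 : f ∈ S3
        · right; right; exact v3 f (hKc e f hf he) h3
        · have := v f hf h3; tauto
      obtain ⟨e0, τ, hτ, hs, a0, a1, a2, a3⟩ := hP
      have hs1 := hτ.sc_right hs
      have hs2 := hτ.sc_right hs1
      have hs3 := hτ.sc_right hs2
      have hs4 := hτ.sc_right hs3
      have h0 := S.closed e e0 hs (hKU he)
      refine (good69 hτ (S.odd _ h0) (S.five _ h0) ?_ ?_).same hs.symm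
      · rw [v3 _ (hKc _ _ hs he) a0, v3 _ (hKc _ _ hs1 he) a1]
        exact win_P3 _ _ _ (v _ hs2 a2) (v _ hs3 a3) (v' _ hs4)
      · intro f hf _ _ _ _ _
        exact v' f (hs.trans hf)
    · have v : ∀ f, σ.SameCycle e f → f ∉ S3 → f ∉ S2 → m f = 0 ∨ m f = 1 := by
        intro f hf h3 h2
        have hfK := hKc e f hf he
        have := v1' f hfK h3 h2
        have hp : ¬ ShP σ S3 f := fun h => hP (shP_same f e hf.symm h)
        rw [decide_eq_false hp] at this
        exact inL_false this
      have v' : ∀ f, σ.SameCycle e f → f ∉ S3 → m f = 0 ∨ m f = 1 ∨ m f = 2 := by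
        intro f hf h3
        by_cases h2 : f ∈ S2
        · right; right; exact v2 f (hKc e f hf he) h2 h3
        · have := v f hf h3 h2; tauto
      rcases sh e he with h | h | h
      · exact absurd h hP
      · obtain ⟨g, τ, hτ, hs, a0, b0, a1, b1, n1, a2, b3, a3, hall⟩ := h
        have hs1 := hτ.sc_right hs
        have hs2 := hτ.sc_right hs1
        have hs3 := hτ.sc_right hs2
        have hs4 := hτ.sc_right hs3
        have h0 := S.closed e g hs (hKU he)
        have p := S.five _ h0
        refine (good58 hτ (S.odd _ h0) (S.five _ h0) ?_ ?_).same hs.symm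
        · rw [v1 _ (hKc _ _ hs1 he) a1 b1 n1, v3 _ (hKc _ _ hs2 he) a2,
            v2 _ (hKc _ _ hs3 he) b3 a3]
          refine win_D _ _ (v _ hs a0 b0) (v' _ hs4 fun h => ?_)
          have := hall _ (hs.symm.trans hs4) h
          exact hτ.ne2 _ ((minimalPeriod_same σ (hs.symm.trans hs2)) ▸ p) this
        · intro f hf _ _ h2 _ _
          exact v' f (hs.trans hf) fun h => h2 (hall f hf h)
      · obtain ⟨e0, τ, hτ, hs, a0, b1, a1, a2, a3, b3, n3, hall, hall2⟩ := h
        have hs1 := hτ.sc_right hs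
        have hs2 := hτ.sc_right hs1
        have hs3 := hτ.sc_right hs2
        have hs4 := hτ.sc_right hs3
        have h0 := S.closed e e0 hs (hKU he)
        have p := S.five _ h0
        have p2 := p
        rw [minimalPeriod_same σ (hs.symm.trans hs2)] at p2
        have p1 := p
        rw [minimalPeriod_same σ (hs.symm.trans hs1)] at p1
        refine (good_win hτ (S.odd _ h0) (S.five _ h0) 7 4 (by decide) ?_ ?_).same hs.symm
        · rw [v3 _ (hKc _ _ hs he) a0, v2 _ (hKc _ _ hs1 he) b1 a1, v3 _ (hKc _ _ hs2 he) a2,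
            v1 _ (hKc _ _ hs3 he) a3 b3 n3]
          refine win_E _ (v _ hs4 (fun h => ?_) (fun h => ?_))
          · rcases hall _ (hs.symm.trans hs4) h with h | h
            · exact hτ.ne4 _ p h
            · exact hτ.ne2 _ p2 h
          · exact hτ.ne3 _ p1 (hall2 _ (hs.symm.trans hs4) h)
        · intro f hf q0 q1 q2 _ _
          refine far01 _ (v f (hs.trans hf) (fun h => ?_) (fun h => q1 (hall2 f hf h)))
          rcases hall f hf h with h | h
          · exact q0 h
          · exact q2 h

end Sol
end CCI

namespace CCI
set_option linter.unusedSectionVars false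
set_option linter.unusedSimpArgs false
section Tr

variable {E : Type*} [Fintype E] [DecidableEq E]

def Link (σ : Equiv.Perm E) (μ : E → E) (U : Finset E) (e : E) : Prop :=
  e ∈ U ∧ μ e ∈ U ∧ ¬ σ.SameCycle e (μ e)

def Chord (σ : Equiv.Perm E) (μ : E → E) (U : Finset E) (e : E) : Prop :=
  e ∈ U ∧ μ e ∈ U ∧ μ e ≠ e ∧ σ.SameCycle e (μ e)

def Ext (μ : E → E) (U : Finset E) (e : E) : Prop := e ∈ U ∧ (μ e ∉ U ∨ μ e = e)

theorem tri (σ : Equiv.Perm E) (μ : E → E) (U : Finset E) {e : E} (he : e ∈ U) :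
    Link σ μ U e ∨ Chord σ μ U e ∨ Ext μ U e := by
  unfold Link Chord Ext
  tauto

theorem Link.ne {σ : Equiv.Perm E} {μ : E → E} {U : Finset E} {e : E} (h : Link σ μ U e) :
    μ e ≠ e := fun h' => h.2.2 (by rw [h'])

theorem Link.mu {σ : Equiv.Perm E} {μ : E → E} {U : Finset E} (S : Sys σ μ U) {e : E}
    (h : Link σ μ U e) : Link σ μ U (μ e) :=
  ⟨h.2.1, by rw [S.inv]; exact h.1, by rw [S.inv]; exact fun h' => h.2.2 h'.symm⟩

theorem Link.not_ext {σ : Equiv.Perm E} {μ : E → E} {U : Finset E} {e : E} (h : Link σ μ U e) :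
    ¬ Ext μ U e := by
  have := h.ne
  rcases h with ⟨_, h, _⟩
  rintro ⟨_, h' | h'⟩ <;> tauto

structure Trail (σ : Equiv.Perm E) (μ : E → E) (U : Finset E) (T : Finset E) (a b : E) : Prop where
  ha : a ∈ T
  hb : b ∈ T
  hab : ¬ σ.SameCycle a b
  link : ∀ e ∈ T, Link σ μ U e ∧ μ e ∈ T
  onea : ∀ e ∈ T, σ.SameCycle a e → e = a
  oneb : ∀ e ∈ T, σ.SameCycle b e → e = b
  mid : ∀ e ∈ T, ¬ σ.SameCycle a e → ¬ σ.SameCycle b e →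
    ∃ τ, Dir σ τ ∧ τ e ∈ T ∧ ∀ f ∈ T, σ.SameCycle e f → f = e ∨ f = τ e

theorem Trail.swap {σ : Equiv.Perm E} {μ : E → E} {U T : Finset E} {a b : E}
    (h : Trail σ μ U T a b) : Trail σ μ U T b a :=
  ⟨h.hb, h.ha, fun h' => h.hab h'.symm, h.link, h.oneb, h.onea, fun e he h1 h2 => h.mid e he h2 h1⟩

def NonExt (σ : Equiv.Perm E) (μ : E → E) (U T : Finset E) (c : E) : Prop :=
  ∀ τ, Dir σ τ → Link σ μ U (τ c) → ∃ t ∈ T, σ.SameCycle t (μ (τ c))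

open Classical in
noncomputable def KT (σ : Equiv.Perm E) (U T : Finset E) : Finset E :=
  U.filter fun e => ∃ t ∈ T, σ.SameCycle t e

theorem mem_KT {σ : Equiv.Perm E} {U T : Finset E} {e : E} :
    e ∈ KT σ U T ↔ e ∈ U ∧ ∃ t ∈ T, σ.SameCycle t e := by
  unfold KT; rw [Finset.mem_filter]

def Plan (σ : Equiv.Perm E) (μ : E → E) (U : Finset E) (ℓ : E → Bool) (c : E)
    (A B B' : Finset E) : Prop :=
  (∃ τ, Dir σ τ ∧ Chord σ μ U (τ c) ∧ A = {τ c, μ (τ c)} ∧ B = ∅) ∨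
  (∃ τ g, Dir σ τ ∧ c = τ (τ g) ∧
    ((Ext μ U (τ (τ (τ g))) ∧ ℓ (τ (τ (τ g))) = true) ∨ Link σ μ U (τ (τ (τ g)))) ∧
    A = ∅ ∧ B = {τ (τ (τ g)), μ (τ (τ (τ g)))} ∧ τ g ∉ B' ∧ g ∉ B')

theorem NonExt.nl {σ : Equiv.Perm E} {μ : E → E} {U T : Finset E} {c : E} (h : NonExt σ μ U T c)
    (hc : c ∈ T) (S : Sys σ μ U) (hU : c ∈ U) {τ : Equiv.Perm E} (hτ : Dir σ τ) :
    μ (τ c) ∈ KT σ U T ∨ μ (τ c) ∉ U := by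
  have h0 : τ c ∈ U := S.closed _ _ (hτ.sc c) hU
  rcases tri σ μ U h0 with h1 | h1 | h1
  · left; exact mem_KT.2 ⟨h1.2.1, h τ hτ h1⟩
  · left; exact mem_KT.2 ⟨h1.2.1, c, hc, (hτ.sc c).trans h1.2.2.2⟩
  · rcases h1.2 with h2 | h2
    · right; exact h2
    · left; rw [h2]; exact mem_KT.2 ⟨h0, c, hc, hτ.sc c⟩

theorem sc_iff {σ τ : Equiv.Perm E} (h : Dir σ τ) {e f : E} :
    σ.SameCycle e (τ f) ↔ σ.SameCycle e f :=
  ⟨fun h' => h'.trans (h.sc f).symm, fun h' => h.sc_right h'⟩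

theorem inv_app (τ : Equiv.Perm E) (e : E) : τ⁻¹ (τ e) = e := τ.symm_apply_apply e
theorem app_inv (τ : Equiv.Perm E) (e : E) : τ (τ⁻¹ e) = e := τ.apply_symm_apply e

/-- two consecutive `S3` ends plus at most one chord partner -/
theorem shP_chord {σ : Equiv.Perm E} {τ : Equiv.Perm E} (hτ : Dir σ τ) {S3 : Finset E} {c d : E}
    (h7 : 7 ≤ Function.minimalPeriod σ c) (hc : c ∈ S3) (hc' : τ c ∈ S3)
    (hall : ∀ f, σ.SameCycle c f → f ∈ S3 → f = c ∨ f = τ c ∨ f = d) : ShP σ S3 c := by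
  have pw := fun (e : E) (he : σ.SameCycle c e) (k : ℕ) (hk : 0 < k) (hk2 : k < 7) =>
    hτ.pow_ne e k hk (by rw [← minimalPeriod_same σ he]; omega)
  obtain ⟨b, rfl⟩ : ∃ b, c = τ (τ b) := ⟨τ⁻¹ (τ⁻¹ c), by simp [app_inv]⟩
  have sb : σ.SameCycle (τ (τ b)) b := (hτ.sc_right (hτ.sc b)).symm
  have sb1 := hτ.sc_right sb
  have N1 : τ b ≠ b := pw _ sb 1 (by omega) (by omega)
  have N2 : τ (τ b) ≠ b := pw _ sb 2 (by omega) (by omega)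
  have N3 : τ (τ (τ b)) ≠ b := pw _ sb 3 (by omega) (by omega)
  have N4 : τ (τ (τ (τ b))) ≠ b := pw _ sb 4 (by omega) (by omega)
  have N5 : τ (τ (τ (τ (τ b)))) ≠ b := pw _ sb 5 (by omega) (by omega)
  by_cases hd : d = τ (τ (τ (τ b))) ∨ d = τ (τ (τ (τ (τ b))))
  · refine ⟨τ (τ (τ b)), τ⁻¹, hτ.inv, hτ.sc _, hc', ?_, ?_, ?_⟩
    · rw [inv_app]; exact hc
    · rw [inv_app, inv_app]
      intro h
      have := hall _ sb1 h
      rcases hd with rfl | rfl <;>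
        simp [N1, N2, N3, N4, N5, N1.symm, N2.symm, N3.symm, N4.symm, N5.symm] at this
    · rw [inv_app, inv_app, inv_app]
      intro h
      have := hall _ sb h
      rcases hd with rfl | rfl <;>
        simp [N1, N2, N3, N4, N5, N1.symm, N2.symm, N3.symm, N4.symm, N5.symm] at this
  · refine ⟨τ (τ b), τ, hτ, .refl _ _, hc, hc', ?_, ?_⟩
    · intro h
      have := hall _ ((hτ.sc_right (hτ.sc _))) h
      push Not at hd
      simp [N1, N2, N3, N4, N5, N1.symm, N2.symm, N3.symm, N4.symm, N5.symm, hd.1.symm] at this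
    · intro h
      have := hall _ (hτ.sc_right (hτ.sc_right (hτ.sc _))) h
      push Not at hd
      simp [N1, N2, N3, N4, N5, N1.symm, N2.symm, N3.symm, N4.symm, N5.symm, hd.2.symm] at this

theorem Plan.hA {σ : Equiv.Perm E} {μ : E → E} {U : Finset E} (S : Sys σ μ U) {ℓ : E → Bool} {c : E}
    {A B B' : Finset E} (h : Plan σ μ U ℓ c A B B') :
    ∀ e ∈ A, σ.SameCycle c e ∧ μ e ∈ A ∧ μ e ≠ e ∧ e ∈ U := by
  rcases h with ⟨τ, hτ, hC, rfl, -⟩ | ⟨τ, g, hτ, rfl, hx, rfl, -⟩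
  · intro e he
    simp only [Finset.mem_insert, Finset.mem_singleton] at he ⊢
    rcases he with rfl | rfl
    · exact ⟨hτ.sc _, by simp, hC.2.2.1, hC.1⟩
    · exact ⟨(hτ.sc _).trans hC.2.2.2, by simp [S.inv], by rw [S.inv]; exact hC.2.2.1.symm, hC.2.1⟩
  · intro e he; simp at he

theorem Plan.hB {σ : Equiv.Perm E} {μ : E → E} {U T : Finset E} (S : Sys σ μ U) {ℓ : E → Bool} {c : E}
    {A B B' : Finset E} (h : Plan σ μ U ℓ c A B B') (hn : NonExt σ μ U T c) (hc : c ∈ T) (hU : c ∈ U) :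
    ∀ e ∈ B, μ e ∈ B ∧ (e ∈ KT σ U T → (μ e ∈ KT σ U T ∨ μ e ∉ U)) ∧
      (e ∈ KT σ U T → (μ e ∉ U ∨ μ e = e) → ℓ e = true) := by
  rcases h with ⟨τ, hτ, hC, rfl, rfl⟩ | ⟨τ, g, hτ, rfl, hx, rfl, rfl, -⟩
  · simp
  · have hs := hτ.sc (τ (τ g))
    have hU' := S.closed _ _ hs hU
    intro e he
    simp only [Finset.mem_insert, Finset.mem_singleton] at he ⊢
    rcases he with rfl | rfl
    · refine ⟨by simp, fun _ => hn.nl hc S hU hτ, fun _ h => ?_⟩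
      rcases hx with hx | hx
      · exact hx.2
      · exact absurd ⟨hx.1, h⟩ hx.not_ext
    · refine ⟨by simp [S.inv], fun _ => ?_, fun hk h => ?_⟩
      · left; rw [S.inv]; exact mem_KT.2 ⟨hU', _, hc, hs⟩
      · rcases hx with hx | hx
        · rcases hx.1.2 with h1 | h1
          · exact absurd (mem_KT.1 hk).1 h1
          · rw [h1]; exact hx.2
        · exact absurd ⟨hx.2.1, h⟩ (hx.mu S).not_ext

theorem endshape {σ : Equiv.Perm E} {μ : E → E} {U T : Finset E} (S : Sys σ μ U) {ℓ : E → Bool} {c : E}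
    {A B B' S3 S2 : Finset E} (h : Plan σ μ U ℓ c A B B') (hn : NonExt σ μ U T c) (hc : c ∈ T)
    (hU : c ∈ U) (hA : A ⊆ S3) (hB : S2 = B ∪ B') (hc3 : c ∈ S3)
    (hall : ∀ f, σ.SameCycle c f → f ∈ S3 → f = c ∨ f ∈ A) :
    ShP σ S3 c ∨ ShD σ (fun f => μ f ∈ KT σ U T ∨ μ f ∉ U) S3 S2 c := by
  rcases h with ⟨τ, hτ, hC, rfl, rfl⟩ | ⟨τ, g, hτ, rfl, hx, rfl, rfl, h1, h0⟩
  · left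
    refine shP_chord (d := μ (τ c)) hτ ?_ hc3 (hA (by simp)) fun f hf h => ?_
    · rw [minimalPeriod_same σ (hτ.sc c)]
      exact S.seven _ hC.1 hC.2.2.1 hC.2.2.2
    · have := hall f hf h
      simpa using this
  · right
    have sg : σ.SameCycle g (τ (τ g)) := hτ.sc_right (hτ.sc g)
    have sg' := sg.symm
    have gU := S.closed _ _ sg' hU
    have h5 := S.five g gU
    have N1 := hτ.ne1 g h5
    have N2 := hτ.ne2 g h5
    have N3 := hτ.ne3 g h5
    have key : ∀ f, σ.SameCycle (τ (τ g)) f → f ≠ τ (τ (τ g)) → f ≠ μ (τ (τ (τ g))) := by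
      intro f hf hne h
      rcases hx with hx | hx
      · rcases hx.1.2 with h' | h'
        · exact h' (h ▸ S.closed _ _ hf hU)
        · exact hne (h.trans h')
      · refine hx.2.2 (h ▸ ?_)
        exact (hτ.sc _).symm.trans hf
    have sg1 := hτ.sc_right sg'
    have nal : ∀ f, σ.SameCycle (τ (τ g)) f → f ≠ τ (τ g) → f ∉ S3 := by
      intro f hf hne h
      have := hall f hf h
      simp at this
      exact hne this
    refine ⟨g, τ, hτ, sg', nal _ sg' N2.symm, ?_, nal _ sg1 (by simpa using N1.symm), ?_, ?_, hc3, ?_, nal _ (hτ.sc _) (by simpa using N1), ?_⟩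
    · rw [hB]; simp only [Finset.mem_union, Finset.mem_insert, Finset.mem_singleton, not_or]
      exact ⟨⟨N3.symm, key _ sg' N3.symm⟩, h0⟩
    · rw [hB]; simp only [Finset.mem_union, Finset.mem_insert, Finset.mem_singleton, not_or]
      have : τ g ≠ τ (τ (τ g)) := by simpa using N2.symm
      exact ⟨⟨this, key _ sg1 this⟩, h1⟩
    · have := hn.nl hc S hU hτ.inv
      rwa [inv_app] at this
    · rw [hB]; simp
    · intro f hf h
      by_contra hne
      exact nal f (sg'.trans hf) hne h

theorem KT_closed {σ : Equiv.Perm E} {μ : E → E} {U : Finset E} (S : Sys σ μ U) (T : Finset E) :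
    ∀ e f, σ.SameCycle e f → e ∈ KT σ U T → f ∈ KT σ U T := by
  intro e f h he
  obtain ⟨h1, t, ht, hs⟩ := mem_KT.1 he
  exact mem_KT.2 ⟨S.closed _ _ h h1, t, ht, hs.trans h⟩

theorem KT_self {σ : Equiv.Perm E} {μ : E → E} {U T : Finset E} {a b : E}
    (h : Trail σ μ U T a b) {e f : E} (he : e ∈ T) (S : Sys σ μ U) (hs : σ.SameCycle e f) : f ∈ KT σ U T :=
  mem_KT.2 ⟨S.closed _ _ hs (h.link e he).1.1, e, he, hs⟩

theorem ShP.same {σ : Equiv.Perm E} {S3 : Finset E} {e f : E} (h : ShP σ S3 e) (hs : σ.SameCycle e f) :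
    ShP σ S3 f := by
  obtain ⟨e0, τ, a, b, c⟩ := h
  exact ⟨e0, τ, a, hs.symm.trans b, c⟩

theorem ShD.same {σ : Equiv.Perm E} {NL : E → Prop} {S3 S2 : Finset E} {e f : E} (h : ShD σ NL S3 S2 e)
    (hs : σ.SameCycle e f) : ShD σ NL S3 S2 f := by
  obtain ⟨e0, τ, a, b, c⟩ := h
  exact ⟨e0, τ, a, hs.symm.trans b, c⟩

theorem ShE.same {σ : Equiv.Perm E} {NL : E → Prop} {S3 S2 : Finset E} {e f : E} (h : ShE σ NL S3 S2 e)
    (hs : σ.SameCycle e f) : ShE σ NL S3 S2 f := by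
  obtain ⟨e0, τ, a, b, c⟩ := h
  exact ⟨e0, τ, a, hs.symm.trans b, c⟩

/-- a pair of consecutive `S3`-ends being the only ones on their cycle -/
theorem shP_pair {σ τ : Equiv.Perm E} (hτ : Dir σ τ) {S3 : Finset E} {c : E}
    (h5 : 5 ≤ Function.minimalPeriod σ c) (hc : c ∈ S3) (hc' : τ c ∈ S3)
    (hall : ∀ f, σ.SameCycle c f → f ∈ S3 → f = c ∨ f = τ c) : ShP σ S3 c := by
  have N1 := hτ.ne1 c h5
  have N2 := hτ.ne2 c h5
  have N3 := hτ.ne3 c h5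
  refine ⟨c, τ, hτ, .refl _ _, hc, hc', fun h => ?_, fun h => ?_⟩
  · have := hall _ (hτ.sc_right (hτ.sc c)) h
    simp [N1, N2] at this
  · have := hall _ (hτ.sc_right (hτ.sc_right (hτ.sc c))) h
    simp [N2, N3] at this

/-- common frame: end-cycles get shapes, middle cycles are automatic -/
theorem trail_core {σ : Equiv.Perm E} {μ : E → E} {U T : Finset E} (S : Sys σ μ U) {ℓ : E → Bool}
    (IH : ∀ U', U' ⊂ U → Sys σ μ U' → ∀ ℓ', Solv σ μ U' ℓ') {a b : E} (Tr : Trail σ μ U T a b)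
    (A S2 : Finset E) (hA : ∀ e ∈ A, (σ.SameCycle a e ∨ σ.SameCycle b e) ∧ μ e ∈ A ∧ μ e ≠ e)
    (hB : ∀ e ∈ S2, μ e ∈ S2 ∧ (e ∈ KT σ U T → (μ e ∈ KT σ U T ∨ μ e ∉ U)) ∧
      (e ∈ KT σ U T → (μ e ∉ U ∨ μ e = e) → ℓ e = true))
    (sa : ShP σ (T ∪ A) a ∨ ShD σ (fun f => μ f ∈ KT σ U T ∨ μ f ∉ U) (T ∪ A) S2 a ∨
      ShE σ (fun f => μ f ∈ KT σ U T ∨ μ f ∉ U) (T ∪ A) S2 a)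
    (sb : ShP σ (T ∪ A) b ∨ ShD σ (fun f => μ f ∈ KT σ U T ∨ μ f ∉ U) (T ∪ A) S2 b ∨
      ShE σ (fun f => μ f ∈ KT σ U T ∨ μ f ∉ U) (T ∪ A) S2 b) : Solv σ μ U ℓ := by
  refine core3 S IH (KT σ U T) (fun e he => (mem_KT.1 he).1) ⟨a, KT_self Tr Tr.ha S (.refl _ _)⟩
    (KT_closed S T) (T ∪ A) S2 ?_ (fun e h1 _ _ => (hB e h1).1) (fun e h1 => (hB e h1).2.1)
    (fun e h1 => (hB e h1).2.2) ?_
  · intro e he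
    rcases Finset.mem_union.1 he with he | he
    · have := Tr.link e he
      exact ⟨KT_self Tr this.2 S (.refl _ _), Finset.mem_union_left _ this.2, this.1.ne⟩
    · have h1 := hA e he
      have h2 := hA _ h1.2.1
      refine ⟨?_, Finset.mem_union_right _ h1.2.1, h1.2.2⟩
      rcases h2.1 with h | h
      · exact KT_self Tr Tr.ha S h
      · exact KT_self Tr Tr.hb S h
  · intro e he
    obtain ⟨eU, t, ht, hs⟩ := mem_KT.1 he
    by_cases h1 : σ.SameCycle a t
    · have := h1.trans hs
      rcases sa with h | h | h
      · exact Or.inl (h.same this)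
      · exact Or.inr (Or.inl (h.same this))
      · exact Or.inr (Or.inr (h.same this))
    · by_cases h2 : σ.SameCycle b t
      · have := h2.trans hs
        rcases sb with h | h | h
        · exact Or.inl (h.same this)
        · exact Or.inr (Or.inl (h.same this))
        · exact Or.inr (Or.inr (h.same this))
      · left
        obtain ⟨τ, hτ, h3, h4⟩ := Tr.mid t ht h1 h2
        refine (shP_pair hτ (S.five t (Tr.link t ht).1.1) (Finset.mem_union_left _ ht)
          (Finset.mem_union_left _ h3) fun f hf hf2 => ?_).same hs
        rcases Finset.mem_union.1 hf2 with h5 | h5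
        · exact h4 f h5 hf
        · exfalso
          rcases (hA f h5).1 with h6 | h6
          · exact h1 (h6.trans hf.symm)
          · exact h2 (h6.trans hf.symm)

theorem A3 {σ : Equiv.Perm E} {μ : E → E} {U T : Finset E} (S : Sys σ μ U) {ℓ : E → Bool}
    (IH : ∀ U', U' ⊂ U → Sys σ μ U' → ∀ ℓ', Solv σ μ U' ℓ') {a b : E} (Tr : Trail σ μ U T a b)
    (na : NonExt σ μ U T a) (nb : NonExt σ μ U T b) {Aa Ba Ab Bb : Finset E}
    (pa : Plan σ μ U ℓ a Aa Ba Bb) (pb : Plan σ μ U ℓ b Ab Bb Ba) : Solv σ μ U ℓ := by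
  have aU := (Tr.link a Tr.ha).1.1
  have bU := (Tr.link b Tr.hb).1.1
  have hAa := pa.hA S
  have hAb := pb.hA S
  have hBa := pa.hB S na Tr.ha aU
  have hBb := pb.hB S nb Tr.hb bU
  refine trail_core S IH Tr (Aa ∪ Ab) (Ba ∪ Bb) ?_ ?_ ?_ ?_
  · intro e he
    rcases Finset.mem_union.1 he with he | he
    · have := hAa e he
      exact ⟨Or.inl this.1, Finset.mem_union_left _ this.2.1, this.2.2.1⟩
    · have := hAb e he
      exact ⟨Or.inr this.1, Finset.mem_union_right _ this.2.1, this.2.2.1⟩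
  · intro e he
    rcases Finset.mem_union.1 he with he | he
    · have := hBa e he
      exact ⟨Finset.mem_union_left _ this.1, this.2⟩
    · have := hBb e he
      exact ⟨Finset.mem_union_right _ this.1, this.2⟩
  · have := endshape (S3 := T ∪ (Aa ∪ Ab)) (S2 := Ba ∪ Bb) S pa na Tr.ha aU (fun x hx => by simp [hx]) rfl
      (by simp [Tr.ha]) ?_
    · tauto
    · intro f hf h
      simp only [Finset.mem_union] at h
      rcases h with h | h | h
      · left; exact Tr.onea f h hf
      · right; exact h
      · exact absurd (hf.trans (hAb f h).1.symm) Tr.hab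
  · have := endshape (S3 := T ∪ (Aa ∪ Ab)) (S2 := Ba ∪ Bb) S pb nb Tr.hb bU (fun x hx => by simp [hx])
      (Finset.union_comm _ _) (by simp [Tr.hb]) ?_
    · tauto
    · intro f hf h
      simp only [Finset.mem_union] at h
      rcases h with h | h | h
      · left; exact Tr.oneb f h hf
      · exact absurd (hf.trans (hAa f h).1.symm) (fun h => Tr.hab h.symm)
      · right; exact h

end Tr
end CCI

namespace CCI
set_option linter.unusedSectionVars false
set_option linter.unusedSimpArgs false
section Lo

variable {E : Type*} [Fintype E] [DecidableEq E]

theorem case0 {σ : Equiv.Perm E} {μ : E → E} {U T : Finset E} (S : Sys σ μ U) {ℓ : E → Bool}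
    (IH : ∀ U', U' ⊂ U → Sys σ μ U' → ∀ ℓ', Solv σ μ U' ℓ') {a b : E} (Tr : Trail σ μ U T a b)
    {τ ρ : Equiv.Perm E} (hτ : Dir σ τ) (hρ : Dir σ ρ) (h : μ (τ a) = ρ b) : Solv σ μ U ℓ := by
  have h' : μ (ρ b) = τ a := by rw [← h, S.inv]
  have aU := (Tr.link a Tr.ha).1.1
  have bU := (Tr.link b Tr.hb).1.1
  have hne : τ a ≠ ρ b := fun he => by
    have h1 := hρ.sc b
    rw [← he] at h1
    exact Tr.hab ((hτ.sc a).trans h1.symm)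
  refine trail_core S IH Tr {τ a, ρ b} ∅ ?_ (by simp) (Or.inl ?_) (Or.inl ?_)
  · intro e he
    simp only [Finset.mem_insert, Finset.mem_singleton] at he
    rcases he with rfl | rfl
    · refine ⟨Or.inl (hτ.sc a), by simp [h], by rw [h]; exact hne.symm⟩
    · refine ⟨Or.inr (hρ.sc b), by simp [h'], by rw [h']; exact hne⟩
  · refine shP_pair hτ (S.five a aU) (by simp [Tr.ha]) (by simp) fun f hf h3 => ?_
    simp only [Finset.mem_insert, Finset.mem_singleton, Finset.mem_union] at h3
    rcases h3 with h3 | rfl | rfl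
    · exact Or.inl (Tr.onea f h3 hf)
    · exact Or.inr rfl
    · exact absurd ((sc_iff hρ).1 hf) Tr.hab
  · refine shP_pair hρ (S.five b bU) (by simp [Tr.hb]) (by simp) fun f hf h3 => ?_
    simp only [Finset.mem_insert, Finset.mem_singleton, Finset.mem_union] at h3
    rcases h3 with h3 | rfl | rfl
    · exact Or.inl (Tr.oneb f h3 hf)
    · exact absurd ((sc_iff hτ).1 hf).symm Tr.hab
    · exact Or.inr rfl

def Abs (σ : Equiv.Perm E) (μ : E → E) (U : Finset E) (ℓ : E → Bool) (p : E) : Prop :=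
  (Ext μ U p ∧ ℓ p = true) ∨ Link σ μ U p

theorem Abs.same {σ : Equiv.Perm E} {μ : E → E} {U : Finset E} {ℓ : E → Bool} {p : E}
    (h : Abs σ μ U ℓ p) (hs : σ.SameCycle p (μ p)) (hU : μ p ∈ U) : μ p = p := by
  rcases h with h | h
  · rcases h.1.2 with h | h
    · exact absurd hU h
    · exact h
  · exact absurd hs h.2.2

theorem plan_abs {σ : Equiv.Perm E} {μ : E → E} {U : Finset E} {ℓ : E → Bool} {c : E}
    {τ : Equiv.Perm E} (hτ : Dir σ τ) (h : Abs σ μ U ℓ (τ c)) {B' : Finset E}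
    (h1 : τ⁻¹ c ∉ B') (h2 : τ⁻¹ (τ⁻¹ c) ∉ B') : Plan σ μ U ℓ c ∅ {τ c, μ (τ c)} B' := by
  obtain ⟨g, rfl⟩ : ∃ g, c = τ (τ g) := ⟨τ⁻¹ (τ⁻¹ c), by simp⟩
  rw [inv_app] at h1 h2
  rw [inv_app] at h2
  exact Or.inr ⟨τ, g, hτ, rfl, h, rfl, rfl, h1, h2⟩

theorem exotic {σ : Equiv.Perm E} {μ : E → E} {U T : Finset E} (S : Sys σ μ U) {ℓ : E → Bool}
    (IH : ∀ U', U' ⊂ U → Sys σ μ U' → ∀ ℓ', Solv σ μ U' ℓ') {a b : E} (Tr : Trail σ μ U T a b)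
    (na : NonExt σ μ U T a)
    {τ ρ : Equiv.Perm E} (hτ : Dir σ τ) (hρ : Dir σ ρ) (h : μ (τ b) = ρ (ρ a))
    (hq : Abs σ μ U ℓ (ρ a)) : Solv σ μ U ℓ := by
  have h' : μ (ρ (ρ a)) = τ b := by rw [← h, S.inv]
  have aU := (Tr.link a Tr.ha).1.1
  have bU := (Tr.link b Tr.hb).1.1
  have s2 := hρ.sc_right (hρ.sc a)
  have hne : τ b ≠ ρ (ρ a) := fun he => by
    rw [← he] at s2
    exact Tr.hab (s2.trans (hτ.sc b).symm)
  have h5 := S.five a aU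
  have N1 := hρ.ne1 a h5
  have N2 := hρ.ne2 a h5
  have N3 := hρ.ne3 a h5
  have all : ∀ f, σ.SameCycle a f → f ∈ T ∪ {τ b, ρ (ρ a)} → f = a ∨ f = ρ (ρ a) := by
    intro f hf h3
    simp only [Finset.mem_insert, Finset.mem_singleton, Finset.mem_union] at h3
    rcases h3 with h3 | rfl | rfl
    · exact Or.inl (Tr.onea f h3 hf)
    · exact absurd ((sc_iff hτ).1 hf) Tr.hab
    · exact Or.inr rfl
  have all2 : ∀ f, σ.SameCycle a f → f ∈ ({ρ a, μ (ρ a)} : Finset E) → f = ρ a := by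
    intro f hf h3
    simp only [Finset.mem_insert, Finset.mem_singleton] at h3
    rcases h3 with rfl | rfl
    · rfl
    · exact hq.same ((hρ.sc a).symm.trans hf) (S.closed _ _ hf aU)
  refine trail_core S IH Tr {τ b, ρ (ρ a)} {ρ a, μ (ρ a)} ?_ ?_ (Or.inr (Or.inr ?_)) (Or.inl ?_)
  · intro e he
    simp only [Finset.mem_insert, Finset.mem_singleton] at he
    rcases he with rfl | rfl
    · refine ⟨Or.inr (hτ.sc b), by simp [h], by rw [h]; exact hne.symm⟩
    · refine ⟨Or.inl s2, by simp [h'], by rw [h']; exact hne⟩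
  · exact (plan_abs (B' := ∅) hρ hq (by simp) (by simp)).hB S na Tr.ha aU
  · have s' := (hρ.inv.sc a)
    refine ⟨ρ (ρ a), ρ⁻¹, hρ.inv, s2, by simp, ?_, ?_, ?_, ?_, ?_, ?_, ?_, ?_⟩
    · rw [inv_app]; simp
    · rw [inv_app]; intro h; have := all _ (hρ.sc a) h
      simp [N1, N1.symm] at this
    · rw [inv_app, inv_app]; simp [Tr.ha]
    · rw [inv_app, inv_app]; intro h
      rcases all _ s' h with h | h
      · apply N1; rw [Equiv.Perm.inv_eq_iff_eq] at h; exact h.symm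
      · apply N3; rw [Equiv.Perm.inv_eq_iff_eq] at h; exact h.symm
    · rw [inv_app, inv_app]; intro h
      have h := all2 _ s' h
      apply N2; rw [Equiv.Perm.inv_eq_iff_eq] at h; exact h.symm
    · rw [inv_app, inv_app]
      exact na.nl Tr.ha S aU hρ.inv
    · rw [inv_app, inv_app]; intro f hf h
      exact (all f (s2.trans hf) h).symm
    · rw [inv_app]; intro f hf h
      exact all2 f (s2.trans hf) h
  · refine shP_pair hτ (S.five b bU) (by simp [Tr.hb]) (by simp) fun f hf h3 => ?_
    simp only [Finset.mem_insert, Finset.mem_singleton, Finset.mem_union] at h3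
    rcases h3 with h3 | rfl | rfl
    · exact Or.inl (Tr.oneb f h3 hf)
    · exact Or.inr rfl
    · exact absurd (s2.trans hf.symm) Tr.hab

def G2 (σ : Equiv.Perm E) (μ : E → E) (U : Finset E) (ℓ : E → Bool) (c : E) : Prop :=
  ∃ τ, Dir σ τ ∧ (Chord σ μ U (τ c) ∨ (Ext μ U (τ c) ∧ ℓ (τ c) = true))

theorem G2.pre {σ : Equiv.Perm E} {μ : E → E} {U : Finset E} {ℓ : E → Bool} {c : E}
    (h : G2 σ μ U ℓ c) : ∃ A B q g, (∀ e ∈ B, e ∈ U → σ.SameCycle c e) ∧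
      (∃ ρ, Dir σ ρ ∧ q = ρ c) ∧ σ.SameCycle c g ∧
      ∀ B', q ∉ B' → g ∉ B' → Plan σ μ U ℓ c A B B' := by
  obtain ⟨τ, hτ, h | h⟩ := h
  · exact ⟨_, _, τ c, c, by simp, ⟨τ, hτ, rfl⟩, .refl _ _, fun B' _ _ => Or.inl ⟨τ, hτ, h, rfl, rfl⟩⟩
  · refine ⟨_, _, _, _, ?_, ⟨τ⁻¹, hτ.inv, rfl⟩, hτ.inv.sc_right (hτ.inv.sc c),
      fun B' h1 h2 => plan_abs hτ (Or.inl h) h1 h2⟩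
    intro e he hU
    simp only [Finset.mem_insert, Finset.mem_singleton] at he
    rcases he with rfl | rfl
    · exact hτ.sc c
    · rcases h.1.2 with h | h
      · exact absurd hU h
      · rw [h]; exact hτ.sc c

theorem nonlink {σ : Equiv.Perm E} {μ : E → E} {U : Finset E} (S : Sys σ μ U) (ℓ : E → Bool) {c : E}
    (hc : c ∈ U) {τ : Equiv.Perm E} (hτ : Dir σ τ) (h : ¬ Link σ μ U (τ c)) :
    G2 σ μ U ℓ c ∨ G2 σ μ U (fun e => !ℓ e) c := by
  rcases tri σ μ U (S.closed _ _ (hτ.sc c) hc) with h1 | h1 | h1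
  · exact absurd h1 h
  · exact Or.inl ⟨τ, hτ, Or.inl h1⟩
  · cases hl : ℓ (τ c)
    · exact Or.inr ⟨τ, hτ, Or.inr ⟨h1, by simp [hl]⟩⟩
    · exact Or.inl ⟨τ, hτ, Or.inr ⟨h1, hl⟩⟩

theorem both2 {σ : Equiv.Perm E} {μ : E → E} {U T : Finset E} (S : Sys σ μ U) {ℓ : E → Bool}
    (IH : ∀ U', U' ⊂ U → Sys σ μ U' → ∀ ℓ', Solv σ μ U' ℓ') {a b : E} (Tr : Trail σ μ U T a b)
    (na : NonExt σ μ U T a) (nb : NonExt σ μ U T b) (ga : G2 σ μ U ℓ a) (gb : G2 σ μ U ℓ b) :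
    Solv σ μ U ℓ := by
  have aU := (Tr.link a Tr.ha).1.1
  have bU := (Tr.link b Tr.hb).1.1
  obtain ⟨A, B, q, g, h1, ⟨ρ, hρ, rfl⟩, h3, h4⟩ := ga.pre
  obtain ⟨A', B', q', g', h1', ⟨ρ', hρ', rfl⟩, h3', h4'⟩ := gb.pre
  have k : ∀ e, σ.SameCycle a e → e ∉ B' := fun e he h =>
    Tr.hab (he.trans (h1' e h (S.closed _ _ he aU)).symm)
  have k' : ∀ e, σ.SameCycle b e → e ∉ B := fun e he h =>
    Tr.hab ((h1 e h (S.closed _ _ he bU)).trans he.symm)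
  exact A3 S IH Tr na nb (h4 B' (k _ (hρ.sc a)) (k _ h3)) (h4' B (k' _ (hρ'.sc b)) (k' _ h3'))

theorem tt2 {σ : Equiv.Perm E} {μ : E → E} {U T : Finset E} (S : Sys σ μ U) {ℓ : E → Bool}
    (IH : ∀ U', U' ⊂ U → Sys σ μ U' → ∀ ℓ', Solv σ μ U' ℓ') {a b : E} (Tr : Trail σ μ U T a b)
    (na : NonExt σ μ U T a) (nb : NonExt σ μ U T b) (ga : G2 σ μ U ℓ a)
    (gb : ∀ τ, Dir σ τ → Link σ μ U (τ b)) :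
    Solv σ μ U ℓ := by
  have aU := (Tr.link a Tr.ha).1.1
  have bU := (Tr.link b Tr.hb).1.1
  obtain ⟨A, B, q, g, h1, ⟨ρ, hρ, rfl⟩, h3, h4⟩ := ga.pre
  have k' : ∀ e, σ.SameCycle b e → e ∉ B := fun e he h =>
    Tr.hab ((h1 e h (S.closed _ _ he bU)).trans he.symm)
  obtain ⟨τ, hτ, hg⟩ : ∃ τ, Dir σ τ ∧ μ (τ b) ≠ g := by
    by_contra hc
    push Not at hc
    have h1 := hc σ (Or.inl rfl)
    have h2 := hc σ⁻¹ (Or.inr rfl)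
    have h3 : σ b = σ⁻¹ b := by rw [← S.inv (σ b), h1, ← h2, S.inv]
    have := congrArg σ h3
    rw [app_inv] at this
    exact Dir.ne2 (Or.inl rfl) b (S.five b bU) this
  by_cases h0 : μ (τ b) = ρ a
  · exact case0 S IH Tr.swap hτ hρ h0
  · refine A3 S IH Tr na nb (h4 _ ?_ ?_) (plan_abs hτ (Or.inr (gb τ hτ)) (k' _ (hτ.inv.sc b))
      (k' _ (hτ.inv.sc_right (hτ.inv.sc b))))
    · simp only [Finset.mem_insert, Finset.mem_singleton, not_or]
      refine ⟨fun h => ?_, fun h => h0 h.symm⟩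
      have := hρ.sc a
      rw [h] at this
      exact Tr.hab (this.trans (hτ.sc b).symm)
    · simp only [Finset.mem_insert, Finset.mem_singleton, not_or]
      refine ⟨fun h => ?_, fun h => hg h.symm⟩
      rw [h] at h3
      exact Tr.hab (h3.trans (hτ.sc b).symm)

theorem ttTT {σ : Equiv.Perm E} {μ : E → E} {U T : Finset E} (S : Sys σ μ U) {ℓ : E → Bool}
    (IH : ∀ U', U' ⊂ U → Sys σ μ U' → ∀ ℓ', Solv σ μ U' ℓ') {a b : E} (Tr : Trail σ μ U T a b)
    (na : NonExt σ μ U T a) (nb : NonExt σ μ U T b) (ga : ∀ τ, Dir σ τ → Link σ μ U (τ a))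
    (gb : ∀ τ, Dir σ τ → Link σ μ U (τ b)) :
    Solv σ μ U ℓ := by
  have hσ : Dir σ σ := Or.inl rfl
  by_cases c1 : μ (σ b) = σ⁻¹ a
  · exact case0 S IH Tr.swap hσ hσ.inv c1
  by_cases c2 : μ (σ a) = σ⁻¹ b
  · exact case0 S IH Tr hσ hσ.inv c2
  by_cases c3 : μ (σ b) = σ⁻¹ (σ⁻¹ a)
  · exact exotic S IH Tr na hσ hσ.inv c3 (Or.inr (ga _ hσ.inv))
  by_cases c4 : μ (σ a) = σ⁻¹ (σ⁻¹ b)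
  · exact exotic S IH Tr.swap nb hσ hσ.inv c4 (Or.inr (gb _ hσ.inv))
  have d : ∀ e f, σ.SameCycle a e → σ.SameCycle b f → e ≠ f := fun e f h1 h2 h => by
    rw [h] at h1; exact Tr.hab (h1.trans h2.symm)
  refine A3 S IH Tr na nb (plan_abs hσ (Or.inr (ga _ hσ)) ?_ ?_) (plan_abs hσ (Or.inr (gb _ hσ)) ?_ ?_)
  all_goals simp only [Finset.mem_insert, Finset.mem_singleton, not_or]
  · exact ⟨d _ _ (hσ.inv.sc _) (hσ.sc _), fun h => c1 h.symm⟩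
  · exact ⟨d _ _ (hσ.inv.sc_right (hσ.inv.sc _)) (hσ.sc _), fun h => c3 h.symm⟩
  · exact ⟨(d _ _ (hσ.sc _) (hσ.inv.sc _)).symm, fun h => c2 h.symm⟩
  · exact ⟨(d _ _ (hσ.sc _) (hσ.inv.sc_right (hσ.inv.sc _))).symm, fun h => c4 h.symm⟩

theorem lem2b {σ : Equiv.Perm E} {μ : E → E} {U T : Finset E} (S : Sys σ μ U) {ℓ : E → Bool}
    (IH : ∀ U', U' ⊂ U → Sys σ μ U' → ∀ ℓ', Solv σ μ U' ℓ') {a b : E} (Tr : Trail σ μ U T a b)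
    (na : NonExt σ μ U T a) (nb : NonExt σ μ U T b) {τ ρ : Equiv.Perm E} (hτ : Dir σ τ) (hρ : Dir σ ρ)
    (hb : Link σ μ U (τ b)) (ha : Ext μ U (ρ a)) (ha' : ℓ (ρ a) = true) (hq : Abs σ μ U ℓ (ρ⁻¹ a)) :
    Solv σ μ U ℓ := by
  have aU := (Tr.link a Tr.ha).1.1
  have bU := (Tr.link b Tr.hb).1.1
  by_cases c1 : μ (τ b) = ρ⁻¹ a
  · exact case0 S IH Tr.swap hτ hρ.inv c1
  by_cases c2 : μ (τ b) = ρ⁻¹ (ρ⁻¹ a)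
  · exact exotic S IH Tr na hτ hρ.inv c2 hq
  have d : ∀ e f, σ.SameCycle a e → σ.SameCycle b f → e ≠ f := fun e f h1 h2 h => by
    rw [h] at h1; exact Tr.hab (h1.trans h2.symm)
  have d2 : ∀ f, σ.SameCycle b f → f ≠ μ (ρ a) := fun f h1 h => by
    rcases ha.2 with h' | h'
    · exact h' (h ▸ S.closed _ _ h1 bU)
    · exact d _ _ (hρ.sc a) h1 (h'.symm.trans h.symm)
  refine A3 S IH Tr na nb (plan_abs hρ (Or.inl ⟨ha, ha'⟩) ?_ ?_) (plan_abs hτ (Or.inr hb) ?_ ?_)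
  all_goals simp only [Finset.mem_insert, Finset.mem_singleton, not_or]
  · exact ⟨d _ _ (hρ.inv.sc _) (hτ.sc _), fun h => c1 h.symm⟩
  · exact ⟨d _ _ (hρ.inv.sc_right (hρ.inv.sc _)) (hτ.sc _), fun h => c2 h.symm⟩
  · exact ⟨(d _ _ (hρ.sc _) (hτ.inv.sc _)).symm, d2 _ (hτ.inv.sc _)⟩
  · exact ⟨(d _ _ (hρ.sc _) (hτ.inv.sc_right (hτ.inv.sc _))).symm, d2 _ (hτ.inv.sc_right (hτ.inv.sc _))⟩

end Lo
end CCI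

namespace CCI
set_option linter.unusedSectionVars false
set_option linter.unusedSimpArgs false
section Ga

variable {E : Type*} [Fintype E] [DecidableEq E]

theorem w01 {z : ZMod 11} (h : z = 0 ∨ z = 1) : z = 0 ∨ z = 1 ∨ z = 2 := by tauto
theorem w12 {z : ZMod 11} (h : z = 1 ∨ z = 2) : z = 0 ∨ z = 1 ∨ z = 2 := by tauto

set_option maxHeartbeats 1000000 in
theorem gamma {σ : Equiv.Perm E} {μ : E → E} {U T : Finset E} (S : Sys σ μ U) {ℓ : E → Bool}
    (IH : ∀ U', U' ⊂ U → Sys σ μ U' → ∀ ℓ', Solv σ μ U' ℓ') {a b : E} (Tr : Trail σ μ U T a b)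
    (hab : μ b ≠ a)
    (hf : Ext μ U (σ a)) (hfl : ℓ (σ a) = true)
    (hp : Ext μ U (σ b)) (hpl : ℓ (σ b) = false)
    (hp' : Ext μ U (σ⁻¹ b)) : Solv σ μ U ℓ := by
  classical
  have hσ : Dir σ σ := Or.inl rfl
  have lb := Tr.link b Tr.hb
  have la := Tr.link a Tr.ha
  have bU := lb.1.1
  have aU := la.1.1
  have n1 : ¬ σ.SameCycle a (μ b) := fun h => hab (Tr.onea _ lb.2 h)
  obtain ⟨τ, hτ, ht, hmid⟩ := Tr.mid (μ b) lb.2 n1 lb.1.2.2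
  set e' := τ (μ b) with he'
  have le' := Tr.link e' ht
  have s' : σ.SameCycle (μ b) e' := hτ.sc _
  have b5 := S.five b bU
  have mb5 := S.five _ lb.1.2.1
  have ne' : e' ≠ μ b := hτ.ne1 _ mb5
  -- the ends with values 9 and 4
  let m0 : E → ZMod 11 := fun e => if e = b ∨ e = μ b then 9 else if e = e' ∨ e = μ e' then 4 else
    if e ∈ T ∨ e = σ a then 2 else if e = σ b then 0 else 1
  have fT : σ a ∉ T := fun h => (Tr.link _ h).1.not_ext hf
  have pT : σ b ∉ T := fun h => (Tr.link _ h).1.not_ext hp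
  have qT : σ⁻¹ b ∉ T := fun h => (Tr.link _ h).1.not_ext hp'
  have hT4 : ∀ e, (e = b ∨ e = μ b) ∨ (e = e' ∨ e = μ e') → e ∈ T := by
    rintro e ((rfl | rfl) | (rfl | rfl))
    exacts [Tr.hb, lb.2, ht, le'.2]
  have inj : ∀ e f, μ e = f ↔ e = μ f := fun e f => ⟨fun h => by rw [← h, S.inv], fun h => by rw [h, S.inv]⟩
  have v9 : ∀ e, e = b ∨ e = μ b → m0 e = 9 := fun e h => by simp only [m0]; rw [if_pos h]
  have nb' : ¬ σ.SameCycle b e' := fun h => lb.1.2.2 (h.trans s'.symm)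
  have e'b : ¬ (e' = b ∨ e' = μ b) := by
    rintro (h | h)
    · exact nb' (by rw [h])
    · exact ne' h
  have me'b : ¬ (μ e' = b ∨ μ e' = μ b) := by
    rintro (h | h)
    · exact ne' ((inj _ _).1 h)
    · exact e'b (Or.inl (by rw [inj, S.inv] at h; exact h))
  have v4 : ∀ e, e = e' ∨ e = μ e' → m0 e = 4 := fun e h => by
    simp only [m0]; rw [if_neg, if_pos h]
    rcases h with rfl | rfl
    · exact e'b
    · exact me'b
  have v2 : ∀ e, e ∈ T → ¬ (e = b ∨ e = μ b) → ¬ (e = e' ∨ e = μ e') → m0 e = 2 := fun e h h1 h2 => by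
    simp only [m0]; rw [if_neg h1, if_neg h2, if_pos (Or.inl h)]
  have vf : m0 (σ a) = 2 := by
    simp only [m0]; rw [if_neg fun h => fT (hT4 _ (Or.inl h)), if_neg fun h => fT (hT4 _ (Or.inr h)), if_pos (Or.inr trivial)]
  have fp : σ b ≠ σ a := fun h => Tr.hab (by rw [σ.injective h])
  have vp : m0 (σ b) = 0 := by
    simp only [m0]; rw [if_neg fun h => pT (hT4 _ (Or.inl h)), if_neg fun h => pT (hT4 _ (Or.inr h)),
      if_neg (by rintro (h | h); exacts [pT h, fp h]), if_pos trivial]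
  have v1 : ∀ e, e ∉ T → e ≠ σ a → e ≠ σ b → m0 e = 1 := fun e h h1 h2 => by
    simp only [m0]; rw [if_neg fun h' => h (hT4 _ (Or.inl h')), if_neg fun h' => h (hT4 _ (Or.inr h')),
      if_neg (by tauto), if_neg h2]
  refine step S IH (KT σ U T) (fun e he => (mem_KT.1 he).1) ⟨a, KT_self Tr Tr.ha S (.refl _ _)⟩
    (KT_closed S T) m0 (fun e => decide (σ.SameCycle b e)) ?_ ?_ ?_
  · intro e he hme
    have hmU := (mem_KT.1 hme).1
    by_cases c1 : e = b ∨ e = μ b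
    · rw [v9 e c1, v9]
      rcases c1 with rfl | rfl <;> simp [S.inv]
    by_cases c2 : e = e' ∨ e = μ e'
    · rw [v4 e c2, v4]
      rcases c2 with h | h <;> rw [h] <;> simp [S.inv]
    by_cases c3 : e ∈ T
    · rw [v2 e c3 c1 c2, v2 _ (Tr.link e c3).2]
      · rw [inj, inj, S.inv]; tauto
      · rw [inj, inj, S.inv]; tauto
    by_cases c4 : e = σ a
    · subst c4
      rcases hf.2 with h | h
      · exact absurd hmU h
      · rw [h]
    by_cases c5 : e = σ b
    · subst c5
      rcases hp.2 with h | h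
      · exact absurd hmU h
      · rw [h]
    rw [v1 e c3 c4 c5, v1]
    · intro h; apply c3; have := (Tr.link _ h).2; rwa [S.inv] at this
    · intro h; rw [inj] at h
      rcases hf.2 with h' | h'
      · rw [← h] at h'; exact h' (mem_KT.1 he).1
      · exact c4 (h.trans h')
    · intro h; rw [inj] at h
      rcases hp.2 with h' | h'
      · rw [← h] at h'; exact h' (mem_KT.1 he).1
      · exact c5 (h.trans h')
  · intro e he hx
    have eU := (mem_KT.1 he).1
    have c3 : e ∉ T := fun h => (Tr.link e h).1.not_ext ⟨eU, hx⟩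
    by_cases c4 : e = σ a
    · rw [c4, hfl, vf]; right; rfl
    by_cases c5 : e = σ b
    · rw [c5, hpl, vp]; right; rfl
    rw [v1 e c3 c4 c5]; left; rfl
  · intro m hm e he
    have hK := KT_closed S T
    have vT : ∀ f ∈ T, m f = m0 f := fun f hf => (hm f (KT_self Tr hf S (.refl _ _))).2
      fun h => h.2 (KT_self Tr (Tr.link f hf).2 S (.refl _ _))
    have vE : ∀ f ∈ KT σ U T, Ext μ U f → m f = m0 f := fun f hf hx => (hm f hf).2 fun h => by
      rcases hx.2 with h' | h'
      · exact h' h.1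
      · rw [h'] at h; exact h.2 hf
    have vN : ∀ f ∈ KT σ U T, f ∉ T → f ≠ σ a → f ≠ σ b → inL (decide (σ.SameCycle b f)) (m f) := by
      intro f hf h1 h2 h3
      by_cases c : μ f ∈ U ∧ μ f ∉ KT σ U T
      · exact (hm f hf).1 c
      · rw [(hm f hf).2 c, v1 f h1 h2 h3]; left; rfl
    have vN' : ∀ f ∈ KT σ U T, f ∉ T → f ≠ σ a → ¬ σ.SameCycle b f → m f = 0 ∨ m f = 1 := by
      intro f hf h1 h2 h3
      have := vN f hf h1 h2 (fun h => h3 (by rw [h]; exact hσ.sc b))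
      rw [decide_eq_false h3] at this
      exact inL_false this
    obtain ⟨eU, t, htT, hs⟩ := mem_KT.1 he
    have tU := (Tr.link t htT).1.1
    by_cases cb : σ.SameCycle b t
    · -- cycle of b
      obtain rfl := Tr.oneb t htT cb
      have hst : ∀ f, σ.SameCycle t f → f ∈ KT σ U T := fun f hf => KT_self Tr htT S hf
      have k : ∀ f, σ.SameCycle t f → f ≠ t → f ≠ σ t → m f = 1 ∨ m f = 2 := by
        intro f hf h1 h2
        have := vN f (hst f hf) (fun h => h1 (Tr.oneb f h hf)) (fun h => ?_) h2
        · rw [decide_eq_true hf] at this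
          exact inL_true this
        · rw [h] at hf; exact Tr.hab ((hσ.sc a).trans hf.symm)
      have kt : m t = 9 := by rw [vT t htT, v9 t (Or.inl rfl)]
      have kp : m (σ t) = 0 := by rw [vE _ (hst _ (hσ.sc t)) hp, vp]
      obtain ⟨g, hg⟩ : ∃ g, t = σ (σ g) := ⟨σ⁻¹ (σ⁻¹ t), by simp⟩
      have sg : σ.SameCycle t g := by rw [hg]; exact (hσ.sc_right (hσ.sc g)).symm
      have g5 := S.five g (S.closed _ _ sg tU)
      have N1 := hσ.ne1 g g5
      have N2 := hσ.ne2 g g5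
      have N3 := hσ.ne3 g g5
      have N4 := hσ.ne4 g g5
      have kq : m (σ g) = 1 := by
        have : σ⁻¹ t = σ g := by rw [hg, inv_app]
        rw [← this, vE _ (hst _ (hσ.inv.sc t)) hp', v1 _ qT]
        · intro h; have h2 := hσ.inv.sc t; rw [h] at h2; exact Tr.hab ((hσ.sc a).trans h2.symm)
        · rw [this, hg]; simpa using N2.symm
      refine Good.same ?_ (sg.symm.trans hs)
      refine good58 hσ (S.odd _ (S.closed _ _ sg tU)) g5 ?_ ?_
      · rw [kq, ← hg, kt, kp]
        refine win_D9 _ _ (k g sg ?_ ?_) ?_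
        · rw [hg]; exact N2.symm
        · rw [hg]; exact N3.symm
        · have := k (σ (σ t)) (hσ.sc_right (hσ.sc t)) (hσ.ne2 _ b5) (by simpa using hσ.ne1 _ b5)
          exact w12 this
      · intro f hf _ _ h2 h3 _
        have := k f (sg.trans hf) (by rw [hg]; exact h2) (by rw [hg]; exact h3)
        exact w12 this
    have nbc : ∀ f, σ.SameCycle t f → ¬ σ.SameCycle b f := fun f hf h => cb (h.trans hf.symm)
    by_cases ca : σ.SameCycle a t
    · obtain rfl := Tr.onea t htT ca
      have hst : ∀ f, σ.SameCycle t f → f ∈ KT σ U T := fun f hf => KT_self Tr htT S hf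
      have k : ∀ f, σ.SameCycle t f → f ≠ t → f ≠ σ t → m f = 0 ∨ m f = 1 := by
        intro f hf h1 h2
        exact vN' f (hst f hf) (fun h => h1 (Tr.onea f h hf)) h2 (nbc f hf)
      have kf : m (σ t) = 2 := by rw [vE _ (hst _ (hσ.sc t)) hf, vf]
      have kt : m t = 2 ∨ m t = 4 := by
        rw [vT t htT]
        by_cases c : t = e' ∨ t = μ e'
        · right; exact v4 t c
        · left; refine v2 t htT ?_ c
          rintro (h | h)
          · exact cb (by rw [h])
          · exact hab h.symm
      obtain ⟨g, hg⟩ : ∃ g, t = σ (σ (σ g)) := ⟨σ⁻¹ (σ⁻¹ (σ⁻¹ t)), by simp⟩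
      have sg : σ.SameCycle t g := by rw [hg]; exact (hσ.sc_right (hσ.sc_right (hσ.sc g))).symm
      have g5 := S.five g (S.closed _ _ sg tU)
      have N1 := hσ.ne1 g g5
      have N2 := hσ.ne2 g g5
      have N3 := hσ.ne3 g g5
      have N4 := hσ.ne4 g g5
      have i1 : σ⁻¹ t = σ (σ g) := by rw [hg, inv_app]
      have st := hσ.sc t
      refine Good.same ?_ (st.symm.trans hs)
      refine good58 hσ.inv (S.odd _ (S.closed _ _ st tU)) (S.five _ (S.closed _ _ st tU)) ?_ ?_
      · simp only [inv_app, i1]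
        rw [kf]
        have k1 := k (σ (σ g)) (hσ.sc_right (hσ.sc_right sg)) (by rw [hg]; simpa using N1.symm) (by rw [hg]; simpa using N2.symm)
        have k2 := k (σ g) (hσ.sc_right sg) (by rw [hg]; simpa using N2.symm) (by rw [hg]; simpa using N3.symm)
        have k3 := k g sg (by rw [hg]; exact N3.symm) (by rw [hg]; exact N4.symm)
        exact win_P2 _ _ _ _ kt k1 k2 (w01 k3)
      · intro f hf h0 h1 _ _ _
        have := k f (st.trans hf) (by rwa [inv_app] at h1) h0
        exact w01 this
    -- middle cycles
    obtain ⟨ρ, hρ, htρ, hm2⟩ := Tr.mid t htT ca cb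
    have nac : ∀ f, σ.SameCycle t f → f ≠ σ a := fun f hf h => ca (by
      rw [h] at hf; exact (hσ.sc a).trans hf.symm)
    have hst : ∀ f, σ.SameCycle t f → f ∈ KT σ U T := fun f hf => KT_self Tr htT S hf
    have k : ∀ f, σ.SameCycle t f → f ≠ t → f ≠ ρ t → m f = 0 ∨ m f = 1 := by
      intro f hf h1 h2
      refine vN' f (hst f hf) (fun h => ?_) (nac f hf) (nbc f hf)
      rcases hm2 f h hf with h | h
      · exact h1 h
      · exact h2 h
    -- general window: a pair x, κ x
    have pairwin : ∀ (x : E) (κ : Equiv.Perm E), Dir σ κ → σ.SameCycle t x →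
        (∀ f, σ.SameCycle t f → f ≠ x → f ≠ κ x → m f = 0 ∨ m f = 1) →
        ((m x = 2 ∧ (m (κ x) = 2 ∨ m (κ x) = 4)) ∨ (m x = 4 ∧ m (κ x) = 9)) → Good σ m e := by
      intro x κ hκ sx kk hv
      have xU := S.closed _ _ sx tU
      have x5 := S.five x xU
      have N1 := hκ.ne1 x x5
      have N2 := hκ.ne2 x x5
      have N3 := hκ.ne3 x x5
      have N4 := hκ.ne4 x x5
      refine Good.same ?_ (sx.symm.trans hs)
      have s2 := hκ.sc_right (hκ.sc_right sx)
      have k1 := kk _ s2 N2 (by simpa using N1)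
      have k2 := kk _ (hκ.sc_right s2) N3 (by simpa using N2)
      have k3 := kk _ (hκ.sc_right (hκ.sc_right s2)) N4 (by simpa using N3)
      refine good58 hκ (S.odd _ xU) x5 ?_ ?_
      · rcases hv with ⟨h1, h2⟩ | ⟨h1, h2⟩
        · rw [h1]; exact win_P2 _ _ _ _ h2 k1 k2 (w01 k3)
        · rw [h1, h2]; exact win_B _ _ _ (w01 k1) (w01 k2) (w01 k3)
      · intro f hf h0 h1 _ _ _
        have := kk f (sx.trans hf) h0 h1
        exact w01 this
    have sρ := hρ.sc t
    by_cases cm : σ.SameCycle (μ b) t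
    · -- cycle of μ b
      have smb := cm.symm
      refine pairwin e' τ⁻¹ hτ.inv (smb.trans s') ?_ (Or.inr ?_)
      · intro f hf h1 h2
        rw [he', inv_app] at h2
        refine vN' f (hst f hf) (fun h => ?_) (nac f hf) (nbc f hf)
        rcases hmid f h (cm.trans hf) with h | h
        · exact h2 h
        · exact h1 h
      · rw [he', inv_app, ← he', vT e' ht, vT _ lb.2]
        exact ⟨v4 _ (Or.inl rfl), v9 _ (Or.inr rfl)⟩
    · have w9 : ∀ f, σ.SameCycle t f → ¬ (f = b ∨ f = μ b) := by
        rintro f hf (rfl | rfl)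
        · exact cb hf.symm
        · exact cm hf.symm
      have we : ∀ f, σ.SameCycle t f → f ≠ e' := by
        rintro f hf rfl
        exact cm (s'.trans hf.symm)
      by_cases c4 : t = μ e'
      · refine pairwin (ρ t) ρ⁻¹ hρ.inv sρ ?_ (Or.inl ?_)
        · intro f hf h1 h2
          rw [inv_app] at h2
          exact k f hf h2 h1
        · rw [inv_app, vT t htT, vT _ htρ]
          refine ⟨v2 _ htρ (w9 _ sρ) ?_, Or.inr (v4 t (Or.inr c4))⟩
          rintro (h | h)
          · exact we _ sρ h
          · rw [← c4] at h; exact hρ.ne1 t (S.five t tU) h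
      · refine pairwin t ρ hρ (.refl _ _) k (Or.inl ?_)
        rw [vT t htT, vT _ htρ]
        refine ⟨v2 t htT (w9 t (.refl _ _)) ?_, ?_⟩
        · rintro (h | h)
          · exact we _ (.refl _ _) h
          · exact c4 h
        · by_cases c5 : ρ t = μ e'
          · right; exact v4 _ (Or.inr c5)
          · left; refine v2 _ htρ (w9 _ sρ) ?_
            rintro (h | h)
            · exact we _ sρ h
            · exact c5 h

end Ga
end CCI

namespace CCI
set_option linter.unusedSectionVars false
set_option linter.unusedSimpArgs false
section Fi

variable {E : Type*} [Fintype E] [DecidableEq E]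

def Dz (σ : Equiv.Perm E) (μ : E → E) (U : Finset E) (ℓ : E → Bool) (u y : E) : Prop :=
  ∀ τ, Dir σ τ → (Ext μ U (τ u) ∧ ℓ (τ u) = false) ∧ (Ext μ U (τ y) ∧ ℓ (τ y) = true)

theorem notG2 {σ : Equiv.Perm E} {μ : E → E} {U : Finset E} (S : Sys σ μ U) {ℓ : E → Bool} {c : E}
    (hc : c ∈ U) (h : ¬ G2 σ μ U (fun e => !ℓ e) c) (τ : Equiv.Perm E) (hτ : Dir σ τ) :
    Abs σ μ U ℓ (τ c) := by
  rcases tri σ μ U (S.closed _ _ (hτ.sc c) hc) with h1 | h1 | h1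
  · exact Or.inr h1
  · exact absurd ⟨τ, hτ, Or.inl h1⟩ h
  · cases hl : ℓ (τ c)
    · exact absurd ⟨τ, hτ, Or.inr ⟨h1, by simp [hl]⟩⟩ h
    · exact Or.inl ⟨h1, hl⟩

theorem mixed {σ : Equiv.Perm E} {μ : E → E} {U T : Finset E} (S : Sys σ μ U) {ℓ : E → Bool}
    (IH : ∀ U', U' ⊂ U → Sys σ μ U' → ∀ ℓ', Solv σ μ U' ℓ') {a b : E} (Tr : Trail σ μ U T a b)
    (na : NonExt σ μ U T a) (nb : NonExt σ μ U T b) (ga : G2 σ μ U ℓ a)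
    (ga' : ¬ G2 σ μ U (fun e => !ℓ e) a) (gb : G2 σ μ U (fun e => !ℓ e) b) (gb' : ¬ G2 σ μ U ℓ b) :
    Solv σ μ U ℓ ∨ (μ b = a ∧ Dz σ μ U ℓ b a) := by
  have aU := (Tr.link a Tr.ha).1.1
  have bU := (Tr.link b Tr.hb).1.1
  have hA := notG2 S aU ga'
  have hB : ∀ τ, Dir σ τ → Abs σ μ U (fun e => !ℓ e) (τ b) := notG2 S bU (by simpa using gb')
  by_cases c1 : ∃ τ, Dir σ τ ∧ Link σ μ U (τ b)
  · obtain ⟨τ, hτ, h⟩ := c1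
    obtain ⟨ρ, hρ, h2 | h2⟩ := ga
    · exact absurd ⟨ρ, hρ, Or.inl h2⟩ ga'
    · exact Or.inl (lem2b S IH Tr na nb hτ hρ h h2.1 h2.2 (hA _ hρ.inv))
  by_cases c2 : ∃ τ, Dir σ τ ∧ Link σ μ U (τ a)
  · obtain ⟨τ, hτ, h⟩ := c2
    obtain ⟨ρ, hρ, h2 | h2⟩ := gb
    · exact absurd ⟨ρ, hρ, Or.inl h2⟩ gb'
    · exact Or.inl (Solv.mirror (lem2b S IH Tr.swap nb na hτ hρ h h2.1 h2.2 (hB _ hρ.inv)))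
  have hD : Dz σ μ U ℓ b a := by
    intro τ hτ
    constructor
    · rcases hB τ hτ with h | h
      · exact ⟨h.1, by simpa using h.2⟩
      · exact absurd ⟨τ, hτ, h⟩ c1
    · rcases hA τ hτ with h | h
      · exact h
      · exact absurd ⟨τ, hτ, h⟩ c2
  by_cases hab : μ b = a
  · exact Or.inr ⟨hab, hD⟩
  · left
    have h1 := hD σ (Or.inl rfl)
    have h2 := hD σ⁻¹ (Or.inr rfl)
    exact gamma S IH Tr hab h1.2.1 h1.2.2 h1.1.1 h1.1.2 h2.1.1

theorem trail_solve {σ : Equiv.Perm E} {μ : E → E} {U T : Finset E} (S : Sys σ μ U) {ℓ : E → Bool}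
    (IH : ∀ U', U' ⊂ U → Sys σ μ U' → ∀ ℓ', Solv σ μ U' ℓ') {a b : E} (Tr : Trail σ μ U T a b)
    (na : NonExt σ μ U T a) (nb : NonExt σ μ U T b) :
    Solv σ μ U ℓ ∨ (μ b = a ∧ (Dz σ μ U ℓ b a ∨ Dz σ μ U ℓ a b)) := by
  have aU := (Tr.link a Tr.ha).1.1
  have bU := (Tr.link b Tr.hb).1.1
  by_cases ta : ∀ τ, Dir σ τ → Link σ μ U (τ a)
  · by_cases tb : ∀ τ, Dir σ τ → Link σ μ U (τ b)
    · exact Or.inl (ttTT S IH Tr na nb ta tb)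
    · push Not at tb
      obtain ⟨τ, hτ, h⟩ := tb
      left
      rcases nonlink S ℓ bU hτ h with h | h
      · exact tt2 S IH Tr.swap nb na h ta
      · exact Solv.mirror (tt2 S IH Tr.swap nb na h ta)
  · push Not at ta
    obtain ⟨τ, hτ, ha⟩ := ta
    have ha := nonlink S ℓ aU hτ ha
    by_cases tb : ∀ τ, Dir σ τ → Link σ μ U (τ b)
    · left
      rcases ha with h | h
      · exact tt2 S IH Tr na nb h tb
      · exact Solv.mirror (tt2 S IH Tr na nb h tb)
    · push Not at tb
      obtain ⟨τ', hτ', hb⟩ := tb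
      have hb := nonlink S ℓ bU hτ' hb
      by_cases c1 : G2 σ μ U ℓ a ∧ G2 σ μ U ℓ b
      · exact Or.inl (both2 S IH Tr na nb c1.1 c1.2)
      by_cases c2 : G2 σ μ U (fun e => !ℓ e) a ∧ G2 σ μ U (fun e => !ℓ e) b
      · exact Or.inl (Solv.mirror (both2 S IH Tr na nb c2.1 c2.2))
      rcases ha with h | h
      · rcases mixed S IH Tr na nb h (by tauto) (by tauto) (by tauto) with h | h
        · exact Or.inl h
        · exact Or.inr ⟨h.1, Or.inl h.2⟩
      · rcases mixed (ℓ := ℓ) S IH Tr.swap nb na (by tauto) (by tauto) (by tauto) (by tauto) with h | h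
        · exact Or.inl h
        · exact Or.inr ⟨by rw [← h.1, S.inv], Or.inr h.2⟩

theorem trail_single {σ : Equiv.Perm E} {μ : E → E} {U : Finset E} (S : Sys σ μ U) {e : E}
    (h : Link σ μ U e) : Trail σ μ U {e, μ e} e (μ e) := by
  refine ⟨by simp, by simp, h.2.2, ?_, ?_, ?_, ?_⟩
  all_goals simp only [Finset.mem_insert, Finset.mem_singleton, forall_eq_or_imp, forall_eq]
  · exact ⟨⟨h, by simp⟩, h.mu S, by simp [S.inv]⟩
  · exact ⟨fun _ => trivial, fun h' => absurd h' h.2.2⟩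
  · exact ⟨fun h' => absurd h'.symm h.2.2, fun _ => trivial⟩
  · exact ⟨fun h1 => absurd (.refl _ _) h1, fun _ h1 => absurd (.refl _ _) h1⟩

theorem trail_ext {σ : Equiv.Perm E} {μ : E → E} {U T : Finset E} (S : Sys σ μ U) {a b : E}
    (Tr : Trail σ μ U T a b) (hn : ¬ NonExt σ μ U T b) :
    ∃ T' b', Trail σ μ U T' a b' ∧ T.card < T'.card ∧ μ b' ≠ a := by
  unfold NonExt at hn
  push Not at hn
  obtain ⟨τ, hτ, hL, hnew⟩ := hn
  have bU := (Tr.link b Tr.hb).1.1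
  have b5 := S.five b bU
  have fT : τ b ∉ T := fun h => hτ.ne1 b b5 (Tr.oneb _ h (hτ.sc b))
  have sab : ¬ σ.SameCycle a (τ b) := fun h => Tr.hab ((sc_iff hτ).1 h)
  refine ⟨T ∪ {τ b, μ (τ b)}, μ (τ b), ⟨?_, ?_, ?_, ?_, ?_, ?_, ?_⟩, ?_, ?_⟩
  · simp [Tr.ha]
  · simp
  · exact hnew a Tr.ha
  · intro e he
    simp only [Finset.mem_union, Finset.mem_insert, Finset.mem_singleton] at he ⊢
    rcases he with he | rfl | rfl
    · exact ⟨(Tr.link e he).1, Or.inl (Tr.link e he).2⟩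
    · exact ⟨hL, by simp⟩
    · exact ⟨hL.mu S, by simp [S.inv]⟩
  · intro e he hs
    simp only [Finset.mem_union, Finset.mem_insert, Finset.mem_singleton] at he ⊢
    rcases he with he | rfl | rfl
    · exact Tr.onea e he hs
    · exact absurd hs sab
    · exact absurd hs (hnew a Tr.ha)
  · intro e he hs
    simp only [Finset.mem_union, Finset.mem_insert, Finset.mem_singleton] at he ⊢
    rcases he with he | rfl | rfl
    · exact absurd hs.symm (hnew e he)
    · exact absurd hs.symm hL.2.2
    · rfl
  · intro e he h1 h2
    have key : ∀ e, σ.SameCycle b e → ∀ f ∈ T ∪ {τ b, μ (τ b)}, σ.SameCycle e f → f = b ∨ f = τ b := by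
      intro e he f hf hef
      simp only [Finset.mem_union, Finset.mem_insert, Finset.mem_singleton] at hf
      rcases hf with hf | hf | rfl
      · exact Or.inl (Tr.oneb f hf (he.trans hef))
      · exact Or.inr hf
      · exact absurd (he.trans hef) (hnew b Tr.hb)
    simp only [Finset.mem_union, Finset.mem_insert, Finset.mem_singleton] at he
    rcases he with he | rfl | rfl
    · by_cases hb : σ.SameCycle b e
      · obtain rfl := Tr.oneb e he hb
        exact ⟨τ, hτ, by simp, key e hb⟩
      · obtain ⟨ρ, hρ, h3, h4⟩ := Tr.mid e he h1 hb
        refine ⟨ρ, hρ, by simp [h3], fun f hf hef => ?_⟩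
        simp only [Finset.mem_union, Finset.mem_insert, Finset.mem_singleton] at hf
        rcases hf with hf | rfl | rfl
        · exact h4 f hf hef
        · exact absurd ((sc_iff hτ).1 hef).symm hb
        · exact absurd hef.symm h2
    · refine ⟨τ⁻¹, hτ.inv, by rw [inv_app]; simp [Tr.hb], fun f hf hef => ?_⟩
      rw [inv_app]
      exact (key _ (hτ.sc b) f hf hef).symm
    · exact absurd (.refl _ _) h2
  · refine Finset.card_lt_card (Finset.ssubset_iff_subset_ne.2 ⟨Finset.subset_union_left, fun h => fT ?_⟩)
    rw [h]; simp
  · rw [S.inv]; intro h; exact sab (by rw [h])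

theorem links_delta {σ : Equiv.Perm E} {μ : E → E} {U : Finset E} (S : Sys σ μ U) {ℓ : E → Bool}
    (IH : ∀ U', U' ⊂ U → Sys σ μ U' → ∀ ℓ', Solv σ μ U' ℓ') (hns : ¬ Solv σ μ U ℓ) {e : E}
    (he : Link σ μ U e) : Dz σ μ U ℓ e (μ e) ∨ Dz σ μ U ℓ (μ e) e := by
  classical
  by_cases hex : ∃ T a b, Trail σ μ U T a b ∧ μ b ≠ a
  · exfalso
    obtain ⟨T0, h0⟩ := hex
    obtain ⟨T, hT, hmax⟩ := Finset.exists_max_image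
      (Finset.univ.filter fun T : Finset E => ∃ a b, Trail σ μ U T a b ∧ μ b ≠ a) Finset.card
      ⟨T0, by simpa using h0⟩
    obtain ⟨a, b, Tr, hab⟩ := (Finset.mem_filter.1 hT).2
    have hx : ∀ a b, Trail σ μ U T a b → NonExt σ μ U T b := by
      intro a b Tr
      by_contra h
      obtain ⟨T', b', Tr', hc, hne⟩ := trail_ext S Tr h
      have := hmax T' (Finset.mem_filter.2 ⟨Finset.mem_univ _, a, b', Tr', hne⟩)
      omega
    rcases trail_solve (ℓ := ℓ) S IH Tr (hx _ _ Tr.swap) (hx _ _ Tr) with h | h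
    · exact hns h
    · exact hab h.1
  · push Not at hex
    have hx : ∀ T a b, Trail σ μ U T a b → NonExt σ μ U T b := by
      intro T a b Tr
      by_contra h
      obtain ⟨T', b', Tr', hc, hne⟩ := trail_ext S Tr h
      exact hne (hex _ _ _ Tr')
    have Tr := trail_single S he
    rcases trail_solve (ℓ := ℓ) S IH Tr (hx _ _ _ Tr.swap) (hx _ _ _ Tr) with h | h
    · exact absurd h hns
    · exact h.2.symm

end Fi
end CCI

namespace CCI
set_option linter.unusedSectionVars false
set_option linter.unusedSimpArgs false
section Par

variable {E : Type*} [Fintype E] [DecidableEq E]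

theorem single0 {σ : Equiv.Perm E} {μ : E → E} {U : Finset E} (S : Sys σ μ U) {ℓ : E → Bool}
    (IH : ∀ U', U' ⊂ U → Sys σ μ U' → ∀ ℓ', Solv σ μ U' ℓ') {c : E} (hc : c ∈ U) (S0 : Finset E)
    (h0 : ∀ e ∈ S0, σ.SameCycle c e ∧ ((Ext μ U e ∧ ℓ e = false) ∨ (Chord σ μ U e ∧ μ e ∈ S0)))
    (sh : ShP σ S0 c) : Solv σ μ U ℓ := by
  classical
  have mK : ∀ e, e ∈ KT σ U {c} ↔ σ.SameCycle c e := by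
    intro e; rw [mem_KT]; simp only [Finset.mem_singleton, exists_eq_left]
    exact ⟨fun h => h.2, fun h => ⟨S.closed _ _ h hc, h⟩⟩
  let m0 : E → ZMod 11 := fun e => if e ∈ S0 then 0 else 1
  have v0 : ∀ e ∈ S0, m0 e = 0 := fun e h => by simp only [m0]; rw [if_pos h]
  have v1 : ∀ e, e ∉ S0 → m0 e = 1 := fun e h => by simp only [m0]; rw [if_neg h]
  have hmu : ∀ e ∈ S0, μ e ∈ U → μ e ∈ S0 := by
    intro e h hU
    rcases (h0 e h).2 with h1 | h1
    · rcases h1.1.2 with h2 | h2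
      · exact absurd hU h2
      · rwa [h2]
    · exact h1.2
  refine step S IH (KT σ U {c}) (fun e he => (mem_KT.1 he).1) ⟨c, (mK c).2 (.refl _ _)⟩
    (KT_closed S _) m0 (fun _ => true) ?_ ?_ ?_
  · intro e he hme
    by_cases h : e ∈ S0
    · rw [v0 e h, v0 _ (hmu e h (mem_KT.1 hme).1)]
    · rw [v1 e h, v1]
      intro h'
      have := hmu _ h' (by rw [S.inv]; exact (mem_KT.1 he).1)
      rw [S.inv] at this; exact h this
  · intro e he hx
    by_cases h : e ∈ S0
    · rw [v0 e h]
      rcases (h0 e h).2 with h1 | h1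
      · rw [h1.2]; right; rfl
      · rcases hx with hx | hx
        · exact absurd h1.1.2.1 hx
        · exact absurd hx h1.1.2.2.1
    · rw [v1 e h]; left; rfl
  · intro m hm e he
    have w0 : ∀ f ∈ S0, m f = 0 := by
      intro f hf
      rw [(hm f ((mK f).2 (h0 f hf).1)).2, v0 f hf]
      rintro ⟨h1, h2⟩
      exact h2 ((mK _).2 (h0 _ (hmu f hf h1)).1)
    have w1 : ∀ f, σ.SameCycle c f → f ∉ S0 → m f = 1 ∨ m f = 2 := by
      intro f hf hn
      have := hm f ((mK f).2 hf)
      by_cases h : μ f ∈ U ∧ μ f ∉ KT σ U {c}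
      · exact inL_true (this.1 h)
      · left; rw [this.2 h, v1 f hn]
    have w : ∀ f, σ.SameCycle c f → m f = 0 ∨ m f = 1 ∨ m f = 2 := by
      intro f hf
      by_cases h : f ∈ S0
      · exact Or.inl (w0 f h)
      · exact w12 (w1 f hf h)
    obtain ⟨e0, τ, hτ, hs, a0, a1, a2, a3⟩ := sh
    have hs1 := hτ.sc_right hs
    have hs2 := hτ.sc_right hs1
    have hs3 := hτ.sc_right hs2
    have hs4 := hτ.sc_right hs3
    have h0 := S.closed c e0 hs hc
    refine (good58 hτ (S.odd _ h0) (S.five _ h0) ?_ ?_).same (hs.symm.trans ((mK e).1 he))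
    · rw [w0 _ a0, w0 _ a1]
      exact win_P0 _ _ _ (w1 _ hs2 a2) (w1 _ hs3 a3) (w _ hs4)
    · intro f hf _ _ _ _ _
      exact w f (hs.trans hf)

theorem adj_ext {σ : Equiv.Perm E} {μ : E → E} {U : Finset E} (S : Sys σ μ U) {ℓ : E → Bool}
    (IH : ∀ U', U' ⊂ U → Sys σ μ U' → ∀ ℓ', Solv σ μ U' ℓ') {c : E} {τ : Equiv.Perm E} (hτ : Dir σ τ)
    (h1 : Ext μ U c) (h2 : Ext μ U (τ c)) (h : ℓ (τ c) = ℓ c) : Solv σ μ U ℓ := by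
  have main : ∀ ℓ : E → Bool, ℓ c = false → ℓ (τ c) = false → Solv σ μ U ℓ := by
    intro ℓ l1 l2
    refine single0 S IH h1.1 {c, τ c} ?_ (shP_pair hτ (S.five _ h1.1) (by simp) (by simp) ?_)
    · intro e he
      simp only [Finset.mem_insert, Finset.mem_singleton] at he
      rcases he with rfl | rfl
      · exact ⟨.refl _ _, Or.inl ⟨h1, l1⟩⟩
      · exact ⟨hτ.sc _, Or.inl ⟨h2, l2⟩⟩
    · intro f _ hf
      simpa using hf
  cases hl : ℓ c
  · exact main ℓ hl (by rw [h, hl])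
  · exact Solv.mirror (main _ (by simp [hl]) (by simp [h, hl]))

theorem adj_chord {σ : Equiv.Perm E} {μ : E → E} {U : Finset E} (S : Sys σ μ U) {ℓ : E → Bool}
    (IH : ∀ U', U' ⊂ U → Sys σ μ U' → ∀ ℓ', Solv σ μ U' ℓ') {c : E} {τ : Equiv.Perm E} (hτ : Dir σ τ)
    (h1 : Ext μ U c) (h2 : Chord σ μ U (τ c)) : Solv σ μ U ℓ := by
  have main : ∀ ℓ : E → Bool, ℓ c = false → Solv σ μ U ℓ := by
    intro ℓ l1
    refine single0 S IH h1.1 {c, τ c, μ (τ c)} ?_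
      (shP_chord (d := μ (τ c)) hτ ?_ (by simp) (by simp) ?_)
    · intro e he
      simp only [Finset.mem_insert, Finset.mem_singleton] at he
      rcases he with rfl | rfl | rfl
      · exact ⟨.refl _ _, Or.inl ⟨h1, l1⟩⟩
      · exact ⟨hτ.sc _, Or.inr ⟨h2, by simp⟩⟩
      · refine ⟨(hτ.sc _).trans h2.2.2.2, Or.inr ⟨⟨h2.2.1, ?_, ?_, ?_⟩, by simp [S.inv]⟩⟩
        · rw [S.inv]; exact h2.1
        · rw [S.inv]; exact h2.2.2.1.symm
        · rw [S.inv]; exact h2.2.2.2.symm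
    · rw [minimalPeriod_same σ (hτ.sc c)]
      exact S.seven _ h2.1 h2.2.2.1 h2.2.2.2
    · intro f _ hf
      simpa using hf
  cases hl : ℓ c
  · exact main ℓ hl
  · exact Solv.mirror (main _ (by simp [hl]))

theorem card_cycle (σ : Equiv.Perm E) (e : E) [DecidablePred fun f => σ.SameCycle e f] :
    (Finset.univ.filter fun f => σ.SameCycle e f).card = Function.minimalPeriod σ e := by
  have hpos : 0 < Function.minimalPeriod σ e := by
    obtain ⟨n, h0, -, h1⟩ := Equiv.Perm.SameCycle.exists_pow_eq' (Equiv.Perm.SameCycle.refl σ e) |>.imp (fun n h => (⟨trivial, h.1, h.2⟩ : True ∧ _ ∧ _))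
    exact Function.minimalPeriod_pos_of_mem_periodicPts
      (Function.mem_periodicPts.2 ⟨orderOf σ, orderOf_pos σ, by
        rw [Function.IsPeriodicPt, Function.IsFixedPt, ← Equiv.Perm.coe_pow, pow_orderOf_eq_one]; rfl⟩)
  have : (Finset.univ.filter fun f => σ.SameCycle e f) =
      (Finset.range (Function.minimalPeriod σ e)).image fun i => (σ ^ i) e := by
    ext f
    simp only [Finset.mem_filter, Finset.mem_univ, true_and, Finset.mem_image, Finset.mem_range]
    constructor
    · intro hf
      obtain ⟨i, hi⟩ := hf.exists_nat_pow_eq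
      refine ⟨i % Function.minimalPeriod σ e, Nat.mod_lt _ hpos, ?_⟩
      rw [← hi, Equiv.Perm.coe_pow, Equiv.Perm.coe_pow, Function.iterate_mod_minimalPeriod_eq]
    · rintro ⟨i, _, rfl⟩
      exact ⟨i, by simp⟩
  rw [this, Finset.card_image_of_injOn, Finset.card_range]
  intro i hi j hj h
  simp only [Finset.coe_range, Set.mem_Iio] at hi hj
  beta_reduce at h
  rw [Equiv.Perm.coe_pow, Equiv.Perm.coe_pow] at h
  exact (Function.iterate_eq_iterate_iff_of_lt_minimalPeriod hi hj).1 h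

theorem even_invol (s : Finset E) (μ : E → E) (h1 : ∀ e ∈ s, μ e ∈ s) (h2 : ∀ e, μ (μ e) = e)
    (h3 : ∀ e ∈ s, μ e ≠ e) : Even s.card := by
  have := Finset.sum_involution (s := s) (f := fun _ => (1 : ZMod 2)) (fun e _ => μ e)
    (fun _ _ => by decide) (fun e he _ => h3 e he) (fun e he => h1 e he) (fun e _ => h2 e)
  rw [Finset.sum_const, nsmul_eq_mul, mul_one] at this
  exact (ZMod.natCast_eq_zero_iff_even).1 this

open Classical in
theorem solvable {σ : Equiv.Perm E} {μ : E → E} (U : Finset E) (S : Sys σ μ U) (ℓ : E → Bool) :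
    Solv σ μ U ℓ := by
  induction U using Finset.strongInduction generalizing ℓ with
  | H U IH' =>
  have IH : ∀ U', U' ⊂ U → Sys σ μ U' → ∀ ℓ', Solv σ μ U' ℓ' := fun U' h S' ℓ' => IH' U' h S' ℓ'
  by_contra hns
  rcases U.eq_empty_or_nonempty with rfl | ⟨e, he⟩
  · exact hns ⟨fun _ => 0, by simp, by simp, by simp⟩
  have hσ : Dir σ σ := Or.inl rfl
  have hD := fun {e : E} (he : Link σ μ U e) => links_delta S IH hns he
  have flank : ∀ f, Link σ μ U f → Ext μ U (σ f) ∧ Ext μ U (σ⁻¹ f) ∧ ℓ (σ f) = ℓ (σ⁻¹ f) := by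
    intro f hf
    rcases hD hf with h | h
    · have h1 := (h σ hσ).1; have h2 := (h σ⁻¹ hσ.inv).1
      exact ⟨h1.1, h2.1, by rw [h1.2, h2.2]⟩
    · have h1 := (h σ hσ).2; have h2 := (h σ⁻¹ hσ.inv).2
      exact ⟨h1.1, h2.1, by rw [h1.2, h2.2]⟩
  by_cases hall : ∀ f, σ.SameCycle e f → Chord σ μ U f
  · have := even_invol (Finset.univ.filter fun f => σ.SameCycle e f) μ ?_ S.inv ?_
    · rw [card_cycle] at this
      exact (Nat.not_even_iff_odd.2 (S.odd e he)) this
    · intro f hf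
      simp only [Finset.mem_filter, Finset.mem_univ, true_and] at hf ⊢
      exact hf.trans (hall f hf).2.2.2
    · intro f hf
      simp only [Finset.mem_filter, Finset.mem_univ, true_and] at hf ⊢
      exact (hall f hf).2.2.1
  · push Not at hall
    obtain ⟨g, hg, hgc⟩ := hall
    have gU := S.closed _ _ hg he
    have cse : ∀ f, f ∈ U → ¬ Chord σ μ U f → Link σ μ U f ∨ Ext μ U f := fun f hf h => by
      rcases tri σ μ U hf with h1 | h1 | h1
      · exact Or.inl h1
      · exact absurd h1 h
      · exact Or.inr h1
    have nx : ∀ f, f ∈ U → ¬ Chord σ μ U f → ¬ Chord σ μ U (σ f) := by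
      intro f hf hc hc'
      rcases cse f hf hc with h | h
      · rcases (flank f h).1.2 with h1 | h1
        · exact h1 hc'.2.1
        · exact hc'.2.2.1 h1
      · exact hns (adj_chord S IH hσ h hc')
    let col : E → Bool := fun f => if Ext μ U f then ℓ f else !ℓ (σ f)
    have cE : ∀ f, Ext μ U f → col f = ℓ f := fun f h => by simp only [col]; rw [if_pos h]
    have cL : ∀ f, Link σ μ U f → col f = !ℓ (σ f) := fun f h => by
      simp only [col]; rw [if_neg h.not_ext]
    have cn : ∀ f, f ∈ U → ¬ Chord σ μ U f → col (σ f) = !col f := by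
      intro f hf hc
      have sU := S.closed _ _ (hσ.sc f) hf
      rcases cse f hf hc with h | h
      · rw [cL f h, cE _ (flank f h).1]; simp
      · rcases cse _ sU (nx f hf hc) with h' | h'
        · rw [cE f h, cL _ h', (flank _ h').2.2, inv_app]
        · rw [cE f h, cE _ h']
          by_contra hne
          refine hns (adj_ext S IH hσ h h' ?_)
          revert hne
          cases ℓ (σ f) <;> cases ℓ f <;> simp
    have it : ∀ k : ℕ, (σ ^ k) g ∈ U ∧ ¬ Chord σ μ U ((σ ^ k) g) ∧
        col ((σ ^ k) g) = (col g ^^ decide (Odd k)) := by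
      intro k
      induction k with
      | zero => simp [gU, hgc]
      | succ k ih =>
        rw [pow_succ', Equiv.Perm.mul_apply]
        refine ⟨S.closed _ _ (hσ.sc _) ih.1, nx _ ih.1 ih.2.1, ?_⟩
        rw [cn _ ih.1 ih.2.1, ih.2.2]
        by_cases ho : Odd k
        · have : ¬ Odd (k + 1) := by rw [Nat.not_odd_iff_even]; exact ho.add_one
          simp [ho, this]
        · have : Odd (k + 1) := (Nat.not_odd_iff_even.1 ho).add_one
          simp [ho, this]
    have := (it (Function.minimalPeriod σ g)).2.2
    have ho := S.odd g gU
    have hper : (σ ^ (Function.minimalPeriod σ g)) g = g := by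
      rw [Equiv.Perm.coe_pow]; exact Function.isPeriodicPt_minimalPeriod _ _
    rw [hper, decide_eq_true ho] at this
    revert this
    cases col g <;> simp

end Par
end CCI

namespace CCI
open SimpleGraph

section Gr
variable {V : Type*}

/-- an edge colouring of `G` by `ℤ/11`, adjacent edges getting far colours. -/
def Col (G : SimpleGraph V) : Prop :=
  ∃ c : V → V → ZMod 11, (∀ u v, G.Adj u v → c u v = c v u) ∧
    ∀ v x y, G.Adj v x → G.Adj v y → x ≠ y → Far (c v x) (c v y)

/-- maximum degree at most three, elementary form. -/
def Sub3 (G : SimpleGraph V) : Prop :=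
  ∀ v a b c d, G.Adj v a → G.Adj v b → G.Adj v c → G.Adj v d →
    a = b ∨ a = c ∨ a = d ∨ b = c ∨ b = d ∨ c = d

/-- `H2`-freeness, elementary form. -/
def NoH2 (G : SimpleGraph V) : Prop :=
  ∀ a b c d s, a ≠ b → s ≠ c → s ≠ d → G.Adj a c → G.Adj a d → G.Adj b c → G.Adj b d →
    G.Adj c d → G.Adj a s → G.Adj b s → False

/-- no edge cut consisting of one edge. -/
def NoCut (G : SimpleGraph V) : Prop :=
  ∀ (S : V → Prop) u v, S u → ¬ S v → G.Adj u v →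
    ∃ u' v', S u' ∧ ¬ S v' ∧ G.Adj u' v' ∧ ¬ (u' = u ∧ v' = v)

/-- twice the number of edges. -/
noncomputable def sz (G : SimpleGraph V) : ℕ := {p : V × V | G.Adj p.1 p.2}.ncard

theorem Sub3.mono {G G' : SimpleGraph V} (h : Sub3 G) (hle : G' ≤ G) : Sub3 G' :=
  fun v a b c d h1 h2 h3 h4 => h v a b c d (hle h1) (hle h2) (hle h3) (hle h4)

theorem NoH2.mono {G G' : SimpleGraph V} (h : NoH2 G) (hle : G' ≤ G) : NoH2 G' :=
  fun a b c d s n1 n2 n3 h1 h2 h3 h4 h5 h6 h7 =>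
    h a b c d s n1 n2 n3 (hle h1) (hle h2) (hle h3) (hle h4) (hle h5) (hle h6) (hle h7)

theorem sz_lt [Finite V] {G G' : SimpleGraph V} (hle : G' ≤ G) {u v : V} (h : G.Adj u v)
    (h' : ¬ G'.Adj u v) : sz G' < sz G := by
  refine Set.ncard_lt_ncard ⟨fun p hp => hle hp, fun hs => ?_⟩ (Set.toFinite _)
  exact h' (hs (show (u, v) ∈ {p : V × V | G.Adj p.1 p.2} from h))

/-- a colour that is free at a vertex with at most two neighbours. -/
theorem free_colour {G : SimpleGraph V} {c : V → V → ZMod 11} {u : V}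
    (hc : ∀ x y, G.Adj u x → G.Adj u y → x ≠ y → Far (c u x) (c u y))
    (h2 : ∀ x y z, G.Adj u x → G.Adj u y → G.Adj u z → x = y ∨ x = z ∨ y = z) :
    ∃ α, ∀ x, G.Adj u x → Far (c u x) α := by
  by_cases h : ∃ x, G.Adj u x
  · obtain ⟨x, hx⟩ := h
    by_cases h' : ∃ y, G.Adj u y ∧ y ≠ x
    · obtain ⟨y, hy, hyx⟩ := h'
      obtain ⟨α, h3, h4⟩ := exists_far2 _ _ (hc x y hx hy hyx.symm)
      refine ⟨α, fun z hz => ?_⟩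
      rcases h2 x y z hx hy hz with rfl | rfl | rfl
      · exact absurd rfl hyx
      · exact h3.symm
      · exact h4.symm
    · push Not at h'
      obtain ⟨α, h3⟩ := exists_far1 (c u x)
      refine ⟨α, fun z hz => ?_⟩
      rw [h' z hz]; exact h3.symm
  · push Not at h
    exact ⟨0, fun x hx => absurd hx (h x)⟩

theorem cut_step [Finite V] {G : SimpleGraph V} (h3 : Sub3 G) (hh : NoH2 G)
    (IH : ∀ G' : SimpleGraph V, sz G' < sz G → Sub3 G' → NoH2 G' → Col G')
    (hn : ¬ NoCut G) : Col G := by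
  classical
  unfold NoCut at hn
  push Not at hn
  obtain ⟨S, u, v, hu, hv, huv, hone⟩ := hn
  set G' := G.deleteEdges {s(u, v)} with hG'
  have hle : G' ≤ G := G.deleteEdges_le _
  have ha : ∀ x y, G'.Adj x y ↔ G.Adj x y ∧ ¬ (x = u ∧ y = v) ∧ ¬ (x = v ∧ y = u) := by
    intro x y
    rw [hG', deleteEdges_adj]
    simp
  obtain ⟨c, hs, hc⟩ := IH G' (sz_lt hle huv (by simp [ha])) (h3.mono hle) (hh.mono hle)
  have hne : u ≠ v := huv.ne
  obtain ⟨α, hα⟩ := free_colour (G := G') (c := c) (u := u) (fun x y => hc u x y) (by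
    intro x y z hx hy hz
    rw [ha] at hx hy hz
    have := h3 u x y z v hx.1 hy.1 hz.1 huv
    grind)
  obtain ⟨β, hβ⟩ := free_colour (G := G') (c := c) (u := v) (fun x y => hc v x y) (by
    intro x y z hx hy hz
    rw [ha] at hx hy hz
    have := h3 v x y z u hx.1 hy.1 hz.1 huv.symm
    grind)
  have hcross : ∀ x y, G.Adj x y → S x → ¬ S y → x = u ∧ y = v :=
    fun x y hxy hx hy => hone x y hx hy hxy
  have hβ' : ∀ x, G'.Adj v x → Far (c v x) β := hβ
  have hα' : ∀ x, G'.Adj u x → Far (c u x + (β - α)) β := by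
    intro x hx
    have := (hα x hx).add_right (β - α)
    simpa using this
  refine ⟨fun x y => if (x = u ∧ y = v) ∨ (x = v ∧ y = u) then β else
    if S x then c x y + (β - α) else c x y, ?_, ?_⟩
  · intro x y hxy
    by_cases h1 : (x = u ∧ y = v) ∨ (x = v ∧ y = u)
    · have h2 : (y = u ∧ x = v) ∨ (y = v ∧ x = u) := by grind
      simp only [h1, h2, if_true]
    · have h2 : ¬ ((y = u ∧ x = v) ∨ (y = v ∧ x = u)) := by grind
      have h4 : G'.Adj x y := by rw [ha]; grind
      have h5 := hs x y h4
      have h6 : S x ↔ S y := by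
        have := hcross x y hxy
        have := hcross y x hxy.symm
        grind
      simp only [h1, h2, if_false, h6, h5]
  · intro w x y hx hy hxy
    have key : ∀ x, G.Adj w x → ¬ ((w = u ∧ x = v) ∨ (w = v ∧ x = u)) → G'.Adj w x := by
      intro x hx hh; rw [ha]; grind
    by_cases h1 : (w = u ∧ x = v) ∨ (w = v ∧ x = u) <;>
    by_cases h2 : (w = u ∧ y = v) ∨ (w = v ∧ y = u)
    · grind
    · simp only [h1, h2, if_true, if_false]
      have := key y hy h2
      rcases h1 with ⟨rfl, rfl⟩ | ⟨rfl, rfl⟩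
      · simp only [hu, if_true]; exact (hα' y this).symm
      · simp only [hv, if_false]; exact (hβ' y this).symm
    · simp only [h1, h2, if_true, if_false]
      have := key x hx h1
      rcases h2 with ⟨rfl, rfl⟩ | ⟨rfl, rfl⟩
      · simp only [hu, if_true]; exact (hα' x this)
      · simp only [hv, if_false]; exact (hβ' x this)
    · simp only [h1, h2, if_false]
      have := hc w x y (key x hx h1) (key y hy h2) hxy
      split_ifs
      · exact this.add_right _
      · exact this

/-- colouring a closed seven vertex piece. -/
theorem comp_step [Finite V] {G : SimpleGraph V} (h3 : Sub3 G) (hh : NoH2 G)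
    (IH : ∀ G' : SimpleGraph V, sz G' < sz G → Sub3 G' → NoH2 G' → Col G')
    (φ : Fin 7 → V) (hφ : Function.Injective φ) (t : Fin 7 → Fin 7 → ZMod 11)
    (A : Fin 7 → Fin 7 → Prop)
    (hA : ∀ i w, G.Adj (φ i) w → ∃ j, w = φ j ∧ A i j)
    (ht : ∀ i j, A i j → t i j = t j i)
    (hp : ∀ i j k, A i j → A i k → j ≠ k → Far (t i j) (t i k))
    {w : V} (hw : G.Adj (φ 0) w) : Col G := by
  classical
  let G' : SimpleGraph V :=
    { Adj := fun x y => G.Adj x y ∧ x ∉ Set.range φ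
      symm := ⟨by
        rintro x y ⟨h, hx⟩
        refine ⟨h.symm, ?_⟩
        rintro ⟨i, rfl⟩
        obtain ⟨j, hj, -⟩ := hA i x h.symm
        exact hx ⟨j, hj.symm⟩⟩
      loopless := ⟨fun x h => G.irrefl h.1⟩ }
  have hle : G' ≤ G := fun x y h => h.1
  obtain ⟨c, hs, hc⟩ := IH G' (sz_lt hle hw (fun h => h.2 ⟨0, rfl⟩)) (h3.mono hle) (hh.mono hle)
  have key : ∀ x, (∃ i, x = φ i) ∨ x ∉ Set.range φ := by
    intro x
    by_cases h : x ∈ Set.range φ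
    · left; obtain ⟨i, hi⟩ := h; exact ⟨i, hi.symm⟩
    · right; exact h
  let g := Function.invFun φ
  have hg : ∀ i, g (φ i) = i := Function.leftInverse_invFun hφ
  refine ⟨fun x y => if x ∈ Set.range φ then t (g x) (g y) else c x y, ?_, ?_⟩
  · intro x y hxy
    rcases key x with ⟨i, rfl⟩ | hx
    · obtain ⟨j, rfl, hj⟩ := hA i y hxy
      simp only [Set.mem_range_self, if_true, hg, ht i j hj]
    · have hy : y ∉ Set.range φ := (G'.adj_symm (show G'.Adj x y from ⟨hxy, hx⟩)).2
      simp only [hx, hy, if_false]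
      exact hs x y ⟨hxy, hx⟩
  · intro v x y hx hy hxy
    rcases key v with ⟨i, rfl⟩ | hv
    · obtain ⟨j, rfl, hj⟩ := hA i x hx
      obtain ⟨k, rfl, hk⟩ := hA i y hy
      simp only [Set.mem_range_self, if_true, hg]
      exact hp i j k hj hk (fun h => hxy (by rw [h]))
    · simp only [hv, if_false]
      exact hc v x y ⟨hx, hv⟩ ⟨hy, hv⟩ hxy

end Gr
end CCI

namespace CCI
open SimpleGraph

section Gr
variable {V : Type*}

theorem seven_step [Finite V] {G : SimpleGraph V} (h3 : Sub3 G) (hh : NoH2 G) (hcut : NoCut G)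
    (IH : ∀ G' : SimpleGraph V, sz G' < sz G → Sub3 G' → NoH2 G' → Col G')
    (φ : Fin 7 → V) (hφ : Function.Injective φ) (n1 n2 n3 : Fin 7 → Fin 7) (δ : Fin 7)
    (t : Fin 7 → Fin 7 → ZMod 11)
    (a1 : ∀ i, G.Adj (φ i) (φ (n1 i))) (a2 : ∀ i, G.Adj (φ i) (φ (n2 i)))
    (a3 : ∀ i, G.Adj (φ i) (φ (n3 i)))
    (hd : ∀ i, n1 i ≠ n2 i ∧ (i ≠ δ → n1 i ≠ n3 i ∧ n2 i ≠ n3 i))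
    (hsym : ∀ i j, (j = n1 i ∨ j = n2 i ∨ j = n3 i) → (i = n1 j ∨ i = n2 j ∨ i = n3 j))
    (ht : ∀ i j, t i j = t j i)
    (hp : ∀ i, Far (t i (n1 i)) (t i (n2 i)) ∧
      (i ≠ δ → Far (t i (n1 i)) (t i (n3 i)) ∧ Far (t i (n2 i)) (t i (n3 i))))
    (hδ : n3 δ = n2 δ) : Col G := by
  have full : ∀ i w, i ≠ δ → G.Adj (φ i) w → ∃ j, w = φ j ∧ (j = n1 i ∨ j = n2 i ∨ j = n3 i) := by
    intro i w hi hw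
    have h1 := h3 (φ i) w _ _ _ hw (a1 i) (a2 i) (a3 i)
    have h2 := hd i
    have e : ∀ j k, φ j = φ k ↔ j = k := fun j k => hφ.eq_iff
    simp only [e] at h1
    have h4 := h2.2 hi
    rcases h1 with h | h | h | h | h | h
    · exact ⟨_, h, Or.inl rfl⟩
    · exact ⟨_, h, Or.inr (Or.inl rfl)⟩
    · exact ⟨_, h, Or.inr (Or.inr rfl)⟩
    · exact absurd h h2.1
    · exact absurd h h4.1
    · exact absurd h h4.2
  have hA : ∀ i w, G.Adj (φ i) w → ∃ j, w = φ j ∧ (j = n1 i ∨ j = n2 i ∨ j = n3 i) := by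
    intro i w hw
    by_cases hi : i = δ
    · subst hi
      by_contra hcon
      push Not at hcon
      have hout : ¬ ∃ j, φ j = w := by
        rintro ⟨j, rfl⟩
        have h1 := hcon j rfl
        by_cases hj : j = i
        · subst hj; exact G.irrefl hw
        · obtain ⟨k, hk, hk2⟩ := full j _ hj hw.symm
          have hk' := hφ hk
          subst hk'
          have := hsym j i hk2
          tauto
      obtain ⟨u, v, ⟨j, rfl⟩, hv, huv, hne⟩ := hcut (fun x => ∃ j, φ j = x) (φ i) w ⟨i, rfl⟩ hout hw
      by_cases hj : j = i
      · subst hj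
        have hvw : v ≠ w := fun h => hne ⟨rfl, h⟩
        have := h3 (φ j) v w _ _ huv hw (a1 j) (a2 j)
        have h5 := (hd j).1
        rcases this with h | h | h | h | h | h
        · exact hvw h
        · exact hv ⟨_, h.symm⟩
        · exact hv ⟨_, h.symm⟩
        · exact hout ⟨_, h.symm⟩
        · exact hout ⟨_, h.symm⟩
        · exact h5 (hφ h)
      · obtain ⟨k, hk, -⟩ := full j v hj huv
        exact hv ⟨k, hk.symm⟩
    · exact full i w hi hw
  refine comp_step h3 hh IH φ hφ t (fun i j => j = n1 i ∨ j = n2 i ∨ j = n3 i) hA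
    (fun i j _ => ht i j) ?_ (a1 0)
  intro i j k hj hk hjk
  obtain ⟨p1, p2⟩ := hp i
  by_cases hi : i = δ
  · subst hi
    rw [hδ] at hj hk
    rcases hj with rfl | rfl | rfl <;> rcases hk with rfl | rfl | rfl <;>
      first | exact absurd rfl hjk | exact p1 | exact p1.symm
  · obtain ⟨p3, p4⟩ := p2 hi
    rcases hj with rfl | rfl | rfl <;> rcases hk with rfl | rfl | rfl <;>
      first | exact absurd rfl hjk | exact p1 | exact p1.symm | exact p3 | exact p3.symm
            | exact p4 | exact p4.symm


theorem inj7 {a b c d e f g : V} (h : [a, b, c, d, e, f, g].Nodup) :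
    Function.Injective ![a, b, c, d, e, f, g] := by
  intro i j hij
  have := h.injective_get (a₁ := i) (a₂ := j)
  apply this
  fin_cases i <;> fin_cases j <;> exact hij

theorem all7 {P : Fin 7 → Prop} (p0 : P 0) (p1 : P 1) (p2 : P 2) (p3 : P 3) (p4 : P 4) (p5 : P 5)
    (p6 : P 6) (i : Fin 7) : P i := by
  fin_cases i <;> assumption

theorem sevenS [Finite V] {G : SimpleGraph V} (h3 : Sub3 G) (hh : NoH2 G) (hcut : NoCut G)
    (IH : ∀ G' : SimpleGraph V, sz G' < sz G → Sub3 G' → NoH2 G' → Col G')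
    (a b c d x y z : V) (hnd : [a, b, c, d, x, y, z].Nodup)
    (e0 : G.Adj a c) (e1 : G.Adj a d) (e2 : G.Adj b c) (e3 : G.Adj b d) (e4 : G.Adj c d) (e5 : G.Adj a x) (e6 : G.Adj b y) (e7 : G.Adj x y) (e8 : G.Adj y z) (e9 : G.Adj x z) :
    Col G := by
  refine seven_step h3 hh hcut IH ![a, b, c, d, x, y, z] (inj7 hnd) ![2, 2, 0, 0, 0, 1, 5] ![3, 3, 1, 1, 5, 4, 4]
    ![4, 5, 3, 2, 6, 6, 4] 6
    ![![0, 0, 0, 3, 6, 0, 0], ![0, 0, 3, 0, 0, 7, 0], ![0, 3, 0, 6, 0, 0, 0], ![3, 0, 6, 0, 0, 0, 0], ![6, 0, 0, 0, 0, 1, 9], ![0, 7, 0, 0, 1, 0, 4], ![0, 0, 0, 0, 9, 4, 0]]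
    ?_ ?_ ?_ (by decide) (by decide) (by decide) (by decide) (by decide)
  · exact all7 e0 e2 e0.symm e1.symm e5.symm e6.symm e8.symm
  · exact all7 e1 e3 e2.symm e3.symm e7 e7.symm e9.symm
  · exact all7 e5 e6 e4 e4.symm e9 e8 e9.symm

theorem sevenA [Finite V] {G : SimpleGraph V} (h3 : Sub3 G) (hh : NoH2 G) (hcut : NoCut G)
    (IH : ∀ G' : SimpleGraph V, sz G' < sz G → Sub3 G' → NoH2 G' → Col G')
    (b c d s x y z : V) (hnd : [b, c, d, s, x, y, z].Nodup)
    (e0 : G.Adj c x) (e1 : G.Adj d y) (e2 : G.Adj s z) (e3 : G.Adj b c) (e4 : G.Adj b d) (e5 : G.Adj b s) (e6 : G.Adj c d) (e7 : G.Adj x y) (e8 : G.Adj y z) (e9 : G.Adj x z) :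
    Col G := by
  refine seven_step h3 hh hcut IH ![b, c, d, s, x, y, z] (inj7 hnd) ![1, 4, 5, 6, 1, 2, 3] ![2, 0, 0, 0, 5, 4, 5]
    ![3, 2, 1, 0, 6, 6, 4] 3
    ![![0, 4, 1, 9, 0, 0, 0], ![4, 0, 7, 0, 0, 0, 0], ![1, 7, 0, 0, 0, 4, 0], ![9, 0, 0, 0, 0, 0, 6], ![0, 0, 0, 0, 0, 7, 3], ![0, 0, 4, 0, 7, 0, 0], ![0, 0, 0, 6, 3, 0, 0]]
    ?_ ?_ ?_ (by decide) (by decide) (by decide) (by decide) (by decide)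
  · exact all7 e3 e0 e1 e2 e0.symm e1.symm e2.symm
  · exact all7 e4 e3.symm e4.symm e5.symm e7 e7.symm e8.symm
  · exact all7 e5 e6 e6.symm e5.symm e9 e8 e9.symm

theorem sevenC [Finite V] {G : SimpleGraph V} (h3 : Sub3 G) (hh : NoH2 G) (hcut : NoCut G)
    (IH : ∀ G' : SimpleGraph V, sz G' < sz G → Sub3 G' → NoH2 G' → Col G')
    (a b d s x y z : V) (hnd : [a, b, d, s, x, y, z].Nodup)
    (e0 : G.Adj a x) (e1 : G.Adj b y) (e2 : G.Adj d z) (e3 : G.Adj a d) (e4 : G.Adj b d) (e5 : G.Adj a s) (e6 : G.Adj b s) (e7 : G.Adj x y) (e8 : G.Adj y z) (e9 : G.Adj x z) :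
    Col G := by
  refine seven_step h3 hh hcut IH ![a, b, d, s, x, y, z] (inj7 hnd) ![4, 5, 6, 0, 0, 1, 2] ![2, 2, 0, 1, 5, 4, 5]
    ![3, 3, 1, 1, 6, 6, 4] 3
    ![![0, 0, 3, 7, 0, 0, 0], ![0, 0, 9, 4, 0, 1, 0], ![3, 9, 0, 0, 0, 0, 6], ![7, 4, 0, 0, 0, 0, 0], ![0, 0, 0, 0, 0, 6, 3], ![0, 1, 0, 0, 6, 0, 9], ![0, 0, 6, 0, 3, 9, 0]]
    ?_ ?_ ?_ (by decide) (by decide) (by decide) (by decide) (by decide)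
  · exact all7 e0 e1 e2 e5.symm e0.symm e1.symm e2.symm
  · exact all7 e3 e4 e3.symm e6.symm e7 e7.symm e8.symm
  · exact all7 e5 e6 e4.symm e6.symm e9 e8 e9.symm

end Gr
end CCI

set_option linter.unusedSimpArgs false
namespace CCI
open SimpleGraph

section Gr
variable {V : Type*}

theorem three_far {A B C : ZMod 11 → Prop} (hA : ∀ a a', A a → A a' → a = a')
    (hB : ∀ a a', B a → B a' → a = a') (hC : ∀ a a', C a → C a' → a = a')
    (hAB : ∀ a b, A a → B b → Far a b) (hAC : ∀ a b, A a → C b → Far a b)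
    (hBC : ∀ a b, B a → C b → Far a b) :
    ∃ α β γ, Far α β ∧ Far α γ ∧ Far β γ ∧ (∀ a, A a → a = α) ∧ (∀ b, B b → b = β) ∧
      ∀ c, C c → c = γ := by
  have aux : ∀ P : ZMod 11 → Prop, (∃ a, P a) ∨ ∀ a, ¬ P a := by
    intro P
    by_cases h : ∃ a, P a
    · exact Or.inl h
    · right; push Not at h; exact h
  rcases aux A with ⟨a, ha⟩ | ha <;> rcases aux B with ⟨b, hb⟩ | hb <;>
    rcases aux C with ⟨c, hc⟩ | hc
  · exact ⟨a, b, c, hAB _ _ ha hb, hAC _ _ ha hc, hBC _ _ hb hc, fun _ h => hA _ _ h ha,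
      fun _ h => hB _ _ h hb, fun _ h => hC _ _ h hc⟩
  · obtain ⟨c, h1, h2⟩ := exists_far2 a b (hAB _ _ ha hb)
    exact ⟨a, b, c, hAB _ _ ha hb, h1.symm, h2.symm, fun _ h => hA _ _ h ha,
      fun _ h => hB _ _ h hb, fun _ h => absurd h (hc _)⟩
  · obtain ⟨b, h1, h2⟩ := exists_far2 a c (hAC _ _ ha hc)
    exact ⟨a, b, c, h1.symm, hAC _ _ ha hc, h2, fun _ h => hA _ _ h ha,
      fun _ h => absurd h (hb _), fun _ h => hC _ _ h hc⟩
  · obtain ⟨b, h1⟩ := exists_far1 a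
    obtain ⟨c, h2, h3⟩ := exists_far2 a b h1.symm
    exact ⟨a, b, c, h1.symm, h2.symm, h3.symm, fun _ h => hA _ _ h ha,
      fun _ h => absurd h (hb _), fun _ h => absurd h (hc _)⟩
  · obtain ⟨a, h1, h2⟩ := exists_far2 b c (hBC _ _ hb hc)
    exact ⟨a, b, c, h1, h2, hBC _ _ hb hc, fun _ h => absurd h (ha _),
      fun _ h => hB _ _ h hb, fun _ h => hC _ _ h hc⟩
  · obtain ⟨a, h1⟩ := exists_far1 b
    obtain ⟨c, h2, h3⟩ := exists_far2 a b h1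
    exact ⟨a, b, c, h1, h2.symm, h3.symm, fun _ h => absurd h (ha _),
      fun _ h => hB _ _ h hb, fun _ h => absurd h (hc _)⟩
  · obtain ⟨a, h1⟩ := exists_far1 c
    obtain ⟨b, h2, h3⟩ := exists_far2 a c h1
    exact ⟨a, b, c, h2.symm, h1, h3, fun _ h => absurd h (ha _),
      fun _ h => absurd h (hb _), fun _ h => hC _ _ h hc⟩
  · exact ⟨0, 3, 6, by decide, by decide, by decide, fun _ h => absurd h (ha _),
      fun _ h => absurd h (hb _), fun _ h => absurd h (hc _)⟩

/-- lies outside the triangle -/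
def Out (x y z a : V) : Prop := a ≠ x ∧ a ≠ y ∧ a ≠ z

/-- attached to the triangle -/
def At (G : SimpleGraph V) (x y z a : V) : Prop :=
  Out x y z a ∧ (G.Adj x a ∨ G.Adj y a ∨ G.Adj z a)

/-- contraction of the triangle `x y z` to `x`. -/
def contr (G : SimpleGraph V) (x y z : V) : SimpleGraph V where
  Adj a b := (Out x y z a ∧ Out x y z b ∧ G.Adj a b) ∨ (a = x ∧ At G x y z b) ∨
    (b = x ∧ At G x y z a)
  symm := ⟨by
    rintro a b (⟨h1, h2, h3⟩ | h | h)
    · exact Or.inl ⟨h2, h1, h3.symm⟩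
    · exact Or.inr (Or.inr h)
    · exact Or.inr (Or.inl h)⟩
  loopless := ⟨by
    rintro a (⟨h1, h2, h3⟩ | ⟨rfl, h⟩ | ⟨rfl, h⟩)
    · exact G.irrefl h3
    · exact h.1.1 rfl
    · exact h.1.1 rfl⟩

/-- `x y z` is a triangle and no outer vertex is adjacent to two of its vertices. -/
structure Tri (G : SimpleGraph V) (x y z : V) : Prop where
  xy : G.Adj x y
  yz : G.Adj y z
  xz : G.Adj x z
  nxy : ∀ w, Out x y z w → G.Adj x w → G.Adj y w → False
  nyz : ∀ w, Out x y z w → G.Adj y w → G.Adj z w → False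
  nxz : ∀ w, Out x y z w → G.Adj x w → G.Adj z w → False

theorem Tri.rot {G : SimpleGraph V} {x y z : V} (h : Tri G x y z) : Tri G y z x := by
  have o : ∀ w, Out y z x w → Out x y z w := fun w hw => ⟨hw.2.2, hw.1, hw.2.1⟩
  exact ⟨h.yz, h.xz.symm, h.xy.symm, fun w hw => h.nyz w (o w hw),
    fun w hw h1 h2 => h.nxz w (o w hw) h2 h1, fun w hw h1 h2 => h.nxy w (o w hw) h2 h1⟩

theorem Tri.swap {G : SimpleGraph V} {x y z : V} (h : Tri G x y z) : Tri G y x z := by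
  have o : ∀ w, Out y x z w → Out x y z w := fun w hw => ⟨hw.2.1, hw.1, hw.2.2⟩
  exact ⟨h.xy.symm, h.xz, h.yz, fun w hw h1 h2 => h.nxy w (o w hw) h2 h1,
    fun w hw h1 h2 => h.nxz w (o w hw) h1 h2, fun w hw h1 h2 => h.nyz w (o w hw) h1 h2⟩

/-- outer neighbours of triangle vertices are unique. -/
theorem Tri.uniq {G : SimpleGraph V} (h3 : Sub3 G) {x y z : V} (h : Tri G x y z) {p q : V}
    (hp : Out x y z p) (hq : Out x y z q) (h1 : G.Adj x p) (h2 : G.Adj x q) : p = q := by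
  have := h3 x p q y z h1 h2 h.xy h.xz
  have := h.yz.ne
  unfold Out at *
  grind

theorem contr_sub3 {G : SimpleGraph V} (h3 : Sub3 G) {x y z : V} (h : Tri G x y z) :
    Sub3 (contr G x y z) := by
  have u1 := fun p q => h.uniq h3 (p := p) (q := q)
  have u2 := fun p q => h.rot.uniq h3 (p := p) (q := q)
  have u3 := fun p q => h.rot.rot.uniq h3 (p := p) (q := q)
  intro v a b c d ha hb hc hd
  by_cases hv : v = x
  · subst hv
    have key : ∀ a, (contr G v y z).Adj v a → At G v y z a := by
      rintro a (⟨h1, -⟩ | h | h)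
      · exact absurd rfl h1.1
      · exact h.2
      · exact absurd rfl h.2.1.1
    have ha := key _ ha
    have hb := key _ hb
    have hc := key _ hc
    have hd := key _ hd
    unfold At Out at *
    grind
  · have key : ∀ a, (contr G x y z).Adj v a → Out x y z v ∧
        ∃ a', G.Adj v a' ∧ ((a = x ∧ ¬ Out x y z a') ∨ (a = a' ∧ Out x y z a')) := by
      rintro a (⟨h1, h2, h4⟩ | h | h)
      · exact ⟨h1, a, h4, Or.inr ⟨rfl, h2⟩⟩
      · exact absurd h.1 hv
      · obtain ⟨rfl, h4, h5⟩ := h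
        refine ⟨h4, ?_⟩
        rcases h5 with h5 | h5 | h5
        · exact ⟨_, h5.symm, Or.inl ⟨rfl, fun h => h.1 rfl⟩⟩
        · exact ⟨_, h5.symm, Or.inl ⟨rfl, fun h => h.2.1 rfl⟩⟩
        · exact ⟨_, h5.symm, Or.inl ⟨rfl, fun h => h.2.2 rfl⟩⟩
    obtain ⟨-, a', ha, ha'⟩ := key _ ha
    obtain ⟨-, b', hb, hb'⟩ := key _ hb
    obtain ⟨-, c', hc, hc'⟩ := key _ hc
    obtain ⟨-, d', hd, hd'⟩ := key _ hd
    have := h3 v a' b' c' d' ha hb hc hd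
    have aux : ∀ a b a' b', ((a = x ∧ ¬ Out x y z a') ∨ (a = a' ∧ Out x y z a')) →
      ((b = x ∧ ¬ Out x y z b') ∨ (b = b' ∧ Out x y z b')) → a' = b' → a = b := by
      rintro a b a' b' (⟨rfl, h1⟩ | ⟨rfl, h1⟩) (⟨rfl, h2⟩ | ⟨rfl, h2⟩) h4
      · rfl
      · exact absurd (h4 ▸ h2) h1
      · exact absurd (h4 ▸ h1) h2
      · exact h4
    rcases this with h | h | h | h | h | h
    · exact Or.inl (aux _ _ _ _ ha' hb' h)
    · exact Or.inr (Or.inl (aux _ _ _ _ ha' hc' h))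
    · exact Or.inr (Or.inr (Or.inl (aux _ _ _ _ ha' hd' h)))
    · exact Or.inr (Or.inr (Or.inr (Or.inl (aux _ _ _ _ hb' hc' h))))
    · exact Or.inr (Or.inr (Or.inr (Or.inr (Or.inl (aux _ _ _ _ hb' hd' h)))))
    · exact Or.inr (Or.inr (Or.inr (Or.inr (Or.inr (aux _ _ _ _ hc' hd' h)))))

theorem contr_sz [Finite V] {G : SimpleGraph V} {x y z : V} (h : Tri G x y z) :
    sz (contr G x y z) < sz G := by
  classical
  let r : V → V := fun v => if v = y ∨ v = z then x else v
  have hr : ∀ a, Out x y z a → r a = a := by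
    intro a ha
    simp [r, ha.2.1, ha.2.2]
  have hx : r x = x := by simp [r]
  have hy : r y = x := by simp [r]
  have hz : r z = x := by simp [r]
  have hsub : {p : V × V | (contr G x y z).Adj p.1 p.2} ⊆
      Prod.map r r '' ({p : V × V | G.Adj p.1 p.2} \ {(x, y)}) := by
    rintro ⟨a, b⟩ (⟨h1, h2, h4⟩ | ⟨h1, h2, h4⟩ | ⟨h1, h2, h4⟩)
    · refine ⟨(a, b), ⟨h4, fun h => h1.1 ?_⟩, by simp [hr, h1, h2]⟩
      exact (Prod.mk.inj h).1
    · obtain rfl : a = x := h1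
      simp only at h2 h4
      rcases h4 with h4 | h4 | h4
      · exact ⟨(a, b), ⟨h4, fun h => h2.2.1 (Prod.mk.inj h).2⟩, by simp [hr, h2, hx]⟩
      · exact ⟨(y, b), ⟨h4, fun h => h2.2.1 (Prod.mk.inj h).2⟩, by simp [hr, h2, hy]⟩
      · exact ⟨(z, b), ⟨h4, fun h => h2.2.1 (Prod.mk.inj h).2⟩, by simp [hr, h2, hz]⟩
    · obtain rfl : b = x := h1
      simp only at h2 h4
      rcases h4 with h4 | h4 | h4
      · exact ⟨(a, b), ⟨h4.symm, fun h => h2.1 (Prod.mk.inj h).1⟩, by simp [hr, h2, hx]⟩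
      · exact ⟨(a, y), ⟨h4.symm, fun h => h2.1 (Prod.mk.inj h).1⟩, by simp [hr, h2, hy]⟩
      · exact ⟨(a, z), ⟨h4.symm, fun h => h2.1 (Prod.mk.inj h).1⟩, by simp [hr, h2, hz]⟩
  calc sz (contr G x y z) ≤ _ := Set.ncard_le_ncard hsub (Set.toFinite _)
    _ ≤ _ := Set.ncard_image_le (Set.toFinite _)
    _ < sz G := Set.ncard_sdiff_singleton_lt_of_mem (show (x, y) ∈ _ from h.xy) (Set.toFinite _)

theorem contr_col {G : SimpleGraph V} (h3 : Sub3 G) {x y z : V} (h : Tri G x y z)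
    (hc : Col (contr G x y z)) : Col G := by
  classical
  obtain ⟨c, hs, hc⟩ := hc
  have adx : ∀ p, Out x y z p → (G.Adj x p ∨ G.Adj y p ∨ G.Adj z p) →
      (contr G x y z).Adj x p := fun p hp h => Or.inr (Or.inl ⟨rfl, hp, h⟩)
  have ne1 := h.xy.ne
  have ne2 := h.yz.ne
  have ne3 := h.xz.ne
  obtain ⟨γx, γy, γz, f1, f2, f3, gx, gy, gz⟩ := three_far
    (A := fun k => ∃ p, Out x y z p ∧ G.Adj x p ∧ k = c x p)
    (B := fun k => ∃ p, Out x y z p ∧ G.Adj y p ∧ k = c x p)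
    (C := fun k => ∃ p, Out x y z p ∧ G.Adj z p ∧ k = c x p)
    (by
      rintro _ _ ⟨p, hp, hp1, rfl⟩ ⟨q, hq, hq1, rfl⟩
      rw [h.uniq h3 hp hq hp1 hq1])
    (by
      rintro _ _ ⟨p, hp, hp1, rfl⟩ ⟨q, hq, hq1, rfl⟩
      rw [h.rot.uniq h3 ⟨hp.2.1, hp.2.2, hp.1⟩ ⟨hq.2.1, hq.2.2, hq.1⟩ hp1 hq1])
    (by
      rintro _ _ ⟨p, hp, hp1, rfl⟩ ⟨q, hq, hq1, rfl⟩
      rw [h.rot.rot.uniq h3 ⟨hp.2.2, hp.1, hp.2.1⟩ ⟨hq.2.2, hq.1, hq.2.1⟩ hp1 hq1])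
    (by
      rintro _ _ ⟨p, hp, hp1, rfl⟩ ⟨q, hq, hq1, rfl⟩
      refine hc x p q (adx p hp (Or.inl hp1)) (adx q hq (Or.inr (Or.inl hq1))) ?_
      rintro rfl; exact h.nxy p hp hp1 hq1)
    (by
      rintro _ _ ⟨p, hp, hp1, rfl⟩ ⟨q, hq, hq1, rfl⟩
      refine hc x p q (adx p hp (Or.inl hp1)) (adx q hq (Or.inr (Or.inr hq1))) ?_
      rintro rfl; exact h.nxz p hp hp1 hq1)
    (by
      rintro _ _ ⟨p, hp, hp1, rfl⟩ ⟨q, hq, hq1, rfl⟩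
      refine hc x p q (adx p hp (Or.inr (Or.inl hp1))) (adx q hq (Or.inr (Or.inr hq1))) ?_
      rintro rfl; exact h.nyz p hp hp1 hq1)
  let r : V → V := fun v => if v = y ∨ v = z then x else v
  have hr : ∀ a, Out x y z a → r a = a := by
    intro a ha
    simp [r, ha.2.1, ha.2.2]
  have hx : r x = x := by simp [r]
  have hy : r y = x := by simp [r]
  have hz : r z = x := by simp [r]
  let C : V → V → ZMod 11 := fun u v =>
    if (u = x ∧ v = y) ∨ (u = y ∧ v = x) then γz else
    if (u = y ∧ v = z) ∨ (u = z ∧ v = y) then γx else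
    if (u = x ∧ v = z) ∨ (u = z ∧ v = x) then γy else c (r u) (r v)
  have Cxy : C x y = γz := by simp [C]
  have Cyx : C y x = γz := by simp [C]
  have Cyz : C y z = γx := by simp [C, ne1, ne2, ne3, ne1.symm, ne2.symm, ne3.symm]
  have Czy : C z y = γx := by simp [C, ne1, ne2, ne3, ne1.symm, ne2.symm, ne3.symm]
  have Cxz : C x z = γy := by simp [C, ne1, ne2, ne3, ne1.symm, ne2.symm, ne3.symm]
  have Czx : C z x = γy := by simp [C, ne1, ne2, ne3, ne1.symm, ne2.symm, ne3.symm]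
  have Co : ∀ a b, (Out x y z a ∨ Out x y z b) → C a b = c (r a) (r b) := by
    intro a b hab
    unfold Out at hab
    simp only [C]
    rw [if_neg, if_neg, if_neg] <;> grind
  have cases4 : ∀ v, v = x ∨ v = y ∨ v = z ∨ Out x y z v := by
    intro v; unfold Out; tauto
  have G' : ∀ a b, G.Adj a b → (Out x y z a ∨ Out x y z b) → (contr G x y z).Adj (r a) (r b) := by
    have half : ∀ a b, G.Adj a b → Out x y z b → (contr G x y z).Adj (r a) (r b) := by
      intro a b hab hb
      rcases cases4 a with rfl | rfl | rfl | ha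
      · rw [hx, hr b hb]; exact adx b hb (Or.inl hab)
      · rw [hy, hr b hb]; exact adx b hb (Or.inr (Or.inl hab))
      · rw [hz, hr b hb]; exact adx b hb (Or.inr (Or.inr hab))
      · rw [hr a ha, hr b hb]; exact Or.inl ⟨ha, hb, hab⟩
    intro a b hab ho
    rcases ho with ho | ho
    · exact (half b a hab.symm ho).symm
    · exact half a b hab ho
  refine ⟨C, ?_, ?_⟩
  · intro u v huv
    by_cases ho : Out x y z u ∨ Out x y z v
    · rw [Co u v ho, Co v u ho.symm]
      exact hs _ _ (G' u v huv ho)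
    · push Not at ho
      have hi := huv.ne
      rcases cases4 u with rfl | rfl | rfl | hu
      · rcases cases4 v with rfl | rfl | rfl | hv
        · exact absurd rfl hi
        · rw [Cxy, Cyx]
        · rw [Cxz, Czx]
        · exact absurd hv ho.2
      · rcases cases4 v with rfl | rfl | rfl | hv
        · rw [Cxy, Cyx]
        · exact absurd rfl hi
        · rw [Cyz, Czy]
        · exact absurd hv ho.2
      · rcases cases4 v with rfl | rfl | rfl | hv
        · rw [Cxz, Czx]
        · rw [Cyz, Czy]
        · exact absurd rfl hi
        · exact absurd hv ho.2
      · exact absurd hu ho.1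
  · intro v a b ha hb hab
    have hva := ha.ne
    have hvb := hb.ne
    rcases cases4 v with rfl | rfl | rfl | hv
    · have k : ∀ a, Out v y z a → G.Adj v a → C v a = γx := fun a hao ha => by
        rw [Co v a (Or.inr hao), hx, hr a hao]; exact gx _ ⟨a, hao, ha, rfl⟩
      rcases cases4 a with rfl | rfl | rfl | ha' <;> rcases cases4 b with rfl | rfl | rfl | hb'
      all_goals first | exact absurd rfl hva | exact absurd rfl hvb | exact absurd rfl hab | skip
      · rw [Cxy, Cxz]; exact f3.symm
      · rw [Cxy, k b hb' hb]; exact f2.symm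
      · rw [Cxy, Cxz]; exact f3
      · rw [Cxz, k b hb' hb]; exact f1.symm
      · rw [Cxy, k a ha' ha]; exact f2
      · rw [Cxz, k a ha' ha]; exact f1
      · exact absurd (h.uniq h3 ha' hb' ha hb) hab
    · have k : ∀ a, Out x v z a → G.Adj v a → C v a = γy := fun a hao ha => by
        rw [Co v a (Or.inr hao), hy, hr a hao]; exact gy _ ⟨a, hao, ha, rfl⟩
      rcases cases4 a with rfl | rfl | rfl | ha' <;> rcases cases4 b with rfl | rfl | rfl | hb'
      all_goals first | exact absurd rfl hva | exact absurd rfl hvb | exact absurd rfl hab | skip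
      · rw [Cyx, Cyz]; exact f2.symm
      · rw [Cyx, k b hb' hb]; exact f3.symm
      · rw [Cyx, Cyz]; exact f2
      · rw [Cyz, k b hb' hb]; exact f1
      · rw [Cyx, k a ha' ha]; exact f3
      · rw [Cyz, k a ha' ha]; exact f1.symm
      · exact absurd (h.rot.uniq h3 ⟨ha'.2.1, ha'.2.2, ha'.1⟩ ⟨hb'.2.1, hb'.2.2, hb'.1⟩ ha hb) hab
    · have k : ∀ a, Out x y v a → G.Adj v a → C v a = γz := fun a hao ha => by
        rw [Co v a (Or.inr hao), hz, hr a hao]; exact gz _ ⟨a, hao, ha, rfl⟩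
      rcases cases4 a with rfl | rfl | rfl | ha' <;> rcases cases4 b with rfl | rfl | rfl | hb'
      all_goals first | exact absurd rfl hva | exact absurd rfl hvb | exact absurd rfl hab | skip
      · rw [Czx, Czy]; exact f1.symm
      · rw [Czx, k b hb' hb]; exact f3
      · rw [Czx, Czy]; exact f1
      · rw [Czy, k b hb' hb]; exact f2
      · rw [Czx, k a ha' ha]; exact f3.symm
      · rw [Czy, k a ha' ha]; exact f2.symm
      · exact absurd (h.rot.rot.uniq h3 ⟨ha'.2.2, ha'.1, ha'.2.1⟩ ⟨hb'.2.2, hb'.1, hb'.2.1⟩ ha hb)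
          hab
    · rw [Co v a (Or.inl hv), Co v b (Or.inl hv)]
      refine hc _ _ _ (G' v a ha (Or.inl hv)) (G' v b hb (Or.inl hv)) ?_
      rcases cases4 a with rfl | rfl | rfl | ha' <;> rcases cases4 b with rfl | rfl | rfl | hb'
      all_goals first | exact absurd rfl hab | skip
      · exact absurd hb.symm (fun hb => h.nxy v hv ha.symm hb)
      · exact absurd hb.symm (fun hb => h.nxz v hv ha.symm hb)
      · rw [hx, hr b hb']; exact hb'.1.symm
      · exact absurd hb.symm (fun hb => h.nxy v hv hb ha.symm)
      · exact absurd hb.symm (fun hb => h.nyz v hv ha.symm hb)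
      · rw [hy, hr b hb']; exact hb'.1.symm
      · exact absurd hb.symm (fun hb => h.nxz v hv hb ha.symm)
      · exact absurd hb.symm (fun hb => h.nyz v hv hb ha.symm)
      · rw [hz, hr b hb']; exact hb'.1.symm
      · rw [hx, hr a ha']; exact ha'.1
      · rw [hy, hr a ha']; exact ha'.1
      · rw [hz, hr a ha']; exact ha'.1
      · rw [hr a ha', hr b hb']; exact hab

end Gr
end CCI

namespace CCI
open SimpleGraph

section Gr
variable {V : Type*}

theorem Out.rot {x y z a : V} (h : Out x y z a) : Out y z x a := ⟨h.2.1, h.2.2, h.1⟩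
theorem Out.swap {x y z a : V} (h : Out x y z a) : Out y x z a := ⟨h.2.1, h.1, h.2.2⟩

theorem att2 {G : SimpleGraph V} (h3 : Sub3 G) {x y z p q : V} (h : Tri G x y z)
    (hp : At G x y z p) (hq : At G x y z q) (hpq : p ≠ q) :
    ∃ x' y' z', Tri G x' y' z' ∧ (∀ w, Out x y z w → Out x' y' z' w) ∧
      (∀ w, At G x y z w → At G x' y' z' w) ∧ G.Adj x' p ∧ G.Adj y' q := by
  obtain ⟨po, hp⟩ := hp
  obtain ⟨qo, hq⟩ := hq
  have u1 := fun h1 h2 => hpq (h.uniq h3 po qo h1 h2)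
  have u2 := fun h1 h2 => hpq (h.rot.uniq h3 po.rot qo.rot h1 h2)
  have u3 := fun h1 h2 => hpq (h.rot.rot.uniq h3 po.rot.rot qo.rot.rot h1 h2)
  rcases hp with hp | hp | hp <;> rcases hq with hq | hq | hq
  · exact (u1 hp hq).elim
  · exact ⟨x, y, z, h, fun w hw => hw, fun w hw => hw, hp, hq⟩
  · refine ⟨x, z, y, h.rot.rot.swap, fun w hw => hw.rot.rot.swap, fun w hw => ?_, hp, hq⟩
    obtain ⟨hw, h1⟩ := hw
    exact ⟨hw.rot.rot.swap, by tauto⟩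
  · refine ⟨y, x, z, h.swap, fun w hw => hw.swap, fun w hw => ?_, hp, hq⟩
    obtain ⟨hw, h1⟩ := hw
    exact ⟨hw.swap, by tauto⟩
  · exact (u2 hp hq).elim
  · refine ⟨y, z, x, h.rot, fun w hw => hw.rot, fun w hw => ?_, hp, hq⟩
    obtain ⟨hw, h1⟩ := hw
    exact ⟨hw.rot, by tauto⟩
  · refine ⟨z, x, y, h.rot.rot, fun w hw => hw.rot.rot, fun w hw => ?_, hp, hq⟩
    obtain ⟨hw, h1⟩ := hw
    exact ⟨hw.rot.rot, by tauto⟩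
  · refine ⟨z, y, x, h.rot.swap, fun w hw => hw.rot.swap, fun w hw => ?_, hp, hq⟩
    obtain ⟨hw, h1⟩ := hw
    exact ⟨hw.rot.swap, by tauto⟩
  · exact (u3 hp hq).elim

theorem att3 {G : SimpleGraph V} (h3 : Sub3 G) {x y z p q r : V} (h : Tri G x y z)
    (hp : At G x y z p) (hq : At G x y z q) (hr : At G x y z r) (hpq : p ≠ q) (hpr : p ≠ r)
    (hqr : q ≠ r) :
    ∃ x' y' z', Tri G x' y' z' ∧ (∀ w, Out x y z w → Out x' y' z' w) ∧
      G.Adj x' p ∧ G.Adj y' q ∧ G.Adj z' r := by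
  obtain ⟨x', y', z', h', ho, ha, h1, h2⟩ := att2 h3 h hp hq hpq
  refine ⟨x', y', z', h', ho, h1, h2, ?_⟩
  obtain ⟨hro, hr'⟩ := ha r hr
  rcases hr' with hr' | hr' | hr'
  · exact absurd (h'.uniq h3 (ho p hp.1) hro h1 hr') hpr
  · exact absurd (h'.rot.uniq h3 (ho q hq.1).rot hro.rot h2 hr') hqr
  · exact hr'

theorem contr_x {G : SimpleGraph V} {x y z a : V} (h : (contr G x y z).Adj x a) :
    At G x y z a := by
  rcases h with ⟨h1, -⟩ | h | h
  · exact absurd rfl h1.1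
  · exact h.2
  · exact absurd rfl h.2.1.1

theorem contr_out {G : SimpleGraph V} {x y z a b : V} (h : (contr G x y z).Adj a b) (ha : a ≠ x) :
    Out x y z a := by
  rcases h with ⟨h1, -⟩ | h | h
  · exact h1
  · exact absurd h.1 ha
  · exact h.2.1

theorem contr_adj {G : SimpleGraph V} {x y z a b : V} (h : (contr G x y z).Adj a b) (ha : a ≠ x)
    (hb : b ≠ x) : G.Adj a b := by
  rcases h with ⟨-, -, h⟩ | h | h
  · exact h
  · exact absurd h.1 ha
  · exact absurd h.1 hb

theorem contr_H2 [Finite V] {G : SimpleGraph V} (h3 : Sub3 G) (hh : NoH2 G) (hcut : NoCut G)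
    (IH : ∀ G' : SimpleGraph V, sz G' < sz G → Sub3 G' → NoH2 G' → Col G') {x y z : V}
    (h : Tri G x y z) (hn : ¬ NoH2 (contr G x y z)) : Col G := by
  unfold NoH2 at hn
  push Not at hn
  obtain ⟨a, b, c, d, s, nab, nsc, nsd, ac, ad, bc, bd, cd, as, bs, -⟩ := hn
  -- the vertex `x` is an end `a`
  have caseA : ∀ b c d s, s ≠ c → s ≠ d → x ≠ b → (contr G x y z).Adj x c →
      (contr G x y z).Adj x d → (contr G x y z).Adj b c → (contr G x y z).Adj b d →
      (contr G x y z).Adj c d → (contr G x y z).Adj x s → (contr G x y z).Adj b s → Col G := by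
    intro b c d s nsc nsd nb ac ad bc bd cd as bs
    obtain ⟨x', y', z', h', ho, e1, e2, e3⟩ := att3 h3 h (contr_x ac) (contr_x ad) (contr_x as)
      cd.ne nsc.symm nsd.symm
    have ob := ho b (contr_out bc nb.symm)
    have oc := ho c (contr_x ac).1
    have od := ho d (contr_x ad).1
    have os := ho s (contr_x as).1
    have n1 := h'.xy.ne
    have n2 := h'.yz.ne
    have n3 := h'.xz.ne
    have m1 := bc.ne
    have m2 := bd.ne
    have m3 := bs.ne
    have m4 := cd.ne
    refine sevenA h3 hh hcut IH b c d s x' y' z' ?_ e1.symm e2.symm e3.symm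
      (contr_adj bc nb.symm ac.ne.symm) (contr_adj bd nb.symm ad.ne.symm)
      (contr_adj bs nb.symm as.ne.symm) (contr_adj cd ac.ne.symm ad.ne.symm) h'.xy h'.yz h'.xz
    unfold Out at *
    simp only [List.nodup_cons, List.mem_cons, List.not_mem_nil, not_or, List.nodup_nil]
    grind
  have caseC : ∀ a b d s, s ≠ x → s ≠ d → a ≠ b → (contr G x y z).Adj a x →
      (contr G x y z).Adj a d → (contr G x y z).Adj b x → (contr G x y z).Adj b d →
      (contr G x y z).Adj x d → (contr G x y z).Adj a s → (contr G x y z).Adj b s → Col G := by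
    intro a b d s nsc nsd nab ac ad bc bd cd as bs
    obtain ⟨x', y', z', h', ho, e1, e2, e3⟩ := att3 h3 h (contr_x ac.symm) (contr_x bc.symm)
      (contr_x cd) nab ad.ne bd.ne
    have ob := ho b (contr_x bc.symm).1
    have oa := ho a (contr_x ac.symm).1
    have od := ho d (contr_x cd).1
    have os := ho s (contr_out as.symm nsc)
    have n1 := h'.xy.ne
    have n2 := h'.yz.ne
    have n3 := h'.xz.ne
    have m1 := ad.ne
    have m2 := bd.ne
    have m3 := as.ne
    have m4 := bs.ne
    refine sevenC h3 hh hcut IH a b d s x' y' z' ?_ e1.symm e2.symm e3.symm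
      (contr_adj ad ac.ne cd.ne.symm) (contr_adj bd bc.ne cd.ne.symm)
      (contr_adj as ac.ne nsc) (contr_adj bs bc.ne nsc) h'.xy h'.yz h'.xz
    unfold Out at *
    simp only [List.nodup_cons, List.mem_cons, List.not_mem_nil, not_or, List.nodup_nil]
    grind
  by_cases ha : a = x
  · subst ha
    exact caseA b c d s nsc nsd nab ac ad bc bd cd as bs
  by_cases hb : b = x
  · subst hb
    exact caseA a c d s nsc nsd nab.symm bc bd ac ad cd bs as
  by_cases hc : c = x
  · subst hc
    exact caseC a b d s nsc nsd nab ac ad bc bd cd as bs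
  by_cases hd : d = x
  · subst hd
    exact caseC a b c s nsd nsc nab ad ac bd bc cd.symm as bs
  by_cases hs : s = x
  · subst hs
    obtain ⟨x', y', z', h', ho, -, e1, e2⟩ := att2 h3 h (contr_x as.symm) (contr_x bs.symm) nab
    have ob := ho b (contr_x bs.symm).1
    have oa := ho a (contr_x as.symm).1
    have od := ho d (contr_out ad.symm hd)
    have oc := ho c (contr_out ac.symm hc)
    have n1 := h'.xy.ne
    have n2 := h'.yz.ne
    have n3 := h'.xz.ne
    have m1 := ad.ne
    have m2 := bd.ne
    have m3 := ac.ne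
    have m4 := bc.ne
    have m5 := cd.ne
    refine sevenS h3 hh hcut IH a b c d x' y' z' ?_ (contr_adj ac ha hc) (contr_adj ad ha hd)
      (contr_adj bc hb hc) (contr_adj bd hb hd) (contr_adj cd hc hd) e1.symm e2.symm
      h'.xy h'.yz h'.xz
    unfold Out at *
    simp only [List.nodup_cons, List.mem_cons, List.not_mem_nil, not_or, List.nodup_nil]
    grind
  · exact (hh a b c d s nab nsc nsd (contr_adj ac ha hc) (contr_adj ad ha hd)
      (contr_adj bc hb hc) (contr_adj bd hb hd) (contr_adj cd hc hd) (contr_adj as ha hs)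
      (contr_adj bs hb hs)).elim

/-- a triangle of the first kind gives a colouring. -/
theorem tri_step [Finite V] {G : SimpleGraph V} (h3 : Sub3 G) (hh : NoH2 G) (hcut : NoCut G)
    (IH : ∀ G' : SimpleGraph V, sz G' < sz G → Sub3 G' → NoH2 G' → Col G') {x y z : V}
    (h : Tri G x y z) : Col G := by
  by_cases hn : NoH2 (contr G x y z)
  · exact contr_col h3 h (IH _ (contr_sz h) (contr_sub3 h3 h) hn)
  · exact contr_H2 h3 hh hcut IH h hn

end Gr
end CCI

namespace CCI
open SimpleGraph

section Gr
variable {V : Type*}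

/-- maximum degree at most two, elementary form. -/
def Sub2 (H : SimpleGraph V) : Prop :=
  ∀ v a b c, H.Adj v a → H.Adj v b → H.Adj v c → a = b ∨ a = c ∨ b = c

/-- decomposition into odd cycles, described by `σ`, and a two edge coloured part. -/
structure Dec (H : SimpleGraph V) (σ : Equiv.Perm V) (κ : V → V → Bool) : Prop where
  nb : ∀ v, σ v ≠ v → ∀ w, H.Adj v w ↔ w = σ v ∨ w = σ⁻¹ v
  odd : ∀ v, σ v ≠ v → Odd (Function.minimalPeriod σ v)
  sym : ∀ u v, H.Adj u v → σ u = u → κ u v = κ v u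
  prop : ∀ v x y, σ v = v → H.Adj v x → H.Adj v y → x ≠ y → κ v x ≠ κ v y

theorem Dec.three {H : SimpleGraph V} {σ : Equiv.Perm V} {κ : V → V → Bool} (D : Dec H σ κ)
    {v : V} (hv : σ v ≠ v) : σ v ≠ σ⁻¹ v := by
  intro h
  have h2 : σ (σ v) = v := by rw [h]; exact σ.apply_symm_apply v
  have h3 : Function.minimalPeriod σ v ∣ 2 := Function.IsPeriodicPt.minimalPeriod_dvd h2
  have ho := D.odd v hv
  have : Function.minimalPeriod σ v = 1 := by
    rcases (Nat.dvd_prime Nat.prime_two).1 h3 with h | h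
    · exact h
    · rw [h] at ho; exact absurd ho (by decide)
  exact hv (Function.minimalPeriod_eq_one_iff_isFixedPt.1 this)

theorem dec_bridge {H : SimpleGraph V} (h2 : Sub2 H) {u v : V} (huv : H.Adj u v)
    (hb : H.IsBridge s(u, v))
    (IH : ∃ σ κ, Dec (H.deleteEdges {s(u, v)}) σ κ) : ∃ σ κ, Dec H σ κ := by
  classical
  obtain ⟨σ, κ, D⟩ := IH
  rw [isBridge_iff] at hb
  set H' := H.deleteEdges {s(u, v)} with hH'
  have ha : ∀ x y, H'.Adj x y ↔ H.Adj x y ∧ ¬ (x = u ∧ y = v) ∧ ¬ (x = v ∧ y = u) := by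
    intro x y
    rw [hH', deleteEdges_adj]
    simp
  have hne := huv.ne
  have uu : ∀ x y, H'.Adj u x → H'.Adj u y → x = y := by
    intro x y hx hy
    rw [ha] at hx hy
    have := h2 u x y v hx.1 hy.1 huv
    grind
  have uv : ∀ x y, H'.Adj v x → H'.Adj v y → x = y := by
    intro x y hx hy
    rw [ha] at hx hy
    have := h2 v x y u hx.1 hy.1 huv.symm
    grind
  have fix : ∀ w, (∀ x y, H'.Adj w x → H'.Adj w y → x = y) → σ w = w := by
    intro w hw
    by_contra h
    exact D.three h (hw _ _ ((D.nb w h _).2 (Or.inl rfl)) ((D.nb w h _).2 (Or.inr rfl)))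
  have fu := fix u uu
  have fv := fix v uv
  -- colours at the two ends
  obtain ⟨p, hp⟩ : ∃ p, ∀ x, H'.Adj u x → κ u x = p := by
    by_cases h : ∃ x, H'.Adj u x
    · obtain ⟨x, hx⟩ := h
      exact ⟨κ u x, fun y hy => by rw [uu x y hx hy]⟩
    · push Not at h
      exact ⟨true, fun x hx => absurd hx (h x)⟩
  obtain ⟨q, hq⟩ : ∃ q, ∀ x, H'.Adj v x → κ v x = q := by
    by_cases h : ∃ x, H'.Adj v x
    · obtain ⟨x, hx⟩ := h
      exact ⟨κ v x, fun y hy => by rw [uv x y hx hy]⟩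
    · push Not at h
      exact ⟨true, fun x hx => absurd hx (h x)⟩
  let C : V → V → Bool := fun x y =>
    if (x = u ∧ y = v) ∨ (x = v ∧ y = u) then !q else
    if H'.Reachable u x then (κ x y ^^ (p ^^ q)) else κ x y
  have Ce : ∀ x y, (x = u ∧ y = v) ∨ (x = v ∧ y = u) → C x y = !q := fun x y h => by simp [C, h]
  have Cn : ∀ x y, H'.Adj x y → C x y = if H'.Reachable u x then (κ x y ^^ (p ^^ q)) else κ x y := by
    intro x y h
    rw [ha] at h
    simp only [C]
    rw [if_neg]
    tauto
  have cs : ∀ x y, H.Adj x y → H'.Adj x y ∨ ((x = u ∧ y = v) ∨ (x = v ∧ y = u)) := by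
    intro x y h; rw [ha]; tauto
  have atu : ∀ x, H'.Adj u x → C u x = q := by
    intro x hx
    rw [Cn u x hx, if_pos (Reachable.refl u), hp x hx]
    cases p <;> cases q <;> rfl
  have atv : ∀ x, H'.Adj v x → C v x = q := by
    intro x hx
    rw [Cn v x hx, if_neg hb, hq x hx]
  refine ⟨σ, C, ⟨?_, D.odd, ?_, ?_⟩⟩
  · intro w hw x
    rw [← D.nb w hw x, ha]
    have : w ≠ u := fun h => hw (h ▸ fu)
    have : w ≠ v := fun h => hw (h ▸ fv)
    tauto
  · intro x y hxy hx
    rcases cs x y hxy with h | h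
    · have hr : H'.Reachable u x ↔ H'.Reachable u y :=
        ⟨fun h' => h'.trans h.reachable, fun h' => h'.trans h.symm.reachable⟩
      rw [Cn x y h, Cn y x h.symm, D.sym x y h hx]
      simp only [hr]
    · rw [Ce x y h, Ce y x (by tauto)]
  · intro w x y hw hx hy hxy
    rcases cs w x hx with h | h <;> rcases cs w y hy with h' | h'
    · rw [Cn w x h, Cn w y h']
      have := D.prop w x y hw h h' hxy
      split_ifs
      · intro h; apply this; revert h
        cases κ w x <;> cases κ w y <;> cases p <;> cases q <;> simp
      · exact this
    · rw [Ce w y h']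
      have : C w x = q := by
        rcases h' with ⟨rfl, rfl⟩ | ⟨rfl, rfl⟩
        · exact atu x h
        · exact atv x h
      rw [this]; cases q <;> simp
    · rw [Ce w x h]
      have : C w y = q := by
        rcases h with ⟨rfl, rfl⟩ | ⟨rfl, rfl⟩
        · exact atu y h'
        · exact atv y h'
      rw [this]; cases q <;> simp
    · grind

/-- delete all edges meeting a set. -/
def offSet (H : SimpleGraph V) (R : Set V) : SimpleGraph V where
  Adj x y := H.Adj x y ∧ x ∉ R ∧ y ∉ R
  symm := ⟨fun _ _ h => ⟨h.1.symm, h.2.2, h.2.1⟩⟩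
  loopless := ⟨fun _ h => H.irrefl h.1⟩

theorem dec_cycle {H : SimpleGraph V} (h2 : Sub2 H) (k : ℕ) (φ : ZMod (k + 3) → V)
    (hφ : Function.Injective φ) (hadj : ∀ i, H.Adj (φ i) (φ (i + 1)))
    (IH : ∃ σ κ, Dec (offSet H (Set.range φ)) σ κ) : ∃ σ κ, Dec H σ κ := by
  classical
  obtain ⟨σ, κ, D⟩ := IH
  have two : (2 : ZMod (k + 3)) ≠ 0 := by
    intro h
    have : ((2 : ℕ) : ZMod (k + 3)) = 0 := by exact_mod_cast h
    rw [ZMod.natCast_eq_zero_iff] at this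
    have := Nat.le_of_dvd (by norm_num) this
    omega
  have pm : ∀ i : ZMod (k + 3), i + 1 ≠ i - 1 := by
    intro i h
    apply two
    linear_combination h
  have hadj' : ∀ i, H.Adj (φ i) (φ (i - 1)) := by
    intro i
    have := hadj (i - 1)
    rw [sub_add_cancel] at this
    exact this.symm
  have nbr : ∀ i w, H.Adj (φ i) w ↔ w = φ (i + 1) ∨ w = φ (i - 1) := by
    intro i w
    constructor
    · intro hw
      rcases h2 (φ i) w _ _ hw (hadj i) (hadj' i) with h | h | h
      · exact Or.inl h
      · exact Or.inr h
      · exact absurd (hφ h) (pm i)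
    · rintro (rfl | rfl)
      · exact hadj i
      · exact hadj' i
  have fixR : ∀ i, σ (φ i) = φ i := by
    intro i
    by_contra h
    exact ((D.nb _ h _).2 (Or.inl rfl)).2.1 ⟨i, rfl⟩
  have out : ∀ v, v ∉ Set.range φ → ∀ w, H.Adj v w ↔ (offSet H (Set.range φ)).Adj v w := by
    intro v hv w
    refine ⟨fun h => ⟨h, hv, ?_⟩, fun h => h.1⟩
    rintro ⟨i, rfl⟩
    rcases (nbr i v).1 h.symm with rfl | rfl
    · exact hv ⟨_, rfl⟩
    · exact hv ⟨_, rfl⟩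
  have key : ∀ x, (∃ i, x = φ i) ∨ x ∉ Set.range φ := by
    intro x
    by_cases h : x ∈ Set.range φ
    · left; obtain ⟨i, hi⟩ := h; exact ⟨i, hi.symm⟩
    · right; exact h
  by_cases ho : Odd (k + 3)
  · -- odd cycle
    let τ : Equiv.Perm V := (Equiv.addRight (1 : ZMod (k + 3)) : Equiv.Perm _).viaEmbedding ⟨φ, hφ⟩
    have τ1 : ∀ i, τ (φ i) = φ (i + 1) := fun i =>
      Equiv.Perm.viaEmbedding_apply (Equiv.addRight (1 : ZMod (k + 3))) ⟨φ, hφ⟩ i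
    have τ2 : ∀ v, v ∉ Set.range φ → τ v = v := fun v hv =>
      Equiv.Perm.viaEmbedding_apply_of_notMem (Equiv.addRight (1 : ZMod (k + 3))) ⟨φ, hφ⟩ v hv
    let ρ := σ * τ
    have ρ1 : ∀ i, ρ (φ i) = φ (i + 1) := fun i => by
      show σ (τ (φ i)) = _
      rw [τ1, fixR]
    have ρ2 : ∀ v, v ∉ Set.range φ → ρ v = σ v := fun v hv => by
      show σ (τ v) = _
      rw [τ2 v hv]
    have σout : ∀ v, v ∉ Set.range φ → σ v ∉ Set.range φ := by
      rintro v hv ⟨i, hi⟩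
      rw [← fixR i] at hi
      exact hv ⟨i, σ.injective hi⟩
    have ρi1 : ∀ i, ρ⁻¹ (φ i) = φ (i - 1) := by
      intro i
      rw [Equiv.Perm.inv_eq_iff_eq, ρ1, sub_add_cancel]
    have ρi2 : ∀ v, v ∉ Set.range φ → ρ⁻¹ v = σ⁻¹ v := by
      intro v hv
      rw [Equiv.Perm.inv_eq_iff_eq, ρ2]
      · exact (σ.apply_symm_apply v).symm
      · rintro ⟨i, hi⟩
        apply hv
        refine ⟨i, ?_⟩
        rw [← fixR i, hi]; exact σ.apply_symm_apply v
    refine ⟨ρ, κ, ⟨?_, ?_, ?_, ?_⟩⟩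
    · intro v hv w
      rcases key v with ⟨i, rfl⟩ | hv'
      · rw [ρ1, ρi1]; exact nbr i w
      · rw [ρ2 v hv', ρi2 v hv', out v hv']
        rw [ρ2 v hv'] at hv
        exact D.nb v hv w
    · intro v hv
      rcases key v with ⟨i, rfl⟩ | hv'
      · have it : ∀ n : ℕ, (⇑ρ)^[n] (φ i) = φ (i + n) := by
          intro n
          induction n with
          | zero => simp
          | succ n ih => rw [Function.iterate_succ_apply', ih, ρ1]; push_cast; rw [add_assoc]
        have : Function.minimalPeriod ρ (φ i) = k + 3 := by
          have hiff : ∀ n, Function.minimalPeriod ρ (φ i) ∣ n ↔ k + 3 ∣ n := by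
            intro n
            rw [← Function.isPeriodicPt_iff_minimalPeriod_dvd, Function.IsPeriodicPt,
              Function.IsFixedPt, it, hφ.eq_iff, ← ZMod.natCast_eq_zero_iff, add_eq_left]
          exact Nat.dvd_antisymm ((hiff _).2 dvd_rfl) ((hiff _).1 dvd_rfl)
        rw [this]; exact ho
      · have it : ∀ n : ℕ, (⇑ρ)^[n] v = (⇑σ)^[n] v ∧ (⇑σ)^[n] v ∉ Set.range φ := by
          intro n
          induction n with
          | zero => exact ⟨rfl, hv'⟩
          | succ n ih =>
            rw [Function.iterate_succ_apply', Function.iterate_succ_apply', ih.1]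
            exact ⟨ρ2 _ ih.2, σout _ ih.2⟩
        have : Function.minimalPeriod ρ v = Function.minimalPeriod σ v := by
          rw [Function.minimalPeriod_eq_minimalPeriod_iff]
          intro n
          rw [Function.IsPeriodicPt, Function.IsFixedPt, (it n).1]
          rfl
        rw [this]
        rw [ρ2 v hv'] at hv
        exact D.odd v hv
    · intro v w hvw hv
      rcases key v with ⟨i, rfl⟩ | hv'
      · rw [ρ1] at hv
        exact absurd (hadj i) (by rw [hv]; exact H.irrefl)
      · rw [ρ2 v hv'] at hv
        exact D.sym v w ((out v hv' w).1 hvw) hv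
    · intro v x y hv hx hy hxy
      rcases key v with ⟨i, rfl⟩ | hv'
      · rw [ρ1] at hv
        exact absurd (hadj i) (by rw [hv]; exact H.irrefl)
      · rw [ρ2 v hv'] at hv
        exact D.prop v x y hv ((out v hv' x).1 hx) ((out v hv' y).1 hy) hxy
  · -- even cycle
    have h2d : 2 ∣ k + 3 := even_iff_two_dvd.1 (Nat.not_odd_iff_even.1 ho)
    let par : ZMod (k + 3) → Bool := fun i => decide (ZMod.castHom h2d (ZMod 2) i = 0)
    have hpar : ∀ i, par (i + 1) = !par i := by
      intro i
      simp only [par, map_add, map_one]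
      generalize ZMod.castHom h2d (ZMod 2) i = a
      revert a; decide
    let g := Function.invFun φ
    have hg : ∀ i, g (φ i) = i := Function.leftInverse_invFun hφ
    let C : V → V → Bool := fun x y =>
      if x ∈ Set.range φ then (if g y = g x + 1 then par (g x) else par (g y)) else κ x y
    have C1 : ∀ i, C (φ i) (φ (i + 1)) = par i := fun i => by simp [C, hg]
    have C2 : ∀ i, C (φ i) (φ (i - 1)) = par (i - 1) := fun i => by
      simp [C, hg, (pm i).symm]
    have C3 : ∀ x y, x ∉ Set.range φ → C x y = κ x y := fun x y hx => by
      simp only [C]; rw [if_neg hx]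
    have pne : ∀ i, par i ≠ par (i - 1) := by
      intro i
      have := hpar (i - 1)
      rw [sub_add_cancel] at this
      rw [this]; cases par (i - 1) <;> simp
    refine ⟨σ, C, ⟨?_, D.odd, ?_, ?_⟩⟩
    · intro v hv w
      rcases key v with ⟨i, rfl⟩ | hv'
      · exact absurd (fixR i) hv
      · rw [out v hv']; exact D.nb v hv w
    · intro v w hvw hv
      rcases key v with ⟨i, rfl⟩ | hv'
      · rcases (nbr i w).1 hvw with rfl | rfl
        · rw [C1]
          have := C2 (i + 1)
          rw [add_sub_cancel_right] at this
          exact this.symm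
        · rw [C2]
          have := C1 (i - 1)
          rw [sub_add_cancel] at this
          exact this.symm
      · have h := (out v hv' w).1 hvw
        rw [C3 v w hv', C3 w v h.2.2]
        exact D.sym v w h hv
    · intro v x y hv hx hy hxy
      rcases key v with ⟨i, rfl⟩ | hv'
      · rcases (nbr i x).1 hx with rfl | rfl <;> rcases (nbr i y).1 hy with rfl | rfl
        · exact absurd rfl hxy
        · rw [C1, C2]; exact pne i
        · rw [C1, C2]; exact (pne i).symm
        · exact absurd rfl hxy
      · rw [C3 v x hv', C3 v y hv']
        exact D.prop v x y hv ((out v hv' x).1 hx) ((out v hv' y).1 hy) hxy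

theorem decomp [Finite V] : ∀ (n : ℕ) (H : SimpleGraph V), sz H = n → Sub2 H →
    ∃ σ κ, Dec H σ κ := by
  intro n
  induction n using Nat.strong_induction_on with
  | _ n ih =>
  intro H hn h2
  subst hn
  have mono : ∀ H' : SimpleGraph V, H' ≤ H → Sub2 H' := fun H' hle v a b c x y z =>
    h2 v a b c (hle x) (hle y) (hle z)
  by_cases hac : H.IsAcyclic
  · by_cases he : ∃ u v, H.Adj u v
    · obtain ⟨u, v, huv⟩ := he
      refine dec_bridge h2 huv (isAcyclic_iff_forall_adj_isBridge.1 hac huv) ?_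
      refine ih _ ?_ _ rfl (mono _ (H.deleteEdges_le _))
      exact sz_lt (H.deleteEdges_le _) huv (by simp [deleteEdges_adj])
    · push Not at he
      refine ⟨1, fun _ _ => true, ⟨fun v h => absurd rfl h, fun v h => absurd rfl h,
        fun u v h => absurd h (he u v), fun v x y _ h => absurd h (he v x)⟩⟩
  · rw [isAcyclic_iff_free_cycleGraph] at hac
    push Not at hac
    obtain ⟨n, hn, hf⟩ := hac
    obtain ⟨k, rfl⟩ : ∃ k, n = k + 3 := ⟨n - 3, by omega⟩
    obtain ⟨f⟩ := hf
    have hadj : ∀ i : Fin (k + 3), H.Adj (f i) (f (i + 1)) := by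
      intro i
      apply f.toHom.map_adj
      rw [cycleGraph_adj]
      right
      exact add_sub_cancel_left i 1
    refine dec_cycle h2 k (fun i => f i) f.injective hadj ?_
    refine ih _ ?_ _ rfl (mono _ fun x y h => h.1)
    refine sz_lt (fun x y h => h.1) (hadj 0) (fun h => h.2.1 ⟨(0 : Fin (k + 3)), rfl⟩)

end Gr
end CCI

namespace CCI
open SimpleGraph

set_option linter.unusedSectionVars false
section Gr
variable {V : Type*} [Fintype V] [DecidableEq V]

/-- directed boundary of a set of vertices. -/
noncomputable def bd (G : SimpleGraph V) (S : V → Prop) : Finset (V × V) := by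
  classical exact Finset.univ.filter fun p => S p.1 ∧ ¬ S p.2 ∧ G.Adj p.1 p.2

theorem mem_bd {G : SimpleGraph V} {S : V → Prop} {p : V × V} :
    p ∈ bd G S ↔ S p.1 ∧ ¬ S p.2 ∧ G.Adj p.1 p.2 := by
  classical
  simp [bd]

theorem bd_odd (G : SimpleGraph V) [DecidableRel G.Adj] (S : V → Prop) [DecidablePred S]
    (h3 : ∀ v, S v → G.degree v = 3) (ho : Odd (Finset.univ.filter S).card) :
    Odd (bd G S).card := by
  classical
  let A : Finset (V × V) := Finset.univ.filter fun p => S p.1 ∧ G.Adj p.1 p.2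
  let B : Finset (V × V) := Finset.univ.filter fun p => S p.1 ∧ S p.2 ∧ G.Adj p.1 p.2
  have hA : A.card = 3 * (Finset.univ.filter S).card := by
    have : A = Finset.image (fun s : (_ : V) × V => (s.1, s.2))
        ((Finset.univ.filter S).sigma (fun v => G.neighborFinset v)) := by
      ext ⟨a, b⟩
      simp only [A, Finset.mem_filter, Finset.mem_univ, true_and, Finset.mem_image,
        Finset.mem_sigma, mem_neighborFinset]
      constructor
      · rintro ⟨h1, h2⟩; exact ⟨⟨a, b⟩, ⟨h1, h2⟩, rfl⟩
      · rintro ⟨⟨a', b'⟩, ⟨h1, h2⟩, h⟩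
        obtain ⟨rfl, rfl⟩ := Prod.mk.inj h
        exact ⟨h1, h2⟩
    rw [this, Finset.card_image_of_injective, Finset.card_sigma, Finset.sum_const_nat (m := 3)]
    · ring
    · intro v hv
      rw [card_neighborFinset_eq_degree]
      exact h3 v (Finset.mem_filter.1 hv).2
    · rintro ⟨a, b⟩ ⟨c, d⟩ h
      obtain ⟨rfl, rfl⟩ := Prod.mk.inj h
      rfl
  have hB : Even B.card := by
    have h1 : ∀ p ∈ B, Prod.swap p ∈ B := by
      rintro ⟨a, b⟩ h
      simp only [B, Finset.mem_filter, Finset.mem_univ, true_and, Prod.swap] at h ⊢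
      exact ⟨h.2.1, h.1, h.2.2.symm⟩
    have h2 := Finset.sum_involution (s := B) (f := fun _ => (1 : ZMod 2)) (fun p _ => p.swap)
      (fun p _ => by decide) (fun p hp _ h => by
        have := (Finset.mem_filter.1 hp).2.2.2
        obtain ⟨a, b⟩ := p
        obtain ⟨h, -⟩ := Prod.mk.inj h
        simp only at this h
        subst h
        exact G.irrefl this) (fun p hp => h1 p hp) (fun p _ => Prod.swap_swap p)
    simp only [Finset.sum_const, nsmul_eq_mul, mul_one] at h2
    rwa [ZMod.natCast_eq_zero_iff_even] at h2
  have hd : bd G S = A \ B := by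
    ext p
    rw [mem_bd]
    simp only [A, B, Finset.mem_sdiff, Finset.mem_filter, Finset.mem_univ, true_and]
    tauto
  have hBA : B ⊆ A := by
    intro p hp
    simp only [A, B, Finset.mem_filter, Finset.mem_univ, true_and] at hp ⊢
    exact ⟨hp.1, hp.2.2⟩
  have hc : (bd G S).card + B.card = A.card := by
    rw [hd]; exact Finset.card_sdiff_add_card_eq_card hBA
  have hAo : Odd A.card := by rw [hA]; exact Odd.mul (by decide) ho
  rw [← hc] at hAo
  by_contra hcon
  rw [Nat.not_odd_iff_even] at hcon
  exact Nat.not_even_iff_odd.2 hAo (hcon.add hB)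

theorem bd_three {G : SimpleGraph V} (hcut : NoCut G) (S : V → Prop) (ho : Odd (bd G S).card) :
    3 ≤ (bd G S).card := by
  have h1 : (bd G S).card ≠ 1 := by
    intro h
    obtain ⟨⟨a, b⟩, hab⟩ := Finset.card_eq_one.1 h
    have hm : (a, b) ∈ bd G S := by rw [hab]; simp
    rw [mem_bd] at hm
    obtain ⟨a', b', h1, h2, h3, h4⟩ := hcut S a b hm.1 hm.2.1 hm.2.2
    have hm' : (a', b') ∈ bd G S := mem_bd.2 ⟨h1, h2, h3⟩
    rw [hab, Finset.mem_singleton] at hm'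
    exact h4 (Prod.mk.inj hm')
  obtain ⟨k, hk⟩ := ho
  omega

/-- vertices which need not be matched inside `G`. -/
def Fl (G : SimpleGraph V) [DecidableRel G.Adj] : V ⊕ V → Prop
  | Sum.inl v => G.degree v ≠ 3
  | Sum.inr _ => True

/-- auxiliary graph. -/
def GS (G : SimpleGraph V) [DecidableRel G.Adj] : SimpleGraph (V ⊕ V) where
  Adj p q := p ≠ q ∧ ((Fl G p ∧ Fl G q) ∨ ∃ u v, p = Sum.inl u ∧ q = Sum.inl v ∧ G.Adj u v)
  symm := ⟨by
    rintro p q ⟨h, h' | ⟨u, v, h1, h2, h3⟩⟩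
    · exact ⟨h.symm, Or.inl h'.symm⟩
    · exact ⟨h.symm, Or.inr ⟨v, u, h2, h1, h3.symm⟩⟩⟩
  loopless := ⟨fun p h => h.1 rfl⟩

theorem no_violator {G : SimpleGraph V} [DecidableRel G.Adj] (hdeg : ∀ v, G.degree v ≤ 3)
    (hcut : NoCut G) (u : Set (V ⊕ V)) : ¬ (GS G).IsTutteViolator u := by
  classical
  intro hv
  unfold IsTutteViolator at hv
  set K := ((⊤ : (GS G).Subgraph).deleteVerts u) with hK
  have hmem : ∀ w, w ∈ K.verts ↔ w ∉ u := by intro w; simp [hK]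
  have hadj : ∀ (p q : K.verts), (GS G).Adj p q → K.coe.Adj p q := by
    intro p q h
    exact Subgraph.deleteVerts_adj.2 ⟨trivial, (hmem _).1 p.2, trivial, (hmem _).1 q.2, h⟩
  -- parity
  have hpar : Odd K.coe.oddComponents.ncard ↔ Odd u.ncard := by
    rw [odd_ncard_oddComponents, Nat.card_coe_set_eq]
    have : K.verts = uᶜ := by ext w; rw [hmem]; rfl
    rw [this]
    have h1 := Set.ncard_add_ncard_compl u
    have h2 : Nat.card (V ⊕ V) = 2 * Nat.card V := by rw [Nat.card_sum]; ring
    rw [h2] at h1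
    constructor <;> rintro ⟨k, hk⟩ <;> exact ⟨Nat.card V - k - 1, by omega⟩
  have hge : u.ncard + 2 ≤ K.coe.oddComponents.ncard := by
    by_contra hcon
    have : K.coe.oddComponents.ncard = u.ncard + 1 := by omega
    rw [this] at hpar
    by_cases h : Odd u.ncard
    · exact Nat.not_odd_iff_even.2 h.add_one (hpar.2 h)
    · exact h (hpar.1 (Nat.not_odd_iff_even.1 h).add_one)
  -- clean components
  let clean : Set K.coe.ConnectedComponent :=
    {C | C ∈ K.coe.oddComponents ∧ ∀ p ∈ C.supp, ¬ Fl G p.1}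
  have hcl : K.coe.oddComponents.ncard ≤ clean.ncard + 1 := by
    by_cases h : ∃ p : K.verts, Fl G p.1
    · obtain ⟨p, hp⟩ := h
      have : K.coe.oddComponents ⊆ insert (K.coe.connectedComponentMk p) clean := by
        intro C hC
        by_cases hc : ∀ q ∈ C.supp, ¬ Fl G q.1
        · exact Or.inr ⟨hC, hc⟩
        · push Not at hc
          obtain ⟨q, hq, hq'⟩ := hc
          left
          rw [← (ConnectedComponent.mem_supp_iff C q).1 hq]
          by_cases hpq : q = p
          · rw [hpq]
          · refine ConnectedComponent.sound (hadj q p ⟨fun h => hpq (Subtype.ext h), Or.inl ⟨hq', hp⟩⟩).reachable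
      exact (Set.ncard_le_ncard this (Set.toFinite _)).trans (Set.ncard_insert_le _ _)
    · push Not at h
      have : K.coe.oddComponents ⊆ clean := fun C hC => ⟨hC, fun p _ => h p⟩
      exact (Set.ncard_le_ncard this (Set.toFinite _)).trans (Nat.le_succ _)
  let SS : K.coe.ConnectedComponent → V → Prop := fun C v =>
    ∃ h : Sum.inl v ∈ K.verts, K.coe.connectedComponentMk ⟨Sum.inl v, h⟩ = C
  have hbd : ∀ C ∈ clean, 3 ≤ (bd G (SS C)).card := by
    intro C hC
    apply bd_three hcut
    apply bd_odd
    · rintro v ⟨h, rfl⟩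
      by_contra hne
      exact hC.2 ⟨Sum.inl v, h⟩ rfl hne
    · have ho : Odd C.supp.ncard := hC.1
      have : (Finset.univ.filter (SS C)).card = C.supp.ncard := by
        rw [← Set.ncard_coe_finset]
        refine Set.ncard_congr (fun v hv => ⟨Sum.inl v, (Finset.mem_filter.1 hv).2.1⟩) ?_ ?_ ?_
        · intro v hv
          exact (Finset.mem_filter.1 hv).2.2
        · intro a b ha hb hab
          exact Sum.inl_injective (congrArg Subtype.val hab)
        · rintro ⟨w, hw⟩ hwC
          rcases w with v | v
          · refine ⟨v, ?_, rfl⟩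
            simp only [Finset.coe_filter, Finset.mem_univ, true_and]
            exact ⟨hw, hwC⟩
          · exact absurd trivial (hC.2 _ hwC)
      rw [this]; exact ho
  let T : Finset (V × V) := Finset.univ.filter fun p => G.Adj p.1 p.2 ∧ Sum.inl p.2 ∈ u
  have hT : T.card ≤ 3 * u.ncard := by
    have h1 : T.card ≤ 3 * (T.image (fun p => p.2)).card := by
      refine Finset.card_le_mul_card_image T 3 ?_
      intro b hb
      refine le_trans ?_ (hdeg b)
      rw [← card_neighborFinset_eq_degree]
      refine Finset.card_le_card_of_injOn (fun p => p.1) ?_ ?_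
      · intro p hp
        simp only [T, Finset.coe_filter, Finset.mem_filter, Finset.mem_univ, true_and,
          Set.mem_ofPred_eq] at hp
        rw [Finset.mem_coe, mem_neighborFinset, ← hp.2]
        exact hp.1.1.symm
      · intro p hp q hq hpq
        simp only [Finset.coe_filter, Set.mem_ofPred_eq] at hp hq
        exact Prod.ext hpq (hp.2.trans hq.2.symm)
    have h2 : (T.image (fun p => p.2)).card ≤ u.ncard := by
      rw [Set.ncard_eq_toFinset_card' u]
      refine Finset.card_le_card_of_injOn Sum.inl ?_ (fun _ _ _ _ h => Sum.inl_injective h)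
      intro b hb
      obtain ⟨p, hp, rfl⟩ := Finset.mem_image.1 (Finset.mem_coe.1 hb)
      rw [Finset.mem_coe, Set.mem_toFinset]
      exact (Finset.mem_filter.1 hp).2.2
    calc _ ≤ _ := h1
      _ ≤ _ := Nat.mul_le_mul_left 3 h2
  have hcount : 3 * clean.ncard ≤ T.card := by
    rw [Set.ncard_eq_toFinset_card' clean]
    have h1 : (clean.toFinset.biUnion fun C => bd G (SS C)) ⊆ T := by
      intro p hp
      obtain ⟨C, hC, hp⟩ := Finset.mem_biUnion.1 hp
      rw [Set.mem_toFinset] at hC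
      rw [mem_bd] at hp
      obtain ⟨⟨h, hC'⟩, h2, h3⟩ := hp
      refine Finset.mem_filter.2 ⟨Finset.mem_univ _, h3, ?_⟩
      by_contra hu
      apply h2
      refine ⟨(hmem _).2 hu, ?_⟩
      rw [← hC']
      refine ConnectedComponent.sound (Adj.reachable (hadj _ _ ?_))
      refine ⟨fun h => h3.ne (Sum.inl_injective h).symm, Or.inr ⟨_, _, rfl, rfl, h3.symm⟩⟩
    refine le_trans ?_ (Finset.card_le_card h1)
    rw [Finset.card_biUnion]
    · rw [mul_comm, ← smul_eq_mul]
      refine Finset.card_nsmul_le_sum _ _ _ fun C hC => hbd C (Set.mem_toFinset.1 hC)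
    · intro C _ C' _ hne
      rw [Function.onFun, Finset.disjoint_left]
      intro p hp hp'
      rw [mem_bd] at hp hp'
      obtain ⟨⟨h, rfl⟩, -⟩ := hp
      obtain ⟨⟨h', rfl⟩, -⟩ := hp'
      exact hne rfl
  omega

theorem exists_matching {G : SimpleGraph V} [DecidableRel G.Adj] (hdeg : ∀ v, G.degree v ≤ 3)
    (hcut : NoCut G) : ∃ μ : V → V, (∀ v, μ (μ v) = v) ∧ (∀ v, μ v ≠ v → G.Adj v (μ v)) ∧
      ∀ v, G.degree v = 3 → μ v ≠ v := by
  classical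
  obtain ⟨M, hM, hsp⟩ := tutte.2 (no_violator hdeg hcut)
  have hex : ∀ w, ∃! w', M.Adj w w' := fun w => hM (hsp w)
  choose π hπ hu using hex
  have hπ' : ∀ w, (GS G).Adj w (π w) := fun w => (hπ w).adj_sub
  have hinv : ∀ p q, π p = q → π q = p := by
    rintro p q rfl
    exact (hu _ p (hπ p).symm).symm
  let μ : V → V := fun v => if h : ∃ w, π (Sum.inl v) = Sum.inl w ∧ G.Adj v w then h.choose else v
  have m1 : ∀ v w, π (Sum.inl v) = Sum.inl w → G.Adj v w → μ v = w := by
    intro v w h1 h2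
    have h : ∃ w, π (Sum.inl v) = Sum.inl w ∧ G.Adj v w := ⟨w, h1, h2⟩
    simp only [μ]
    rw [dif_pos h]
    have := h.choose_spec.1
    exact (Sum.inl_injective (h1.symm.trans this)).symm
  have m2 : ∀ v, (∃ w, π (Sum.inl v) = Sum.inl w ∧ G.Adj v w) ∨ μ v = v := by
    intro v
    by_cases h : ∃ w, π (Sum.inl v) = Sum.inl w ∧ G.Adj v w
    · exact Or.inl h
    · right; simp only [μ]; rw [dif_neg h]
  refine ⟨μ, ?_, ?_, ?_⟩
  · intro v
    rcases m2 v with ⟨w, h1, h2⟩ | h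
    · rw [m1 v w h1 h2]
      exact m1 w v (hinv _ _ h1) h2.symm
    · rw [h, h]
  · intro v hv
    rcases m2 v with ⟨w, h1, h2⟩ | h
    · rw [m1 v w h1 h2]; exact h2
    · exact absurd h hv
  · intro v hv
    obtain ⟨-, h | ⟨a, b, h1, h2, h3⟩⟩ := hπ' (Sum.inl v)
    · exact absurd hv h.1
    · obtain rfl := Sum.inl_injective h1
      rw [m1 v b h2 h3]
      exact h3.ne.symm

end Gr
end CCI

namespace CCI
open SimpleGraph

set_option linter.unusedSectionVars false
section Gr
variable {V : Type*} [Fintype V] [DecidableEq V]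

theorem exists_global {σ : Equiv.Perm V} {m : V → ZMod 11} {U : Finset V}
    (hU : ∀ e f, σ.SameCycle e f → e ∈ U → f ∈ U) (h : ∀ e ∈ U, Good σ m e) :
    ∃ x : V → ZMod 11, ∀ f ∈ U, Far (x (σ⁻¹ f)) (x f) ∧ Far (m f) (x f) ∧
      Far (m f) (x (σ⁻¹ f)) := by
  classical
  choose! X hX using h
  let r : V → V := fun f =>
    (Quotient.out (Quotient.mk (Equiv.Perm.SameCycle.setoid σ) f))
  have hr : ∀ f, σ.SameCycle (r f) f := fun f =>
    Quotient.mk_out (s := Equiv.Perm.SameCycle.setoid σ) f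
  have hr' : ∀ f, r (σ⁻¹ f) = r f := by
    intro f
    simp only [r]
    congr 1
    apply Quotient.sound (s := Equiv.Perm.SameCycle.setoid σ)
    exact ⟨1, by simp⟩
  refine ⟨fun f => X (r f) f, fun f hf => ?_⟩
  simp only [hr' f]
  exact hX (r f) (hU _ _ (hr f).symm hf) f (hr f)

theorem degree_le_of_sub3 {G : SimpleGraph V} [DecidableRel G.Adj] (h3 : Sub3 G) (v : V) :
    G.degree v ≤ 3 := by
  by_contra hcon
  push Not at hcon
  rw [← card_neighborFinset_eq_degree] at hcon
  obtain ⟨t, ht, hc⟩ := Finset.exists_subset_card_eq (show 4 ≤ _ from hcon)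
  obtain ⟨a, t', ha, rfl, hc'⟩ := Finset.card_eq_succ.1 hc
  obtain ⟨b, c, d, hbc, hbd, hcd, rfl⟩ := Finset.card_eq_three.1 hc'
  have hm : ∀ w ∈ insert a ({b, c, d} : Finset V), G.Adj v w := fun w hw =>
    (G.mem_neighborFinset v w).1 (ht hw)
  have := h3 v a b c d (hm a (by simp)) (hm b (by simp)) (hm c (by simp)) (hm d (by simp))
  simp only [Finset.mem_insert, Finset.mem_singleton, not_or] at ha
  tauto

theorem tri_out {G : SimpleGraph V} (htri : ∀ x y z, ¬ Tri G x y z) {x y z : V} (xy : G.Adj x y)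
    (yz : G.Adj y z) (xz : G.Adj x z) : ∃ w, Out x y z w ∧
      ((G.Adj x w ∧ G.Adj y w) ∨ (G.Adj y w ∧ G.Adj z w) ∨ (G.Adj x w ∧ G.Adj z w)) := by
  by_contra hcon
  push Not at hcon
  exact htri x y z ⟨xy, yz, xz, fun w hw h1 h2 => (hcon w hw).1 h1 h2,
    fun w hw h1 h2 => (hcon w hw).2.1 h1 h2, fun w hw h1 h2 => (hcon w hw).2.2 h1 h2⟩

theorem final_step {G : SimpleGraph V} (h3 : Sub3 G) (hh : NoH2 G) (hcut : NoCut G)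
    (htri : ∀ x y z, ¬ Tri G x y z) : Col G := by
  classical
  have hdeg := degree_le_of_sub3 h3
  obtain ⟨μ, μinv, μadj, μ3⟩ := exists_matching hdeg hcut
  let H : SimpleGraph V :=
    { Adj := fun v w => G.Adj v w ∧ w ≠ μ v
      symm := ⟨fun v w h => ⟨h.1.symm, fun h' => h.2 (by rw [h', μinv])⟩⟩
      loopless := ⟨fun v h => G.irrefl h.1⟩ }
  have hH2 : Sub2 H := by
    intro v a b c ha hb hc
    by_contra hcon
    push Not at hcon
    obtain ⟨h1, h2, h4⟩ := hcon
    have hd : G.degree v = 3 := by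
      refine le_antisymm (hdeg v) ?_
      rw [← card_neighborFinset_eq_degree]
      have : ({a, b, c} : Finset V) ⊆ G.neighborFinset v := by
        intro w hw
        simp only [Finset.mem_insert, Finset.mem_singleton] at hw
        rw [mem_neighborFinset]
        rcases hw with rfl | rfl | rfl
        · exact ha.1
        · exact hb.1
        · exact hc.1
      have hc3 := Finset.card_le_card this
      rwa [Finset.card_eq_three.2 ⟨a, b, c, h1, h2, h4, rfl⟩] at hc3
    have hm := μadj v (μ3 v hd)
    have := h3 v a b c (μ v) ha.1 hb.1 hc.1 hm
    have n1 := ha.2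
    have n2 := hb.2
    have n3 := hc.2
    tauto
  obtain ⟨σ, κ, D⟩ := decomp _ H rfl hH2
  let U : Finset V := Finset.univ.filter fun v => σ v ≠ v
  have mU : ∀ v, v ∈ U ↔ σ v ≠ v := fun v => by simp [U]
  have ap : ∀ v, σ (σ⁻¹ v) = v := fun v => σ.apply_symm_apply v
  have ap' : ∀ v, σ⁻¹ (σ v) = v := fun v => σ.symm_apply_apply v
  have closed1 : ∀ v, σ v ≠ v → σ (σ v) ≠ σ v := fun v h h' => h (σ.injective h')
  have Hs : ∀ v, σ v ≠ v → H.Adj v (σ v) := fun v h => (D.nb v h _).2 (Or.inl rfl)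
  have Hp : ∀ v, σ v ≠ v → H.Adj v (σ⁻¹ v) := fun v h => (D.nb v h _).2 (Or.inr rfl)
  have Gn : ∀ v, σ v ≠ v → ∀ w, G.Adj v w → w = σ v ∨ w = σ⁻¹ v ∨ w = μ v := by
    intro v hv w hw
    by_cases h : w = μ v
    · exact Or.inr (Or.inr h)
    · rcases (D.nb v hv w).1 ⟨hw, h⟩ with h | h
      · exact Or.inl h
      · exact Or.inr (Or.inl h)
  have itU : ∀ n v, σ v ≠ v → σ ((⇑σ)^[n] v) ≠ (⇑σ)^[n] v := by
    intro n v hv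
    induction n with
    | zero => exact hv
    | succ n ih => rw [Function.iterate_succ_apply']; exact closed1 _ ih
  have dist : ∀ v i j, i < Function.minimalPeriod σ v → j < Function.minimalPeriod σ v → i ≠ j →
      (⇑σ)^[i] v ≠ (⇑σ)^[j] v := by
    intro v i j hi hj hij h
    exact hij ((Function.iterate_eq_iterate_iff_of_lt_minimalPeriod hi hj).1 h)
  have per : ∀ v, (⇑σ)^[Function.minimalPeriod σ v] v = v := fun v =>
    Function.iterate_minimalPeriod
  have no1 : ∀ v, σ v ≠ v → Function.minimalPeriod σ v ≠ 1 := fun v hv h =>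
    hv (Function.minimalPeriod_eq_one_iff_isFixedPt.1 h)
  have no3 : ∀ v, σ v ≠ v → Function.minimalPeriod σ v ≠ 3 := by
    intro v hv hp
    have pv := per v
    rw [hp] at pv
    have d01 := dist v 0 1 (by omega) (by omega) (by omega)
    have d02 := dist v 0 2 (by omega) (by omega) (by omega)
    have d12 := dist v 1 2 (by omega) (by omega) (by omega)
    simp only [Function.iterate_succ, Function.iterate_zero, Function.comp, id] at pv d01 d02 d12
    have u1 := closed1 v hv
    have u2 := closed1 _ u1
    have a1 := Hs v hv
    have a2 := Hs _ u1
    have a3 := Hs _ u2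
    rw [pv] at a3
    have i0 : σ⁻¹ v = σ (σ v) := by rw [Equiv.Perm.inv_eq_iff_eq, pv]
    obtain ⟨w, ⟨o1, o2, o3⟩, hw⟩ := tri_out htri a1.1 a2.1 a3.1.symm
    have g0 := Gn v hv w
    have g1 := Gn _ u1 w
    have g2 := Gn _ u2 w
    rw [i0] at g0
    rw [ap'] at g1 g2
    rw [pv] at g2
    have inj : ∀ a b, w = μ a → w = μ b → a = b := fun a b h1 h2 => by
      rw [← μinv a, ← h1, h2, μinv]
    rcases hw with ⟨h1, h2⟩ | ⟨h1, h2⟩ | ⟨h1, h2⟩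
    · exact d01 (inj _ _ (by tauto) (by tauto))
    · exact d12 (inj _ _ (by tauto) (by tauto))
    · exact d02 (inj _ _ (by tauto) (by tauto))
  have no5 : ∀ v, σ v ≠ v → Function.minimalPeriod σ v = 5 → μ v = σ (σ v) → False := by
    intro v hv hp hm
    have pv := per v
    rw [hp] at pv
    have d := fun i j (hi : i < 5) (hj : j < 5) => dist v i j (hp ▸ hi) (hp ▸ hj)
    have d02 := d 0 2 (by omega) (by omega) (by omega)
    have d03 := d 0 3 (by omega) (by omega) (by omega)
    have d04 := d 0 4 (by omega) (by omega) (by omega)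
    have d13 := d 1 3 (by omega) (by omega) (by omega)
    have d14 := d 1 4 (by omega) (by omega) (by omega)
    have d24 := d 2 4 (by omega) (by omega) (by omega)
    have d34 := d 3 4 (by omega) (by omega) (by omega)
    clear d
    simp only [Function.iterate_succ, Function.iterate_zero, Function.comp, id] at *
    obtain ⟨v1, e1⟩ : ∃ v1, v1 = σ v := ⟨_, rfl⟩
    obtain ⟨v2, e2⟩ : ∃ v2, v2 = σ v1 := ⟨_, rfl⟩
    obtain ⟨v3, e3⟩ : ∃ v3, v3 = σ v2 := ⟨_, rfl⟩
    obtain ⟨v4, e4⟩ : ∃ v4, v4 = σ v3 := ⟨_, rfl⟩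
    have u1 := closed1 v hv
    have u2 := closed1 _ u1
    have u3 := closed1 _ u2
    have u4 := closed1 _ u3
    rw [← e1] at pv d02 d03 d04 d13 d14 d24 d34 u1 u2 u3 u4 hm
    rw [← e2] at pv d02 d03 d04 d13 d14 d24 d34 u1 u2 u3 u4 hm
    rw [← e3] at pv d03 d04 d13 d14 d24 d34 u2 u3 u4
    rw [← e4] at pv d04 d14 d24 d34 u3 u4
    have a0 := (Hs v hv).1
    have a1 := (Hs v1 (by rw [← e2]; exact u1)).1
    have a2 := (Hs v2 (by rw [← e3]; exact u2)).1
    have a3 := (Hs v3 (by rw [← e4]; exact u3)).1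
    have a4 := (Hs v4 u4).1
    rw [← e1] at a0
    rw [← e2] at a1
    rw [← e3] at a2
    rw [← e4] at a3
    rw [pv] at a4
    have ch : G.Adj v v2 := by
      have := μadj v (by rw [hm]; exact d02.symm)
      rwa [hm] at this
    have mm : μ v2 = v := by rw [← hm, μinv]
    have i0 : σ⁻¹ v = v4 := by rw [Equiv.Perm.inv_eq_iff_eq, pv]
    have i2 : σ⁻¹ v2 = v1 := by rw [Equiv.Perm.inv_eq_iff_eq, e2]
    have g0 := fun w h => Gn v hv w h
    have g2 := fun w h => Gn v2 (by rw [← e3]; exact u2) w h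
    rw [i0, ← e1, hm] at g0
    rw [i2, ← e3, mm] at g2
    obtain ⟨w, ⟨o1, o2, o3⟩, hw⟩ := tri_out htri a0 a1 ch
    rcases hw with ⟨h1, h2⟩ | ⟨h1, h2⟩ | ⟨h1, h2⟩
    · have hw : w = v4 := by
        rcases g0 w h1 with h | h | h
        · exact absurd h o2
        · exact h
        · exact absurd h o3
      subst hw
      exact hh v2 w v v1 v3 d24 d03.symm d13.symm ch.symm a1.symm a4 h2.symm a0 a2 a3.symm
    · have hw : w = v3 := by
        rcases g2 w h2 with h | h | h
        · exact h
        · exact absurd h o2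
        · exact absurd h o1
      subst hw
      exact hh v w v1 v2 v4 d03 d14.symm d24.symm a0 ch h1.symm h2.symm a1 a4.symm a3
    · have hw : w = v4 := by
        rcases g0 w h1 with h | h | h
        · exact absurd h o2
        · exact h
        · exact absurd h o3
      have hw' : w = v3 := by
        rcases g2 w h2 with h | h | h
        · exact h
        · exact absurd h o2
        · exact absurd h o1
      exact d34 (hw'.symm.trans hw)
  have oddge : ∀ v, σ v ≠ v → 5 ≤ Function.minimalPeriod σ v := by
    intro v hv
    obtain ⟨k, hk⟩ := D.odd v hv
    have := no1 v hv
    have := no3 v hv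
    omega
  have S : Sys σ μ U := by
    refine ⟨μinv, ?_, fun e he => D.odd e ((mU e).1 he), fun e he => oddge e ((mU e).1 he), ?_, ?_⟩
    · rintro e f hef he
      rw [mU] at he ⊢
      intro hf
      exact he ((Equiv.Perm.SameCycle.apply_eq_self_iff hef).2 hf)
    · intro e he h
      exact (Hs e ((mU e).1 he)).2 h.symm
    · intro e he hne hsc
      have he' := (mU e).1 he
      obtain ⟨k, hk⟩ := D.odd e he'
      have h5 := oddge e he'
      by_contra hcon
      have hp : Function.minimalPeriod σ e = 5 := by omega
      obtain ⟨n, hn⟩ := hsc.exists_nat_pow_eq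
      rw [Equiv.Perm.coe_pow, ← Function.iterate_mod_minimalPeriod_eq, hp] at hn
      have hlt : n % 5 < 5 := Nat.mod_lt _ (by norm_num)
      generalize n % 5 = r at hn hlt
      have pv := per e
      rw [hp] at pv
      interval_cases r
      · exact hne hn.symm
      · exact (Hs e he').2 hn
      · exact no5 e he' hp hn.symm
      · -- reverse the chord
        refine no5 (σ (σ (σ e))) (itU 3 e he') ?_ ?_
        · rw [← hp]
          exact Function.minimalPeriod_apply_iterate (Function.minimalPeriod_pos_iff_mem_periodicPts.1 (by omega)) 3
        · have : μ e = σ (σ (σ e)) := hn.symm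
          rw [← this, μinv]
          rw [this]; exact pv.symm
      · refine (Hp e he').2 ?_
        rw [Equiv.Perm.inv_eq_iff_eq, ← hn]
        exact pv.symm
  obtain ⟨m, m1, m2, m3⟩ := solvable U S (fun _ => true)
  obtain ⟨x, hx⟩ := exists_global S.closed m3
  have low : ∀ a, a ∈ U → μ a ∉ U → m a = 0 ∨ m a = 1 ∨ m a = 2 := fun a ha hb => by
    have := inL_true (m2 a ha (Or.inl hb))
    tauto
  let C : V → V → ZMod 11 := fun u v =>
    if v = μ u then (if u ∈ U then m u else if v ∈ U then m v else 1) else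
    if u ∈ U then (if v = σ u then x u else x v) else if κ u v then 5 else 8
  have CM : ∀ u, u ∈ U → C u (μ u) = m u := fun u hu => by simp [C, hu]
  have CM' : ∀ u, u ∉ U → C u (μ u) = if μ u ∈ U then m (μ u) else 1 := fun u hu => by
    simp [C, hu]
  have Cs : ∀ u, u ∈ U → C u (σ u) = x u := fun u hu => by
    have := (Hs u ((mU u).1 hu)).2
    simp [C, hu, this]
  have Cp : ∀ u, u ∈ U → C u (σ⁻¹ u) = x (σ⁻¹ u) := fun u hu => by
    have h1 := (Hp u ((mU u).1 hu)).2
    have h2 := D.three ((mU u).1 hu)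
    simp only [C]
    rw [if_neg h1, if_pos hu, if_neg h2.symm]
  have Ck : ∀ u v, u ∉ U → H.Adj u v → C u v = if κ u v then 5 else 8 := fun u v hu hv => by
    simp only [C]
    rw [if_neg hv.2, if_neg hu]
  have nU : ∀ u, u ∉ U → σ u = u := fun u hu => by
    by_contra h; exact hu ((mU u).2 h)
  have pU : ∀ u, u ∈ U → σ⁻¹ u ∈ U := fun u hu => by
    rw [mU] at hu ⊢
    intro h
    rw [ap] at h
    apply hu
    conv_lhs => rw [h, ap]
  have sU : ∀ u, u ∈ U → σ u ∈ U := fun u hu => by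
    rw [mU] at hu ⊢
    exact closed1 u hu
  have cs : ∀ u v, G.Adj u v → v = μ u ∨ (u ∈ U ∧ (v = σ u ∨ v = σ⁻¹ u)) ∨ (u ∉ U ∧ H.Adj u v) := by
    intro u v huv
    by_cases h : v = μ u
    · exact Or.inl h
    · right
      by_cases hu : u ∈ U
      · exact Or.inl ⟨hu, (D.nb u ((mU u).1 hu) v).1 ⟨huv, h⟩⟩
      · exact Or.inr ⟨hu, huv, h⟩
  refine ⟨C, ?_, ?_⟩
  · intro u v huv
    rcases cs u v huv with rfl | ⟨hu, rfl | rfl⟩ | ⟨hu, hv⟩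
    · have e : C (μ u) u = C (μ u) (μ (μ u)) := by rw [μinv]
      rw [e]
      by_cases hu : u ∈ U
      · rw [CM u hu]
        by_cases hm : μ u ∈ U
        · rw [CM _ hm, m1 u hu hm]
        · rw [CM' _ hm, μinv, if_pos hu]
      · rw [CM' u hu]
        by_cases hm : μ u ∈ U
        · rw [CM _ hm, if_pos hm]
        · rw [CM' _ hm, μinv, if_neg hu, if_neg hm]
    · rw [Cs u hu]
      have := Cp _ (sU u hu)
      rw [ap'] at this
      exact this.symm
    · rw [Cp u hu]
      have := Cs _ (pU u hu)
      rw [ap] at this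
      exact this.symm
    · have hv' : v ∉ U := by
        intro hv'
        rcases (D.nb v ((mU v).1 hv') u).1 hv.symm with h | h
        · exact hu (h ▸ sU v hv')
        · exact hu (h ▸ pU v hv')
      rw [Ck u v hu hv, Ck v u hv' hv.symm, D.sym u v hv (nU u hu)]
  · have half : ∀ v b, G.Adj v b → b ≠ μ v → Far (C v (μ v)) (C v b) := by
      intro v b hb hne
      rcases cs v b hb with h | ⟨hu, h⟩ | ⟨hu, hv⟩
      · exact absurd h hne
      · obtain ⟨f1, f2, f3⟩ := hx v hu
        rw [CM v hu]
        rcases h with rfl | rfl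
        · rw [Cs v hu]; exact f2
        · rw [Cp v hu]; exact f3
      · have hz : C v (μ v) = 0 ∨ C v (μ v) = 1 ∨ C v (μ v) = 2 := by
          rw [CM' v hu]
          split_ifs with hm
          · exact low _ hm (by rw [μinv]; exact hu)
          · exact Or.inr (Or.inl rfl)
        rw [Ck v b hu hv]
        have := far012 _ hz
        split_ifs
        · exact this.1
        · exact this.2
    intro v a b ha hb hab
    by_cases h1 : a = μ v
    · subst h1; exact half v b hb hab.symm
    by_cases h2 : b = μ v
    · subst h2; exact (half v a ha hab).symm
    rcases cs v a ha with h | ⟨hu, h⟩ | ⟨hu, hv⟩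
    · exact absurd h h1
    · rcases cs v b hb with h' | ⟨-, h'⟩ | ⟨hu', -⟩
      · exact absurd h' h2
      · obtain ⟨f1, f2, f3⟩ := hx v hu
        rcases h with rfl | rfl <;> rcases h' with rfl | rfl
        · exact absurd rfl hab
        · rw [Cs v hu, Cp v hu]; exact f1.symm
        · rw [Cs v hu, Cp v hu]; exact f1
        · exact absurd rfl hab
      · exact absurd hu hu'
    · rw [Ck v a hu hv, Ck v b hu ⟨hb, h2⟩]
      have := D.prop v a b (nU v hu) hv ⟨hb, h2⟩ hab
      revert this
      cases κ v a <;> cases κ v b <;> simp <;> decide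

theorem all_col : ∀ (n : ℕ) (G : SimpleGraph V), sz G = n → Sub3 G → NoH2 G → Col G := by
  intro n
  induction n using Nat.strong_induction_on with
  | _ n ih =>
  intro G hn h3 hh
  subst hn
  have IH : ∀ G' : SimpleGraph V, sz G' < sz G → Sub3 G' → NoH2 G' → Col G' :=
    fun G' h => ih _ h G' rfl
  by_cases hcut : NoCut G
  · by_cases ht : ∃ x y z, Tri G x y z
    · obtain ⟨x, y, z, h⟩ := ht
      exact tri_step h3 hh hcut IH h
    · push Not at ht
      exact final_step h3 hh hcut ht
  · exact cut_step h3 hh IH hcut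

end Gr
end CCI

/-- If `G` is a finite simple graph of maximum degree at most `3` not containing `H₂`
(the graph obtained from `K₄` by subdividing one edge) as a subgraph, then the line graph of `G`
admits an `(11,3)`-coloring, i.e. the circular chromatic index of `G` is at most `11/3`. -/
theorem circular_chromatic_index_le_eleven_thirds_of_no_H2
    {V : Type*} [Fintype V] [DecidableEq V] (G : SimpleGraph V) [DecidableRel G.Adj]
    (hdeg : ∀ v, G.degree v ≤ 3)
    (hH2 : ¬ ContainsSubgraph H2 G) :
    ∃ f, IsPQColoring G.lineGraph 11 3 f := by
  have h3 : CCI.Sub3 G := by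
    intro v a b c d ha hb hc hd
    by_contra hcon
    push Not at hcon
    obtain ⟨h1, h2, h3, h4, h5, h6⟩ := hcon
    have hs : ({a, b, c, d} : Finset V) ⊆ G.neighborFinset v := by
      intro x hx
      simp only [Finset.mem_insert, Finset.mem_singleton] at hx
      rw [mem_neighborFinset]
      rcases hx with rfl | rfl | rfl | rfl <;> assumption
    have hc4 : ({a, b, c, d} : Finset V).card = 4 := by
      simp [h1, h2, h3, h4, h5, h6]
    have := Finset.card_le_card hs
    rw [hc4, card_neighborFinset_eq_degree] at this
    have := hdeg v
    omega
  have hN : CCI.NoH2 G := by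
    intro a b c d s hab hsc hsd hac had hbc hbd hcd has hbs
    apply hH2
    refine ⟨![a, b, c, d, s], ?_, ?_⟩
    · have := hac.ne
      have := had.ne
      have := hbc.ne
      have := hbd.ne
      have := hcd.ne
      have := has.ne
      have := hbs.ne
      intro x y hxy
      fin_cases x <;> fin_cases y <;> simp at hxy ⊢ <;> grind
    · intro x y hxy
      fin_cases x <;> fin_cases y <;> simp [H2] at hxy ⊢ <;>
        first | assumption | (apply SimpleGraph.Adj.symm; assumption)
  obtain ⟨c, hcs, hcf⟩ := CCI.all_col _ G rfl h3 hN
  have key : ∀ a b : ZMod 11, CCI.Far a b →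
      (3 : ℤ) ≤ |(a.val : ℤ) - (b.val : ℤ)| ∧ |(a.val : ℤ) - (b.val : ℤ)| ≤ 11 - 3 := by
    unfold CCI.Far
    decide
  have hval : ∀ (e : Sym2 V) (u v : V), e = s(u, v) → G.Adj u v →
      c e.out.1 e.out.2 = c u v := by
    intro e u v he hadj
    have h1 : s(e.out.1, e.out.2) = s(u, v) := by
      rw [← he]; exact e.out_eq
    rcases Sym2.eq_iff.1 h1 with ⟨h, h'⟩ | ⟨h, h'⟩
    · rw [h, h']
    · rw [h, h']; exact hcs _ _ hadj.symm
  refine ⟨fun e => (c e.1.out.1 e.1.out.2).val, fun e => ZMod.val_lt _, ?_⟩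
  rintro ⟨e, he⟩ ⟨f, hf⟩ hadj
  rw [lineGraph_adj_iff_exists] at hadj
  obtain ⟨hne, v, hve, hvf⟩ := hadj
  obtain ⟨x, rfl⟩ := Sym2.mem_iff_exists.1 hve
  obtain ⟨y, rfl⟩ := Sym2.mem_iff_exists.1 hvf
  have hxy : x ≠ y := fun h => hne (by subst h; rfl)
  have hx : G.Adj v x := he
  have hy : G.Adj v y := hf
  have := key _ _ (hcf v x y hx hy hxy)
  simp only [hval _ v x rfl hx, hval _ v y rfl hy]
  exact_mod_cast this
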